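/- Let (n,p) be an admissible Strichartz pair and let δ be a real number satisfying: 0 < δ < 1/2 − 3/p when n = 1; 0 < δ < 1/2 − 2/p when n ∈ {2,3}; and 0 < δ < 1/2 − (n+3)/(np) when n ≥ 4. Then there is a constant C > 0 such that for all reals 1 ≤ M ≤ N, every set R in the class 𝓡_M(N), and every finitely supported a : ℤⁿ → ℂ with supp a ⊆ R, one has ‖u_a‖_{L^p([0,2π]×[0,2π]ⁿ)} ≤ C · N^{n/2 − (n+2)/p} · (M/N)^δ · ‖a‖_{ℓ²}. -/

import Mathlib

open MeasureTheory Real Finset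

noncomputable section

/-- The free Schrödinger wave `u_a(t,x) = Σ_ξ a(ξ) e^{i(x·ξ − t|ξ|²)}` on the torus. -/
def tWave (n : ℕ) (a : (Fin n → ℤ) →₀ ℂ) (t : ℝ) (x : Fin n → ℝ) : ℂ :=
  ∑ ξ ∈ a.support, a ξ *
    Complex.exp (Complex.I *
      (((∑ i, x i * (ξ i : ℝ)) - t * ∑ i, ((ξ i : ℝ)) ^ 2 : ℝ) : ℂ))

/-- The ℓ² norm of the Fourier coefficients. -/
def l2Norm (n : ℕ) (a : (Fin n → ℤ) →₀ ℂ) : ℝ :=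
  Real.sqrt (∑ ξ ∈ a.support, ‖a ξ‖ ^ 2)

/-- Euclidean norm of a lattice point in `ℤⁿ`. -/
def znorm (n : ℕ) (ξ : Fin n → ℤ) : ℝ :=
  Real.sqrt (∑ i, ((ξ i : ℝ)) ^ 2)

/-- The period box `[0,2π] × [0,2π]ⁿ`. -/
def stBox (n : ℕ) : Set (ℝ × (Fin n → ℝ)) :=
  Set.Icc 0 (2 * π) ×ˢ Set.univ.pi fun _ => Set.Icc 0 (2 * π)

/-- The `L^p` norm over the period box `[0,2π] × [0,2π]ⁿ`. -/
def boxLpNorm (n : ℕ) (p : ℝ) (f : ℝ → (Fin n → ℝ) → ℂ) : ℝ :=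
  (∫ q in stBox n, ‖f q.1 q.2‖ ^ p) ^ (1 / p)

end

/-- `(n,p)` is an admissible Strichartz pair. -/
def AdmissibleStrichartz (n : ℕ) (p : ℝ) : Prop :=
  (n = 1 ∧ 6 < p) ∨ ((n = 2 ∨ n = 3) ∧ 4 < p) ∨ (4 ≤ n ∧ 2 * ((n : ℝ) + 4) / n ≤ p)

/-- `R ∈ 𝓡_M(N)`: `R` is the intersection of the lattice points of a cube of side length `2N`
(centered at a lattice point `ξ₀`) with a strip `{ξ : |a·ξ − A| ≤ M}` of width `2M`. -/
def InStripClass (n : ℕ) (M N : ℝ) (R : Set (Fin n → ℤ)) : Prop :=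
  ∃ (ξ₀ : Fin n → ℤ) (v : Fin n → ℝ) (A : ℝ),
    (∑ i, v i ^ 2) = 1 ∧
    R = {ξ | (∀ i, |(ξ i : ℝ) - (ξ₀ i : ℝ)| ≤ N) ∧ |(∑ i, v i * (ξ i : ℝ)) - A| ≤ M}

/-- The additive character `θ ↦ exp (2πiθ)`. -/
noncomputable def ee (θ : ℝ) : ℂ := Complex.exp (2 * π * θ * Complex.I)

/-- Distance to the nearest integer. -/
noncomputable def nd (θ : ℝ) : ℝ := |θ - round θ|

lemma ee_add (a b : ℝ) : ee (a + b) = ee a * ee b := by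
  simp only [ee, ← Complex.exp_add]; congr 1; push_cast; ring

lemma ee_int (m : ℤ) : ee m = 1 := by
  rw [ee, Complex.exp_eq_one_iff]; exact ⟨m, by push_cast; ring⟩

lemma ee_zero : ee 0 = 1 := by simp [ee]

lemma norm_ee (θ : ℝ) : ‖ee θ‖ = 1 := by
  have : ee θ = Complex.exp ((2 * π * θ : ℝ) * Complex.I) := by simp [ee]
  rw [this, Complex.norm_exp_ofReal_mul_I]

lemma ee_neg (θ : ℝ) : ee (-θ) = (starRingEnd ℂ) (ee θ) := by
  simp only [ee, ← Complex.exp_conj]; congr 1; simp [Complex.conj_ofNat]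

lemma ee_sub (a b : ℝ) : ee (a - b) = ee a * (starRingEnd ℂ) (ee b) := by
  rw [sub_eq_add_neg, ee_add, ee_neg]

lemma ee_sum {ι : Type*} (s : Finset ι) (f : ι → ℝ) : ee (∑ i ∈ s, f i) = ∏ i ∈ s, ee (f i) := by
  classical
  induction s using Finset.induction_on with
  | empty => simp [ee_zero]
  | insert a s ha ih => rw [Finset.sum_insert ha, Finset.prod_insert ha, ee_add, ih]

lemma nd_nonneg (θ : ℝ) : 0 ≤ nd θ := abs_nonneg _

lemma four_nd_le (θ : ℝ) : 4 * nd θ ≤ ‖ee θ - 1‖ := by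
  have h1 : ee θ = Complex.exp (Complex.I * ((2 * π * (θ - round θ) : ℝ) : ℂ)) := by
    have : θ = (θ - round θ) + ((round θ : ℤ) : ℝ) := by ring
    conv_lhs => rw [this, ee_add, ee_int, mul_one]
    simp only [ee]; congr 1; push_cast; ring
  rw [h1, Complex.norm_exp_I_mul_ofReal_sub_one]
  have h2 : |θ - round θ| ≤ 1 / 2 := abs_sub_round θ
  have h3 : 2 / π * |π * (θ - round θ)| ≤ |Real.sin (π * (θ - round θ))| := by
    apply Real.mul_abs_le_abs_sin
    rw [abs_mul, abs_of_pos Real.pi_pos]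
    nlinarith [Real.pi_pos]
  rw [abs_mul, abs_of_pos Real.pi_pos] at h3
  have h4 : 2 * π * (θ - round θ) / 2 = π * (θ - round θ) := by ring
  rw [h4, norm_mul, nd]
  have h5 : 2 / π * (π * |θ - round θ|) = 2 * |θ - round θ| := by
    field_simp
  rw [h5] at h3
  simp only [Real.norm_eq_abs, Nat.abs_ofNat]
  linarith

/-- Order-`k` smoothness of a sequence at scale `ε⁻¹`. -/
def Smo (ε : ℝ) : ℕ → ℝ → (ℤ → ℝ) → Prop
  | 0, C, g => ∀ m, |g m| ≤ C
  | k + 1, C, g => (∀ m, |g m| ≤ C) ∧ Smo ε k (C * ε) (fun m => g (m + 1) - g m)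

lemma Smo.bound {ε C : ℝ} {k : ℕ} {g : ℤ → ℝ} (h : Smo ε k C g) (m : ℤ) : |g m| ≤ C := by
  cases k with
  | zero => exact h m
  | succ k => exact h.1 m

lemma Smo.shift {ε : ℝ} {k : ℕ} : ∀ {C : ℝ} {g : ℤ → ℝ}, Smo ε k C g → ∀ c : ℤ,
    Smo ε k C (fun m => g (m + c)) := by
  induction k with
  | zero => intro C g h c m; exact h _
  | succ k ih =>
    intro C g h c
    refine ⟨fun m => h.1 _, ?_⟩
    have := ih h.2 c
    convert this using 3
    ring_nf

lemma Smo.add {ε : ℝ} {k : ℕ} : ∀ {C D : ℝ} {f g : ℤ → ℝ}, Smo ε k C f → Smo ε k D g →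
    Smo ε k (C + D) (fun m => f m + g m) := by
  induction k with
  | zero => intro C D f g hf hg m; exact (abs_add_le _ _).trans (add_le_add (hf m) (hg m))
  | succ k ih =>
    intro C D f g hf hg
    refine ⟨fun m => (abs_add_le _ _).trans (add_le_add (hf.1 m) (hg.1 m)), ?_⟩
    have := ih hf.2 hg.2
    convert this using 1
    · ring
    · funext m; ring

lemma Smo.const_mul {ε : ℝ} {k : ℕ} (c : ℝ) : ∀ {C : ℝ} {g : ℤ → ℝ}, Smo ε k C g →
    Smo ε k (|c| * C) (fun m => c * g m) := by
  induction k with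
  | zero => intro C g h m; rw [abs_mul]; exact mul_le_mul_of_nonneg_left (h m) (abs_nonneg _)
  | succ k ih =>
    intro C g h
    refine ⟨fun m => by rw [abs_mul]; exact mul_le_mul_of_nonneg_left (h.1 m) (abs_nonneg _), ?_⟩
    have := ih h.2
    convert this using 1
    · ring
    · funext m; ring

lemma Smo.pred {ε : ℝ} {k : ℕ} : ∀ {C : ℝ} {g : ℤ → ℝ}, Smo ε (k + 1) C g → Smo ε k C g := by
  induction k with
  | zero => intro C g h; exact h.1
  | succ k ih => intro C g h; exact ⟨h.1, ih h.2⟩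

lemma Smo.mul {ε : ℝ} {k : ℕ} : ∀ {C D : ℝ} {f g : ℤ → ℝ}, Smo ε k C f → Smo ε k D g →
    Smo ε k (2 ^ k * (C * D)) (fun m => f m * g m) := by
  have key : ∀ {C D : ℝ} {f g : ℤ → ℝ} (m : ℤ), |f m| ≤ C → |g m| ≤ D → |f m * g m| ≤ C * D := by
    intro C D f g m hf hg
    rw [abs_mul]
    exact mul_le_mul hf hg (abs_nonneg _) ((abs_nonneg _).trans hf)
  induction k with
  | zero => intro C D f g hf hg m; simpa using key m (hf m) (hg m)
  | succ k ih =>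
    intro C D f g hf hg
    refine ⟨fun m => ?_, ?_⟩
    · refine (key m (hf.1 m) (hg.1 m)).trans ?_
      have h0 : 0 ≤ C * D := (abs_nonneg _).trans (key m (hf.1 m) (hg.1 m))
      have h1 : (1 : ℝ) ≤ 2 ^ (k + 1) := one_le_pow₀ (by norm_num)
      nlinarith
    · have h1 := ih hf.2 (hg.pred.shift 1)
      have h2 := ih hf.pred hg.2
      have := h1.add h2
      convert this using 1
      · ring
      · funext m; ring

/-- One-sided moving average of length `N`. -/
noncomputable def avgN (N : ℕ) (g : ℤ → ℝ) (m : ℤ) : ℝ := (∑ i ∈ range N, g (m - i)) / N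

lemma Smo.avgN {N : ℕ} (hN : 1 ≤ N) {k : ℕ} {C : ℝ} {g : ℤ → ℝ} (h : Smo (1 / (N : ℝ)) k C g) :
    Smo (1 / (N : ℝ)) (k + 1) (2 * C) (_root_.avgN N g) := by
  have hN' : (0 : ℝ) < N := by exact_mod_cast hN
  have hC : 0 ≤ C := (abs_nonneg _).trans (h.bound 0)
  refine ⟨fun m => ?_, ?_⟩
  · rw [_root_.avgN, abs_div, abs_of_pos hN', div_le_iff₀ hN']
    refine (Finset.abs_sum_le_sum_abs _ _).trans ?_
    refine (Finset.sum_le_card_nsmul _ _ C fun i _ => h.bound _).trans ?_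
    simp only [card_range, nsmul_eq_mul]
    nlinarith [mul_nonneg hC hN'.le]
  · have h1 := (h.shift 1).const_mul (1 / (N : ℝ))
    have h2 := (h.shift (1 - N)).const_mul (-(1 / (N : ℝ)))
    have h3 := h1.add h2
    rw [abs_neg, abs_of_pos (by positivity : (0 : ℝ) < 1 / N)] at h3
    convert h3 using 1
    · ring
    · funext m
      have : ∑ i ∈ range N, g (m + 1 - i) - ∑ i ∈ range N, g (m - i) = g (m + 1) - g (m + 1 - N) := by
        rw [← Finset.sum_sub_distrib]
        have := Finset.sum_range_sub' (fun i : ℕ => g (m + 1 - i)) N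
        simp only [Nat.cast_zero, sub_zero] at this
        rw [← this]
        refine Finset.sum_congr rfl fun i _ => ?_
        push_cast; ring_nf
      simp only [_root_.avgN]
      rw [← sub_div, this]
      have : m + (1 - (N : ℤ)) = m + 1 - N := by ring
      rw [this]; ring

/-- A smooth cutoff, equal to one on `[-N, N]` and supported in `[-4N, 4N]`. -/
noncomputable def bump (N : ℕ) : ℤ → ℝ :=
  avgN N (avgN N (avgN N (fun m => if -(4 * N : ℤ) ≤ m ∧ m ≤ N then 1 else 0)))

lemma bump_smo {N : ℕ} (hN : 1 ≤ N) : Smo (1 / (N : ℝ)) 3 8 (bump N) := by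
  have h0 : Smo (1 / (N : ℝ)) 0 1 (fun m => if -(4 * N : ℤ) ≤ m ∧ m ≤ N then (1 : ℝ) else 0) := by
    intro m; dsimp only; split_ifs <;> simp
  have := ((h0.avgN hN).avgN hN).avgN hN
  norm_num only [zero_add, mul_one, Nat.reduceAdd] at this
  exact this

lemma avgN_nonneg {N : ℕ} {g : ℤ → ℝ} (h : ∀ m, 0 ≤ g m) (m : ℤ) : 0 ≤ avgN N g m :=
  div_nonneg (Finset.sum_nonneg fun _ _ => h _) (Nat.cast_nonneg _)

lemma avgN_eq {N : ℕ} (hN : 1 ≤ N) {g : ℤ → ℝ} {m : ℤ} {c : ℝ}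
    (h : ∀ j, m - N ≤ j → j ≤ m → g j = c) : avgN N g m = c := by
  have hN' : (0 : ℝ) < N := by exact_mod_cast hN
  rw [avgN, Finset.sum_congr rfl (fun (i : ℕ) hi => h (m - (i : ℤ)) (by have := mem_range.1 hi; omega) (by omega))]
  simp; field_simp

lemma avgN_le {N : ℕ} (hN : 1 ≤ N) {g : ℤ → ℝ} {c : ℝ} (h : ∀ j, g j ≤ c) (m : ℤ) :
    avgN N g m ≤ c := by
  have hN' : (0 : ℝ) < N := by exact_mod_cast hN
  rw [avgN, div_le_iff₀ hN']
  refine (Finset.sum_le_card_nsmul _ _ c fun i _ => h _).trans ?_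
  simp [mul_comm]

lemma bump_nonneg (N : ℕ) (m : ℤ) : 0 ≤ bump N m :=
  avgN_nonneg (avgN_nonneg (avgN_nonneg fun m => by split_ifs <;> norm_num)) m

lemma bump_le_one {N : ℕ} (hN : 1 ≤ N) (m : ℤ) : bump N m ≤ 1 :=
  avgN_le hN (avgN_le hN (avgN_le hN fun m => by split_ifs <;> norm_num)) m

lemma bump_eq_one {N : ℕ} (hN : 1 ≤ N) {m : ℤ} (hm : |m| ≤ N) : bump N m = 1 := by
  rw [abs_le] at hm
  refine avgN_eq hN fun j h1 h2 => avgN_eq hN fun j' h1' h2' => avgN_eq hN fun j'' h1'' h2'' => ?_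
  rw [if_pos]; omega

lemma bump_eq_zero {N : ℕ} (hN : 1 ≤ N) {m : ℤ} (hm : 4 * (N : ℤ) < |m|) : bump N m = 0 := by
  rw [lt_abs] at hm
  refine avgN_eq hN fun j h1 h2 => avgN_eq hN fun j' h1' h2' => avgN_eq hN fun j'' h1'' h2'' => ?_
  rw [if_neg]; omega

/-- Majorant for smooth exponential sums of length `N`. -/
noncomputable def Pm (N : ℕ) (θ : ℝ) : ℝ := N / (1 + N * nd θ) ^ 3

lemma sum_abel {g : ℤ → ℝ} {B : ℤ} (hg : ∀ m, B ≤ |m| → g m = 0) (θ : ℝ) :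
    (∑ m ∈ Icc (-B) B, (g m : ℂ) * ee (m * θ)) * (1 - ee θ) =
      ee θ * ∑ m ∈ Icc (-B) B, ((g (m + 1) - g m : ℝ) : ℂ) * ee (m * θ) := by
  have h1 : ∑ m ∈ Icc (-B) B, (g (m + 1) : ℂ) * ee ((m + 1 : ℤ) * θ) =
      ∑ m ∈ Icc (-B) B, (g m : ℂ) * ee (m * θ) := by
    have : ∑ m ∈ Icc (-B) B, (g (m + 1) : ℂ) * ee ((m + 1 : ℤ) * θ) =
        ∑ m ∈ Icc (-B + 1) (B + 1), (g m : ℂ) * ee (m * θ) := by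
      rw [← Finset.map_add_right_Icc, Finset.sum_map]; rfl
    rw [this]
    apply Finset.sum_congr_of_eq_on_inter
    · intro m h1 h2
      rw [hg m (by simp only [mem_Icc] at h1 h2; rw [le_abs]; omega)]; simp
    · intro m h1 h2
      rw [hg m (by simp only [mem_Icc] at h1 h2; rw [le_abs]; omega)]; simp
    · intros; rfl
  have h2 : ∀ m : ℤ, ee θ * (((g (m + 1) - g m : ℝ) : ℂ) * ee (m * θ)) =
      (g (m + 1) : ℂ) * ee ((m + 1 : ℤ) * θ) - ee θ * ((g m : ℂ) * ee (m * θ)) := by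
    intro m
    have : ((m + 1 : ℤ) : ℝ) * θ = m * θ + θ := by push_cast; ring
    rw [this, ee_add]; push_cast; ring
  rw [Finset.mul_sum, Finset.sum_congr rfl (fun m _ => h2 m), Finset.sum_sub_distrib, h1,
    ← Finset.mul_sum]
  ring

lemma Smo.sum_bound {ε : ℝ} {k : ℕ} : ∀ {C : ℝ} {g : ℤ → ℝ} {B : ℤ}, Smo ε k C g → 0 ≤ B →
    (∀ m, B - k ≤ |m| → g m = 0) → ∀ θ,
    ‖∑ m ∈ Icc (-B) B, (g m : ℂ) * ee (m * θ)‖ * ‖1 - ee θ‖ ^ k ≤ (2 * B + 1) * (C * ε ^ k) := by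
  induction k with
  | zero =>
    intro C g B h hB hg θ
    simp only [pow_zero, mul_one]
    refine (norm_sum_le _ _).trans ?_
    refine (Finset.sum_le_card_nsmul _ _ C fun m _ => ?_).trans ?_
    · rw [norm_mul, norm_ee, mul_one, Complex.norm_real]; exact h m
    · rw [nsmul_eq_mul, Int.card_Icc]
      have h1 : ((B + 1 - -B).toNat : ℤ) = 2 * B + 1 := by omega
      have : (((B + 1 - -B).toNat : ℕ) : ℝ) = 2 * B + 1 := by exact_mod_cast h1
      rw [this]
  | succ k ih =>
    intro C g B h hB hg θ
    have h1 := sum_abel (B := B) (g := g) (fun m hm => hg m (by push_cast; omega)) θ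
    rw [pow_succ', ← mul_assoc, ← norm_mul, h1, norm_mul, norm_ee, one_mul]
    have := ih h.2 hB (fun m hm => ?_) θ
    · refine this.trans (le_of_eq ?_); ring
    · push_cast at hg
      rw [hg m (by omega), hg (m + 1) ?_, sub_zero]
      have := abs_sub_abs_le_abs_sub m (m+1)
      have h3 : |m - (m + 1)| = 1 := by simp
      rw [h3] at this
      omega

/-- Exponential sums of products of two shifted bumps. -/
lemma bump_sum_le {N : ℕ} (hN : 1 ≤ N) (h : ℤ) {B : ℤ} (hB : 4 * (N : ℤ) ≤ B) (θ : ℝ) :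
    ‖∑ m ∈ Icc (-B) B, ((bump N m * bump N (m + h) : ℝ) : ℂ) * ee (m * θ)‖ ≤ 20000 * Pm N θ := by
  have hN' : (1 : ℝ) ≤ N := by exact_mod_cast hN
  have hs : ∑ m ∈ Icc (-B) B, ((bump N m * bump N (m + h) : ℝ) : ℂ) * ee (m * θ) =
      ∑ m ∈ Icc (-(4 * N + 4 : ℤ)) (4 * N + 4), ((bump N m * bump N (m + h) : ℝ) : ℂ) * ee (m * θ) := by
    apply Finset.sum_congr_of_eq_on_inter
    · intro m h1 h2
      rw [bump_eq_zero hN (by simp only [mem_Icc] at h1 h2; rw [lt_abs]; omega)]; simp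
    · intro m h1 h2
      rw [bump_eq_zero hN (by simp only [mem_Icc] at h1 h2; rw [lt_abs]; omega)]; simp
    · intros; rfl
  rw [hs]
  have hz : ∀ m : ℤ, (4 * N + 4 : ℤ) - 3 ≤ |m| → bump N m * bump N (m + h) = 0 := by
    intro m hm; rw [bump_eq_zero hN (by omega)]; simp
  have hS := (bump_smo hN).mul ((bump_smo hN).shift h)
  have h3 := hS.sum_bound (B := 4 * N + 4) (by omega) (by exact_mod_cast hz) θ
  have h0 : ‖∑ m ∈ Icc (-(4 * N + 4 : ℤ)) (4 * N + 4),
      ((bump N m * bump N (m + h) : ℝ) : ℂ) * ee (m * θ)‖ ≤ (2 * (4 * N + 4) + 1) := by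
    refine (norm_sum_le _ _).trans ?_
    refine (Finset.sum_le_card_nsmul _ _ 1 fun m _ => ?_).trans ?_
    · rw [norm_mul, norm_ee, mul_one, Complex.norm_real, Real.norm_eq_abs,
        abs_of_nonneg (mul_nonneg (bump_nonneg _ _) (bump_nonneg _ _))]
      exact mul_le_one₀ (bump_le_one hN _) (bump_nonneg _ _) (bump_le_one hN _)
    · rw [nsmul_eq_mul, Int.card_Icc, mul_one]
      have h1 : ((4 * N + 4 + 1 - -(4 * (N : ℤ) + 4)).toNat : ℤ) = 2 * (4 * N + 4) + 1 := by omega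
      have : (((4 * N + 4 + 1 - -(4 * (N : ℤ) + 4)).toNat : ℕ) : ℝ) = 2 * (4 * N + 4) + 1 := by
        exact_mod_cast h1
      rw [this]
  set S := ‖∑ m ∈ Icc (-(4 * N + 4 : ℤ)) (4 * N + 4),
      ((bump N m * bump N (m + h) : ℝ) : ℂ) * ee (m * θ)‖ with hSdef
  have hS0 : 0 ≤ S := norm_nonneg _
  have h4 := four_nd_le θ
  rw [norm_sub_rev] at h4
  have h5 : S * (4 * nd θ) ^ 3 ≤ (2 * ((4 * N + 4 : ℤ) : ℝ) + 1) * (2 ^ 3 * (8 * 8) * (1 / (N : ℝ)) ^ 3) := by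
    refine le_trans ?_ h3
    refine mul_le_mul_of_nonneg_left ?_ hS0
    exact pow_le_pow_left₀ (by have := nd_nonneg θ; linarith) h4 3
  have h9 : (1 / (N : ℝ)) ^ 3 * N ^ 3 = 1 := by
    rw [← mul_pow]; field_simp
  have h10 : S * (N * nd θ) ^ 3 ≤ (2 * (4 * N + 4) + 1) * 8 := by
    have h8 : S * (N * nd θ) ^ 3 = S * (4 * nd θ) ^ 3 * (N ^ 3 / 64) := by ring
    rw [h8]
    refine (mul_le_mul_of_nonneg_right h5 (by positivity)).trans (le_of_eq ?_)
    have : (2 * ((4 * N + 4 : ℤ) : ℝ) + 1) * (2 ^ 3 * (8 * 8) * (1 / (N : ℝ)) ^ 3) * (N ^ 3 / 64)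
      = (2 * (4 * N + 4) + 1) * 8 * ((1 / (N : ℝ)) ^ 3 * N ^ 3) := by push_cast; ring
    rw [this, h9, mul_one]
  have hx : 0 ≤ N * nd θ := mul_nonneg (by linarith) (nd_nonneg θ)
  rw [Pm, mul_div_assoc', le_div_iff₀ (by positivity)]
  generalize N * nd θ = x at h10 hx
  have h11 : (1 + x) ^ 3 ≤ 4 * (1 + x ^ 3) := by
    nlinarith [mul_nonneg (by linarith : (0 : ℝ) ≤ 1 + x) (sq_nonneg (x - 1))]
  nlinarith [mul_le_mul_of_nonneg_left h11 hS0]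

lemma sum_Icc_natAbs (f : ℕ → ℝ) (J : ℕ) :
    ∑ m ∈ Icc (-(J : ℤ)) J, f m.natAbs = f 0 + 2 * ∑ i ∈ range J, f (i + 1) := by
  induction J with
  | zero => simp
  | succ J ih =>
    have h : Icc (-((J + 1 : ℕ) : ℤ)) ((J + 1 : ℕ) : ℤ) =
        insert (-((J : ℤ) + 1)) (insert ((J : ℤ) + 1) (Icc (-(J : ℤ)) J)) := by
      ext m; simp only [mem_Icc, mem_insert]; push_cast; omega
    rw [h, Finset.sum_insert, Finset.sum_insert, ih, Finset.sum_range_succ]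
    · have h1 : (-((J : ℤ) + 1)).natAbs = J + 1 := by omega
      have h2 : ((J : ℤ) + 1).natAbs = J + 1 := by omega
      rw [h1, h2]; ring
    · simp
    · simp only [mem_insert, mem_Icc]; omega

/-- Integers in a fixed residue class modulo `q` lying in an interval of length `ℓ`. -/
lemma card_le_of_dvd {S : Finset ℤ} {q : ℕ} (hq : 1 ≤ q) {ℓ : ℝ} (hℓ : 0 ≤ ℓ)
    (h1 : ∀ x ∈ S, ∀ y ∈ S, (q : ℤ) ∣ x - y) (h2 : ∀ x ∈ S, ∀ y ∈ S, ((x : ℝ) - y) ≤ ℓ) :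
    (S.card : ℝ) ≤ ℓ / q + 1 := by
  have hq' : (0 : ℝ) < q := by exact_mod_cast hq
  rcases S.eq_empty_or_nonempty with rfl | hS
  · simp; positivity
  set m := S.min' hS
  have hm : m ∈ S := S.min'_mem hS
  have hcard : S.card ≤ (Finset.range (⌊ℓ / q⌋₊ + 1)).card := by
    apply Finset.card_le_card_of_injOn (fun x => ((x - m) / q).toNat)
    · intro x hx
      have hx : x ∈ S := hx
      obtain ⟨c, hc⟩ := h1 x hx m hm
      have hxm : m ≤ x := S.min'_le x hx
      have hq0 : (q : ℤ) ≠ 0 := by positivity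
      have : (x - m) / q = c := by rw [hc]; exact Int.mul_ediv_cancel_left _ hq0
      simp only [this, coe_range, Set.mem_Iio]
      have hc0 : 0 ≤ c := by
        by_contra hneg
        push Not at hneg
        have : (q : ℤ) * c < 0 := by apply mul_neg_of_pos_of_neg <;> [positivity; exact hneg]
        omega
      apply Nat.lt_succ_of_le
      apply Nat.le_floor
      rw [le_div_iff₀ hq']
      have h3 := h2 x hx m hm
      have h4 : (x : ℝ) - m = q * c := by exact_mod_cast hc
      have h5 : ((c.toNat : ℕ) : ℝ) = c := by exact_mod_cast Int.toNat_of_nonneg hc0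
      rw [h5]; linarith
    · intro x hx y hy hxy
      have hx : x ∈ S := hx
      have hy : y ∈ S := hy
      obtain ⟨c, hc⟩ := h1 x hx m hm
      obtain ⟨d, hd⟩ := h1 y hy m hm
      have hxm : m ≤ x := S.min'_le x hx
      have hym : m ≤ y := S.min'_le y hy
      have hq0 : (0 : ℤ) < q := by positivity
      have e1 : (x - m) / q = c := by rw [hc]; exact Int.mul_ediv_cancel_left _ hq0.ne'
      have e2 : (y - m) / q = d := by rw [hd]; exact Int.mul_ediv_cancel_left _ hq0.ne'
      have hc0 : 0 ≤ (x - m) / q := Int.ediv_nonneg (by omega) hq0.le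
      have hd0 : 0 ≤ (y - m) / q := Int.ediv_nonneg (by omega) hq0.le
      simp only at hxy
      have : c = d := by omega
      subst this
      omega
  rw [Finset.card_range] at hcard
  have : (S.card : ℝ) ≤ (⌊ℓ / q⌋₊ : ℝ) + 1 := by exact_mod_cast hcard
  have := Nat.floor_le (show 0 ≤ ℓ / q by positivity)
  linarith

lemma sum_inv_one_add_sq {X : ℝ} (hX : 0 < X) (J : ℕ) :
    ∑ i ∈ range J, 1 / (1 + X * ((i + 1 : ℕ) : ℝ)) ^ 2 ≤ 1 / X := by
  have : ∀ J : ℕ, ∑ i ∈ range J, 1 / (1 + X * ((i + 1 : ℕ) : ℝ)) ^ 2 ≤ 1 / X - 1 / (X * (1 + X * J)) := by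
    intro J
    induction J with
    | zero => simp
    | succ J ih =>
      rw [Finset.sum_range_succ]
      have h1 : (0 : ℝ) < 1 + X * J := by positivity
      have h2 : (0 : ℝ) < 1 + X * ((J + 1 : ℕ) : ℝ) := by positivity
      have h3 : 1 / (1 + X * ((J + 1 : ℕ) : ℝ)) ^ 2 ≤
          1 / (X * (1 + X * J)) - 1 / (X * (1 + X * ((J + 1 : ℕ) : ℝ))) := by
        rw [div_sub_div _ _ (by positivity) (by positivity), div_le_div_iff₀ (by positivity) (by positivity)]
        push_cast
        push_cast at h2
        have : 0 ≤ X * X * (1 + X * (J + 1)) * (X * (1 + X * (J + 1)) ) := by positivity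
        nlinarith
      linarith
  refine (this J).trans ?_
  have : 0 ≤ 1 / (X * (1 + X * J)) := by positivity
  linarith

lemma nd_int_mul_add (z : ℤ) (θ : ℝ) : nd (z + θ) = nd θ := by
  simp [nd, round_intCast_add]

lemma nd_ge_min (x : ℝ) (h : |x| ≤ 1) : min |x| (1 - |x|) ≤ nd x := by
  rw [nd]
  have h0 := abs_le.1 h
  have hr : round x = 0 ∨ 1 ≤ |(round x : ℝ)| := by
    rcases eq_or_ne (round x) 0 with h | h
    · exact Or.inl h
    · right; exact_mod_cast Int.one_le_abs h
  rcases hr with hr | hr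
  · rw [hr]; simp
  · have := abs_sub_abs_le_abs_sub (round x : ℝ) x
    rw [abs_sub_comm] at this
    exact (min_le_right _ _).trans (by linarith)

lemma sum_valMinAbs_le (q : ℕ) [NeZero q] :
    ∑ c : ZMod q, (if c = 0 then 0 else 1 / ((c.valMinAbs : ℝ)) ^ 2) ≤ 4 := by
  classical
  set f : ℕ → ℝ := fun m => if m = 0 then 0 else 1 / ((m : ℝ)) ^ 2
  have h1 : ∀ c : ZMod q, (if c = 0 then 0 else 1 / ((c.valMinAbs : ℝ)) ^ 2) = f c.valMinAbs.natAbs := by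
    intro c
    simp only [f, Int.natAbs_eq_zero, ZMod.valMinAbs_eq_zero]
    split_ifs
    · rfl
    · rw [Nat.cast_natAbs, Int.cast_abs, sq_abs]
  rw [Finset.sum_congr rfl fun c _ => h1 c,
    ← Finset.sum_image (s := Finset.univ) (g := fun c : ZMod q => c.valMinAbs) (f := fun m => f m.natAbs)]
  · have hs : (Finset.univ.image fun c : ZMod q => c.valMinAbs) ⊆ Icc (-(q : ℤ)) q := by
      intro m hm
      simp only [mem_image, mem_univ, true_and] at hm
      obtain ⟨c, rfl⟩ := hm
      have := ZMod.natAbs_valMinAbs_le c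
      rw [mem_Icc]; omega
    refine (Finset.sum_le_sum_of_subset_of_nonneg hs fun m _ _ => ?_).trans ?_
    · simp only [f]; split_ifs <;> positivity
    · rw [sum_Icc_natAbs]
      simp only [f, if_true, zero_add]
      have : ∑ i ∈ range q, (if i + 1 = 0 then (0 : ℝ) else 1 / ((i + 1 : ℕ) : ℝ) ^ 2) ≤ 2 := by
        have h2 : ∀ J : ℕ, ∑ i ∈ range (J + 1), (if i + 1 = 0 then (0 : ℝ) else 1 / ((i + 1 : ℕ) : ℝ) ^ 2) ≤ 2 - 1 / (J + 1) := by
          intro J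
          induction J with
          | zero => simp; norm_num
          | succ J ih =>
            rw [Finset.sum_range_succ, if_neg (by omega)]
            have : (1 : ℝ) / ((J + 1 + 1 : ℕ) : ℝ) ^ 2 ≤ 1 / (J + 1) - 1 / ((J + 1 : ℕ) + 1) := by
              push_cast
              rw [div_sub_div _ _ (by positivity) (by positivity), div_le_div_iff₀ (by positivity) (by positivity)]
              nlinarith
            linarith
        rcases Nat.eq_zero_or_pos q with h | h
        · subst h; simp
        · obtain ⟨J, rfl⟩ := Nat.exists_eq_succ_of_ne_zero h.ne'
          refine (h2 J).trans ?_
          have : (0 : ℝ) ≤ 1 / (J + 1) := by positivity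
          linarith
      linarith
  · intro c _ d _ h; exact ZMod.injective_valMinAbs h

lemma Pm_nonneg (N : ℕ) (θ : ℝ) : 0 ≤ Pm N θ := by
  have := nd_nonneg θ; unfold Pm; positivity

lemma Pm_le (N : ℕ) (θ : ℝ) : Pm N θ ≤ N := by
  have := nd_nonneg θ
  unfold Pm
  apply div_le_self (Nat.cast_nonneg _)
  apply one_le_pow₀
  have : 0 ≤ N * nd θ := by positivity
  linarith

lemma Pm_le_of_nd {N : ℕ} {θ x : ℝ} (hx : 0 ≤ x) (h : x ≤ nd θ) : Pm N θ ≤ N / (1 + N * x) ^ 2 := by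
  unfold Pm
  have h1 : 0 ≤ N * x := by positivity
  have h2 : N * x ≤ N * nd θ := by gcongr
  apply div_le_div_of_nonneg_left (Nat.cast_nonneg _) (by positivity)
  calc (1 + N * x) ^ 2 ≤ (1 + N * nd θ) ^ 2 := by gcongr
    _ ≤ (1 + N * nd θ) ^ 3 := by
      apply pow_le_pow_right₀ <;> [linarith; norm_num]

lemma card_residue_le {q B : ℕ} (hq : 1 ≤ q) (c : ZMod q) :
    (((Icc (-(B : ℤ)) B).filter fun h : ℤ => (h : ZMod q) = c).card : ℝ) ≤ 2 * B / q + 1 := by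
  apply card_le_of_dvd hq (by positivity)
  · intro x hx y hy
    rw [mem_filter] at hx hy
    rw [← ZMod.intCast_zmod_eq_zero_iff_dvd]; push_cast; rw [hx.2, hy.2, sub_self]
  · intro x hx y hy
    rw [mem_filter, mem_Icc] at hx hy
    have h1 : (x : ℝ) ≤ B := by exact_mod_cast hx.1.2
    have h2 : -(B : ℝ) ≤ y := by exact_mod_cast hy.1.1
    linarith

/-- Major arc bound for the sum of the majorants `Pm N (h t)`. -/
lemma sum_Pm_le {N q : ℕ} (hq : 1 ≤ q) (hqN : q ≤ 64 * N) (a : ℤ) (ha : IsCoprime a q)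
    (β : ℝ) (hβ : |β| ≤ 1 / (64 * N * q)) :
    (∑ h ∈ Icc (-((16 * N : ℕ) : ℤ)) (16 * N : ℕ), Pm N (h * (a / q + β))) * q ≤ 10000000 * N ^ 2 ∧
    (∑ h ∈ Icc (-((16 * N : ℕ) : ℤ)) (16 * N : ℕ), Pm N (h * (a / q + β))) * (q * |β|) ≤ 10000 := by
  classical
  have : NeZero q := ⟨by omega⟩
  have hN : 1 ≤ N := by omega
  have hN' : (1 : ℝ) ≤ N := by exact_mod_cast hN
  have hq' : (1 : ℝ) ≤ q := by exact_mod_cast hq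
  have hqN' : (q : ℝ) ≤ 64 * N := by exact_mod_cast hqN
  set H := Icc (-((16 * N : ℕ) : ℤ)) (16 * N : ℕ)
  have hcount : ∀ c : ZMod q, ((H.filter fun h : ℤ => (h : ZMod q) = c).card : ℝ) ≤ 96 * N / q := by
    intro c
    refine (card_residue_le hq c).trans ?_
    rw [div_add_one (by positivity)]
    gcongr; push_cast; linarith
  have hβh : ∀ h ∈ H, |β * h| ≤ 1 / (4 * q) := by
    intro h hh
    have hh' : |(h : ℝ)| ≤ 16 * N := by
      rw [mem_Icc, ← abs_le] at hh
      exact_mod_cast hh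
    rw [abs_mul]
    calc |β| * |(h : ℝ)| ≤ 1 / (64 * N * q) * (16 * N) := by gcongr
      _ = 1 / (4 * q) := by field_simp; norm_num
  have hunit : IsUnit (a : ZMod q) := IsUnit.of_mul_eq_one _ (ZMod.coe_int_mul_inv_eq_one ha)
  have hA : ∑ h ∈ H.filter (fun h : ℤ => (h : ZMod q) ≠ 0), Pm N (h * (a / q + β)) ≤ 1536 * q := by
    have h1 : ∀ h ∈ H.filter (fun h : ℤ => (h : ZMod q) ≠ 0), Pm N (h * (a / q + β)) ≤
        (4 * q ^ 2 / N) * (fun c : ZMod q => if c = 0 then 0 else 1 / ((c.valMinAbs : ℝ)) ^ 2) ((a * h : ℤ) : ZMod q) := by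
      intro h hh
      rw [mem_filter] at hh
      set c := ((a * h : ℤ) : ZMod q) with hc
      have hc0 : c ≠ 0 := by
        rw [hc]; push_cast; exact (hunit.mul_right_eq_zero).not.2 hh.2
      simp only [if_neg hc0]
      set v := c.valMinAbs with hv
      have hv0 : v ≠ 0 := by rw [hv, Ne, ZMod.valMinAbs_eq_zero]; exact hc0
      obtain ⟨k, hk⟩ : (q : ℤ) ∣ a * h - v := by
        rw [← ZMod.intCast_zmod_eq_zero_iff_dvd]; push_cast
        rw [hv, ZMod.coe_valMinAbs, hc]; push_cast; ring
      have hv1 : (1 : ℝ) ≤ |(v : ℝ)| := by exact_mod_cast Int.one_le_abs hv0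
      have hv2 : |(v : ℝ)| ≤ q / 2 := by
        have h3 := ZMod.natAbs_valMinAbs_le c
        have h4 : (v.natAbs : ℝ) ≤ ((q / 2 : ℕ) : ℝ) := by exact_mod_cast h3
        have h5 : ((q / 2 : ℕ) : ℝ) ≤ q / 2 := Nat.cast_div_le
        rw [Nat.cast_natAbs, Int.cast_abs] at h4
        linarith
      have hθ : (h : ℝ) * (a / q + β) = k + (v / q + β * h) := by
        have : (a : ℝ) * h - v = q * k := by exact_mod_cast hk
        field_simp
        linarith
      have h4 := hβh h hh.1
      have hvq : |(v : ℝ) / q| = |(v : ℝ)| / q := by rw [abs_div, abs_of_pos (by linarith : (0 : ℝ) < q)]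
      have h41 : 1 / (4 * (q : ℝ)) ≤ |(v : ℝ)| / q / 4 := by
        rw [div_div, div_le_div_iff₀ (by positivity) (by positivity)]; nlinarith
      have h42 : |(v : ℝ)| / q ≤ 1 / 2 := by
        rw [div_le_iff₀ (by linarith)]; linarith
      have h5 : |(v : ℝ)| / (2 * q) ≤ nd (h * (a / q + β)) := by
        rw [hθ, nd_int_mul_add]
        have h6 : |(v : ℝ) / q + β * h| ≤ |(v : ℝ)| / q + |(v : ℝ)| / q / 4 :=
          (abs_add_le _ _).trans (by rw [hvq]; linarith)
        have h7 : |(v : ℝ)| / q - |(v : ℝ)| / q / 4 ≤ |(v : ℝ) / q + β * h| := by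
          have := abs_sub_abs_le_abs_sub ((v : ℝ) / q) (-(β * h))
          rw [abs_neg, sub_neg_eq_add, hvq] at this
          linarith
        have h8 : |(v : ℝ)| / (2 * q) = |(v : ℝ)| / q / 2 := by rw [div_div, mul_comm]
        have h9 : 0 ≤ |(v : ℝ)| / q := by positivity
        refine le_trans (le_min ?_ ?_) (nd_ge_min _ (by linarith)) <;> linarith
      refine (Pm_le_of_nd (by positivity) h5).trans ?_
      have h10 : 4 * (q : ℝ) ^ 2 / N * (1 / (v : ℝ) ^ 2) = N / (N * (|(v : ℝ)| / (2 * q))) ^ 2 := by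
        rw [mul_pow, div_pow, sq_abs]
        have : (v : ℝ) ≠ 0 := by exact_mod_cast hv0
        field_simp
        norm_num
      rw [h10]
      apply div_le_div_of_nonneg_left (by linarith) (by positivity)
      gcongr; linarith
    refine (Finset.sum_le_sum h1).trans ?_
    set G : ZMod q → ℝ := fun c : ZMod q => if c = 0 then 0 else 1 / ((c.valMinAbs : ℝ)) ^ 2 with hG
    have hG0 : ∀ c, 0 ≤ G c := by intro c; simp only [hG]; split_ifs <;> positivity
    have h2 : ∑ h ∈ H.filter (fun h : ℤ => (h : ZMod q) ≠ 0), (4 * q ^ 2 / N) * G ((a * h : ℤ) : ZMod q)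
        ≤ ∑ h ∈ H, (4 * q ^ 2 / N) * G ((a * h : ℤ) : ZMod q) :=
      Finset.sum_le_sum_of_subset_of_nonneg (Finset.filter_subset _ _)
        fun h _ _ => mul_nonneg (by positivity) (hG0 _)
    refine h2.trans ?_
    rw [← Finset.mul_sum]
    have h3 : ∑ h ∈ H, G ((a * h : ℤ) : ZMod q) ≤ 96 * N / q * 4 := by
      rw [← Finset.sum_fiberwise (s := H) (g := fun h : ℤ => (h : ZMod q))]
      have : ∀ c : ZMod q, ∑ h ∈ H.filter (fun h : ℤ => (h : ZMod q) = c), G ((a * h : ℤ) : ZMod q)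
          ≤ 96 * N / q * G (a * c) := by
        intro c
        rw [Finset.sum_congr rfl (g := fun _ => G (a * c)) (fun h hh => by
          rw [← (mem_filter.1 hh).2]; push_cast; rfl), Finset.sum_const, nsmul_eq_mul]
        exact mul_le_mul_of_nonneg_right (hcount c) (hG0 _)
      refine (Finset.sum_le_sum fun c _ => this c).trans ?_
      rw [← Finset.mul_sum]
      refine mul_le_mul_of_nonneg_left ?_ (by positivity)
      have h4 : ∑ c : ZMod q, G (a * c) = ∑ c : ZMod q, G c := by
        obtain ⟨u, hu⟩ := hunit
        rw [← hu]
        exact Equiv.sum_comp (Units.mulLeft u) G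
      rw [h4]
      exact sum_valMinAbs_le q
    refine (mul_le_mul_of_nonneg_left h3 (by positivity)).trans (le_of_eq ?_)
    field_simp; norm_num
  have hsplit : ∑ h ∈ H, Pm N (h * (a / q + β)) =
      ∑ h ∈ H.filter (fun h : ℤ => (h : ZMod q) = 0), Pm N (h * (a / q + β)) +
      ∑ h ∈ H.filter (fun h : ℤ => (h : ZMod q) ≠ 0), Pm N (h * (a / q + β)) :=
    (Finset.sum_filter_add_sum_filter_not _ _ _).symm
  have hB1 : ∑ h ∈ H.filter (fun h : ℤ => (h : ZMod q) = 0), Pm N (h * (a / q + β)) ≤ 96 * N / q * N := by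
    refine (Finset.sum_le_card_nsmul _ _ (N : ℝ) fun h _ => Pm_le _ _).trans ?_
    rw [nsmul_eq_mul]
    exact mul_le_mul_of_nonneg_right (hcount 0) (by linarith)
  have hqβ : q * |β| ≤ 1 / (64 * N) := by
    calc q * |β| ≤ q * (1 / (64 * N * q)) := by gcongr
      _ = 1 / (64 * N) := by field_simp
  have hB2 : (∑ h ∈ H.filter (fun h : ℤ => (h : ZMod q) = 0), Pm N (h * (a / q + β))) * (q * |β|) ≤ 3 := by
    rcases eq_or_ne β 0 with h0 | h0
    · rw [h0]; simp
    have hβ0 : 0 < |β| := abs_pos.2 h0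
    set X := N * (q * |β|) with hX
    have hX0 : 0 < X := by positivity
    have h1 : ∀ h ∈ H.filter (fun h : ℤ => (h : ZMod q) = 0), Pm N (h * (a / q + β)) ≤
        N * (fun m : ℕ => 1 / (1 + X * (m : ℝ)) ^ 2) (h / q).natAbs := by
      intro h hh
      rw [mem_filter, ZMod.intCast_zmod_eq_zero_iff_dvd] at hh
      obtain ⟨hh1, k, hk⟩ := hh
      have hk' : h / q = k := by rw [hk]; exact Int.mul_ediv_cancel_left _ (by positivity)
      have hθ : (h : ℝ) * (a / q + β) = ((k * a : ℤ) : ℝ) + β * h := by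
        rw [hk]; push_cast; field_simp
      have h4 := hβh h hh1
      have h5 : |β * h| ≤ nd (h * (a / q + β)) := by
        rw [hθ, nd_int_mul_add]
        have h6 : 1 / (4 * (q : ℝ)) ≤ 1 / 4 := by
          apply div_le_div_of_nonneg_left <;> linarith
        refine le_trans (le_min le_rfl ?_) (nd_ge_min _ (by linarith)); linarith
      refine (Pm_le_of_nd (abs_nonneg _) h5).trans (le_of_eq ?_)
      rw [hk']
      have : X * (k.natAbs : ℝ) = N * |β * h| := by
        rw [hX, Nat.cast_natAbs, Int.cast_abs, hk]; push_cast
        rw [abs_mul, abs_mul, abs_of_pos (by linarith : (0 : ℝ) < q)]; ring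
      simp only [this]; ring
    have h2 : ∑ h ∈ H.filter (fun h : ℤ => (h : ZMod q) = 0), Pm N (h * (a / q + β)) ≤
        N * (1 + 2 * (1 / X)) := by
      refine (Finset.sum_le_sum h1).trans ?_
      rw [← Finset.mul_sum]
      refine mul_le_mul_of_nonneg_left ?_ (by linarith)
      set f : ℕ → ℝ := fun m : ℕ => 1 / (1 + X * (m : ℝ)) ^ 2
      have h3 := sum_Icc_natAbs f (16 * N)
      have h4 := sum_inv_one_add_sq hX0 (16 * N)
      rw [← Finset.sum_image (s := H.filter fun h : ℤ => (h : ZMod q) = 0) (g := fun h : ℤ => h / q)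
        (f := fun m => f m.natAbs)]
      · refine (Finset.sum_le_sum_of_subset_of_nonneg (t := H) ?_ fun m _ _ => by positivity).trans ?_
        · intro m hm
          rw [mem_image] at hm
          obtain ⟨h, hh, rfl⟩ := hm
          rw [mem_filter, ZMod.intCast_zmod_eq_zero_iff_dvd] at hh
          obtain ⟨hh1, k, hk⟩ := hh
          have hk' : h / q = k := by rw [hk]; exact Int.mul_ediv_cancel_left _ (by positivity)
          rw [hk']
          have hq1 : (1 : ℤ) ≤ q := by exact_mod_cast hq
          rw [mem_Icc, ← abs_le] at hh1 ⊢
          refine le_trans ?_ hh1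
          rw [hk, abs_mul]
          have := abs_nonneg k
          rw [abs_of_nonneg (by omega : (0 : ℤ) ≤ q)]
          nlinarith
        · rw [h3]
          have : f 0 = 1 := by simp [f]
          rw [this]
          linarith
      · intro x hx y hy hxy
        simp only [coe_filter, Set.mem_ofPred_eq, ZMod.intCast_zmod_eq_zero_iff_dvd] at hx hy hxy
        rw [← Int.ediv_mul_cancel hx.2, ← Int.ediv_mul_cancel hy.2, hxy]
    calc _ ≤ N * (1 + 2 * (1 / X)) * (q * |β|) := by gcongr
      _ = X + 2 := by rw [hX]; field_simp
      _ ≤ 3 := by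
        have : X ≤ N * (1 / (64 * N)) := by rw [hX]; gcongr
        have h3 : (N : ℝ) * (1 / (64 * N)) = 1 / 64 := by field_simp
        linarith
  constructor
  · rw [hsplit, add_mul]
    have h1 : 96 * N / q * N * q = 96 * (N : ℝ) ^ 2 := by field_simp
    have h2 := mul_le_mul_of_nonneg_right hB1 (by linarith : (0 : ℝ) ≤ q)
    have h3 := mul_le_mul_of_nonneg_right hA (by linarith : (0 : ℝ) ≤ q)
    nlinarith
  · rw [hsplit, add_mul]
    have h3 := mul_le_mul_of_nonneg_right hA (by positivity : (0 : ℝ) ≤ q * |β|)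
    have h4 : 1536 * (q : ℝ) * (q * |β|) ≤ 1536 * (64 * N) * (1 / (64 * N)) := by gcongr
    have h5 : 1536 * (64 * (N : ℝ)) * (1 / (64 * N)) = 1536 := by field_simp
    linarith

/-- Weyl differencing for quadratic phases in `n` variables. -/
lemma weyl_diff {n : ℕ} (B H : Finset (Fin n → ℤ)) (w : (Fin n → ℤ) → ℝ)
    (hw : ∀ ξ, ξ ∉ B → w ξ = 0) (hH : ∀ ξ ∈ B, ∀ η ∈ B, η - ξ ∈ H) (t : ℝ) (x : Fin n → ℝ) :
    ‖∑ ξ ∈ B, (w ξ : ℂ) * ee (∑ i, (x i * ξ i + t * (ξ i : ℝ) ^ 2))‖ ^ 2 ≤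
      ∑ h ∈ H, ‖∑ ξ ∈ B, ((w ξ * w (ξ + h) : ℝ) : ℂ) * ee (∑ i, (ξ i : ℝ) * (2 * t * h i))‖ := by
  classical
  set E : (Fin n → ℤ) → ℂ := fun ξ => ee (∑ i, (x i * ξ i + t * (ξ i : ℝ) ^ 2)) with hE
  have h1 : ∀ ξ h : Fin n → ℤ, E (ξ + h) * (starRingEnd ℂ) (E ξ) =
      ee (∑ i, (x i * h i + t * (h i : ℝ) ^ 2)) * ee (∑ i, (ξ i : ℝ) * (2 * t * h i)) := by
    intro ξ h
    rw [hE, ← ee_sub, ← ee_add]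
    congr 1
    rw [← Finset.sum_sub_distrib, ← Finset.sum_add_distrib]
    refine Finset.sum_congr rfl fun i _ => ?_
    rw [Pi.add_apply]; push_cast; ring
  have h2 : (∑ ξ ∈ B, (w ξ : ℂ) * E ξ) * (starRingEnd ℂ) (∑ ξ ∈ B, (w ξ : ℂ) * E ξ) =
      ∑ h ∈ H, ee (∑ i, (x i * h i + t * (h i : ℝ) ^ 2)) *
        ∑ ξ ∈ B, ((w ξ * w (ξ + h) : ℝ) : ℂ) * ee (∑ i, (ξ i : ℝ) * (2 * t * h i)) := by
    rw [map_sum, Finset.mul_sum]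
    simp_rw [Finset.mul_sum]
    rw [Finset.sum_comm]
    refine Finset.sum_congr rfl fun ξ hξ => ?_
    rw [Finset.sum_mul]
    refine Finset.sum_of_injOn (fun η => η - ξ) (fun a _ b _ hab => by simpa using hab)
      (fun η hη => hH ξ hξ η hη) (fun h _ hh => ?_) (fun η _ => ?_)
    · rw [hw (ξ + h) (fun h' => hh ⟨ξ + h, h', by simp⟩)]; simp
    · have := h1 ξ (η - ξ)
      rw [mul_left_comm, ← this, add_sub_cancel, map_mul, Complex.conj_ofReal]
      push_cast; ring
  have h3 : ‖∑ ξ ∈ B, (w ξ : ℂ) * E ξ‖ ^ 2 =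
      ‖(∑ ξ ∈ B, (w ξ : ℂ) * E ξ) * (starRingEnd ℂ) (∑ ξ ∈ B, (w ξ : ℂ) * E ξ)‖ := by
    rw [norm_mul, RCLike.norm_conj, sq]
  rw [h3, h2]
  refine (norm_sum_le _ _).trans (Finset.sum_le_sum fun h _ => ?_)
  rw [norm_mul, norm_ee, one_mul]

/-- The lattice cube of radius `4 N` around `c`. -/
noncomputable def cube {n : ℕ} (c : Fin n → ℤ) (N : ℕ) : Finset (Fin n → ℤ) :=
  Fintype.piFinset fun i => Icc (c i - 4 * N) (c i + 4 * N)

/-- Smooth product cutoff adapted to the cube of radius `N` around `c`. -/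
noncomputable def bw {n : ℕ} (c : Fin n → ℤ) (N : ℕ) (ξ : Fin n → ℤ) : ℝ :=
  ∏ i, bump N (ξ i - c i)

lemma bw_nonneg {n : ℕ} (c : Fin n → ℤ) (N : ℕ) (ξ : Fin n → ℤ) : 0 ≤ bw c N ξ :=
  Finset.prod_nonneg fun _ _ => bump_nonneg _ _

lemma bw_le_one {n : ℕ} (c : Fin n → ℤ) {N : ℕ} (hN : 1 ≤ N) (ξ : Fin n → ℤ) : bw c N ξ ≤ 1 :=
  Finset.prod_le_one (fun _ _ => bump_nonneg _ _) fun _ _ => bump_le_one hN _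

lemma bw_eq_one {n : ℕ} {c : Fin n → ℤ} {N : ℕ} (hN : 1 ≤ N) {ξ : Fin n → ℤ}
    (h : ∀ i, |ξ i - c i| ≤ N) : bw c N ξ = 1 :=
  Finset.prod_eq_one fun i _ => bump_eq_one hN (h i)

lemma bw_eq_zero {n : ℕ} {c : Fin n → ℤ} {N : ℕ} (hN : 1 ≤ N) {ξ : Fin n → ℤ}
    (h : ξ ∉ cube c N) : bw c N ξ = 0 := by
  simp only [cube, Fintype.mem_piFinset, not_forall, mem_Icc] at h
  obtain ⟨i, hi⟩ := h
  refine Finset.prod_eq_zero (mem_univ i) (bump_eq_zero hN ?_)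
  rw [lt_abs]; omega

/-- The box of differences of two points in a cube. -/
noncomputable def dbox (n N : ℕ) : Finset (Fin n → ℤ) :=
  Fintype.piFinset fun _ => Icc (-((8 * N : ℕ) : ℤ)) (8 * N : ℕ)

lemma sub_mem_dbox {n N : ℕ} {c ξ η : Fin n → ℤ} (h1 : ξ ∈ cube c N) (h2 : η ∈ cube c N) :
    η - ξ ∈ dbox n N := by
  simp only [cube, dbox, Fintype.mem_piFinset, mem_Icc, Pi.sub_apply] at *
  intro i
  have := h1 i
  have := h2 i
  push_cast
  omega

lemma bump_sum_center {N : ℕ} (hN : 1 ≤ N) (c h : ℤ) (θ : ℝ) :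
    ‖∑ m ∈ Icc (c - 4 * N) (c + 4 * N), ((bump N (m - c) * bump N (m + h - c) : ℝ) : ℂ) * ee (m * θ)‖
      ≤ 20000 * Pm N θ := by
  refine le_trans (le_of_eq ?_) (bump_sum_le hN h (B := 4 * N) le_rfl θ)
  have : ∑ m ∈ Icc (c - 4 * N) (c + 4 * N), ((bump N (m - c) * bump N (m + h - c) : ℝ) : ℂ) * ee (m * θ)
      = ee (c * θ) * ∑ m ∈ Icc (-(4 * N : ℤ)) (4 * N), ((bump N m * bump N (m + h) : ℝ) : ℂ) * ee (m * θ) := by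
    have e : Icc (c - 4 * (N : ℤ)) (c + 4 * N) = (Icc (-(4 * N : ℤ)) (4 * N)).map (addRightEmbedding c) := by
      rw [Finset.map_add_right_Icc]; congr 1 <;> ring
    rw [e, Finset.sum_map, Finset.mul_sum]
    refine Finset.sum_congr rfl fun m _ => ?_
    simp only [addRightEmbedding_apply, add_sub_cancel_right]
    have e1 : m + c + h - c = m + h := by ring
    have e2 : ((m + c : ℤ) : ℝ) * θ = c * θ + m * θ := by push_cast; ring
    rw [e1, e2, ee_add]; ring
  rw [this, norm_mul, norm_ee, one_mul]

lemma bw_sum_le {n N : ℕ} (hN : 1 ≤ N) (c h : Fin n → ℤ) (θ : Fin n → ℝ) :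
    ‖∑ ξ ∈ cube c N, ((bw c N ξ * bw c N (ξ + h) : ℝ) : ℂ) * ee (∑ i, (ξ i : ℝ) * θ i)‖ ≤
      ∏ i, (20000 * Pm N (θ i)) := by
  have : ∑ ξ ∈ cube c N, ((bw c N ξ * bw c N (ξ + h) : ℝ) : ℂ) * ee (∑ i, (ξ i : ℝ) * θ i) =
      ∏ i, ∑ m ∈ Icc (c i - 4 * N) (c i + 4 * N),
        ((bump N (m - c i) * bump N (m + h i - c i) : ℝ) : ℂ) * ee (m * θ i) := by
    rw [Finset.prod_univ_sum]
    refine Finset.sum_congr rfl fun ξ _ => ?_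
    rw [ee_sum, Finset.prod_mul_distrib, bw, bw, ← Finset.prod_mul_distrib]
    push_cast
    rfl
  rw [this, norm_prod]
  exact Finset.prod_le_prod (fun _ _ => norm_nonneg _) fun i _ => bump_sum_center hN _ _ _

lemma sum_dbox_two_mul_le {N : ℕ} {f : ℤ → ℝ} (hf : ∀ m, 0 ≤ f m) :
    ∑ h ∈ Icc (-((8 * N : ℕ) : ℤ)) (8 * N : ℕ), f (2 * h) ≤
      ∑ h ∈ Icc (-((16 * N : ℕ) : ℤ)) (16 * N : ℕ), f h := by
  rw [← Finset.sum_image (g := fun h : ℤ => 2 * h) (f := f) (by intro x _ y _ h; simpa using h)]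
  refine Finset.sum_le_sum_of_subset_of_nonneg (fun m hm => ?_) fun m _ _ => hf m
  simp only [mem_image, mem_Icc] at hm ⊢
  obtain ⟨a, ha, rfl⟩ := hm
  push_cast at *
  omega

/-- Bound for the smoothed Schrödinger kernel of a cube. -/
lemma kernel_sq_le {n N : ℕ} (hN : 1 ≤ N) (c : Fin n → ℤ) (t : ℝ) (x : Fin n → ℝ) :
    ‖∑ ξ ∈ cube c N, (bw c N ξ : ℂ) * ee (∑ i, (x i * ξ i + t * (ξ i : ℝ) ^ 2))‖ ^ 2 ≤
      (20000 * ∑ h ∈ Icc (-((16 * N : ℕ) : ℤ)) (16 * N : ℕ), Pm N (h * t)) ^ n := by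
  classical
  refine (weyl_diff (cube c N) (dbox n N) (bw c N) (fun ξ h => bw_eq_zero hN h)
    (fun ξ h1 η h2 => sub_mem_dbox h1 h2) t x).trans ?_
  refine (Finset.sum_le_sum fun h _ => bw_sum_le hN c h fun i => 2 * t * h i).trans ?_
  rw [dbox, ← Finset.prod_univ_sum (fun _ => Icc (-((8 * N : ℕ) : ℤ)) (8 * N : ℕ))
    (fun _ m => 20000 * Pm N (2 * t * (m : ℝ))), Finset.prod_const, card_univ, Fintype.card_fin,
    ← Finset.mul_sum]
  refine pow_le_pow_left₀ (mul_nonneg (by norm_num) (Finset.sum_nonneg fun _ _ => Pm_nonneg _ _)) ?_ n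
  refine mul_le_mul_of_nonneg_left ?_ (by norm_num)
  have := sum_dbox_two_mul_le (N := N) (f := fun m : ℤ => Pm N (m * t)) fun m => Pm_nonneg _ _
  refine le_trans (le_of_eq ?_) this
  refine Finset.sum_congr rfl fun m _ => ?_
  congr 1; push_cast; ring

/-- Bessel's inequality for characters of a finite abelian group. -/
lemma bessel_char {Z σ : Type*} [AddCommGroup Z] [Fintype Z] (A : Finset σ) (X : σ → AddChar Z ℂ)
    (hX : Set.InjOn X A) (f : Z → ℂ) :
    ∑ s ∈ A, ‖∑ z, f z * (starRingEnd ℂ) (X s z)‖ ^ 2 ≤ Fintype.card Z * ∑ z, ‖f z‖ ^ 2 := by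
  classical
  have hZ : (0 : ℝ) < (Fintype.card Z : ℝ) := by exact_mod_cast Fintype.card_pos
  set r : ℝ := (√(Fintype.card Z))⁻¹ with hr
  have hr2 : r ^ 2 * Fintype.card Z = 1 := by
    rw [hr, inv_pow, Real.sq_sqrt hZ.le, inv_mul_cancel₀ hZ.ne']
  have hr0 : 0 ≤ r := by positivity
  set v : A → EuclideanSpace ℂ Z := fun s => WithLp.toLp 2 fun z => (r : ℂ) * X s z with hv
  have hin : ∀ (s : A) (g : Z → ℂ), inner ℂ (v s) (WithLp.toLp 2 g) =
      (r : ℂ) * ∑ z, g z * (starRingEnd ℂ) (X s z) := by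
    intro s g
    simp only [hv, PiLp.inner_apply, RCLike.inner_apply, Finset.mul_sum, map_mul, Complex.conj_ofReal]
    exact Finset.sum_congr rfl fun z _ => by ring
  have hort : Orthonormal ℂ v := by
    rw [orthonormal_iff_ite]
    intro s s'
    rw [hin s]
    have h1 : ∀ z, (r : ℂ) * X s' z * (starRingEnd ℂ) (X s z) = r * ((X s') - (X s)) z := by
      intro z
      rw [AddChar.sub_apply, AddChar.map_neg_eq_conj, mul_assoc]
    simp_rw [h1]
    rw [← Finset.mul_sum, AddChar.sum_eq_ite]
    have h2 : (X s' - X s = 0) ↔ s = s' := by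
      rw [sub_eq_zero]
      exact ⟨fun h => Subtype.ext (hX s.2 s'.2 h.symm), fun h => by rw [h]⟩
    by_cases h : s = s'
    · rw [if_pos (h2.2 h), if_pos h, ← mul_assoc, ← sq]
      exact_mod_cast hr2
    · rw [if_neg (mt h2.1 h), if_neg h]; simp
  have h := hort.sum_inner_products_le (WithLp.toLp 2 f) (s := Finset.univ)
  rw [EuclideanSpace.norm_sq_eq] at h
  simp_rw [hin, norm_mul, mul_pow, ← Finset.mul_sum] at h
  rw [Complex.norm_of_nonneg hr0, Finset.univ_eq_attach,
    Finset.sum_attach A (fun s => ‖∑ z, f z * (starRingEnd ℂ) (X s z)‖ ^ 2)] at h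
  calc _ = (r ^ 2 * Fintype.card Z) * ∑ s ∈ A, ‖∑ z, f z * (starRingEnd ℂ) (X s z)‖ ^ 2 := by
        rw [hr2, one_mul]
    _ = Fintype.card Z * (r ^ 2 * ∑ s ∈ A, ‖∑ z, f z * (starRingEnd ℂ) (X s z)‖ ^ 2) := by ring
    _ ≤ _ := mul_le_mul_of_nonneg_left h hZ.le

/-- The `T T*` method on level sets of a character sum over a finite abelian group. -/
lemma tt_star {Z ι κ : Type*} [AddCommGroup Z] [Fintype Z] [Fintype κ] (S : Finset ι)
    (ψ : ι → AddChar Z ℂ) (τ : κ → AddChar Z ℂ)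
    (hinj : ∀ ξ ∈ S, ∀ ξ' ∈ S, ∀ k k', ψ ξ * τ k = ψ ξ' * τ k' → ξ = ξ' ∧ k = k')
    (k0 : κ) (hk0 : τ k0 = 1) (a : ι → ℂ) (ha : ∑ ξ ∈ S, ‖a ξ‖ ^ 2 ≤ 1) {lam e : ℝ} (hl : 0 < lam)
    (he : e * Fintype.card Z = #{z | lam < ‖∑ ξ ∈ S, a ξ * ψ ξ z‖}) :
    ∃ F : ι → κ → ℝ, (∀ ξ k, 0 ≤ F ξ k) ∧ (∀ ξ k, F ξ k ≤ e) ∧ (∑ ξ ∈ S, ∑ k, F ξ k ^ 2 ≤ e) ∧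
      (∀ ω : ι → ℝ, (∀ ξ, 0 ≤ ω ξ) → (∀ ξ ∈ S, a ξ ≠ 0 → 1 ≤ ω ξ) →
        lam ^ 2 * e ^ 2 ≤ ∑ ξ ∈ S, ω ξ * F ξ k0 ^ 2) ∧
      (∀ (ω : ι → ℝ) (Θ : Z → ℂ) (c : κ → ℂ) (B : ℝ), (∀ ξ, 0 ≤ ω ξ) → (∀ z, Θ z = ∑ k, c k * τ k z) →
        (∀ z, ‖∑ ξ ∈ S, (ω ξ : ℂ) * ψ ξ z‖ * ‖1 - Θ z‖ ≤ B) →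
        ∑ ξ ∈ S, ω ξ * F ξ k0 ^ 2 ≤ B * e ^ 2 + ∑ k, ‖c k‖ * ∑ ξ ∈ S, ω ξ * F ξ k ^ 2) := by
  classical
  have hZ : (0 : ℝ) < (Fintype.card Z : ℝ) := by exact_mod_cast Fintype.card_pos
  set n : ℝ := (Fintype.card Z : ℝ) with hn
  set u : Z → ℂ := fun z => ∑ ξ ∈ S, a ξ * ψ ξ z with hu
  set E : Finset Z := {z | lam < ‖u z‖} with hE
  set f : Z → ℂ := fun z => if lam < ‖u z‖ then u z / ‖u z‖ else 0 with hf
  have hfn : ∀ z, ‖f z‖ = if lam < ‖u z‖ then 1 else 0 := by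
    intro z
    simp only [hf]
    split_ifs with h
    · rw [norm_div, Complex.norm_real, norm_norm, div_self (hl.trans h).ne']
    · simp
  have hfs : ∑ z, ‖f z‖ = e * n := by
    rw [he]; simp only [hfn, Finset.sum_boole]; rfl
  have hfs2 : ∑ z, ‖f z‖ ^ 2 = e * n := by
    rw [he]; simp only [hfn, ite_pow, one_pow, zero_pow two_ne_zero, Finset.sum_boole]; rfl
  set G : ι → κ → ℂ := fun ξ k => ∑ z, f z * (starRingEnd ℂ) ((ψ ξ * τ k) z) with hG
  have hGle : ∀ ξ k, ‖G ξ k‖ ≤ e * n := by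
    intro ξ k
    rw [← hfs]
    refine (norm_sum_le _ _).trans (Finset.sum_le_sum fun z _ => ?_)
    rw [norm_mul, RCLike.norm_conj, AddChar.norm_apply, mul_one]
  have hFn : ∀ ξ k, ‖G ξ k‖ = (‖G ξ k‖ / n) * n := fun ξ k => by field_simp
  refine ⟨fun ξ k => ‖G ξ k‖ / n, fun ξ k => by positivity, fun ξ k => ?_, ?_, ?_, ?_⟩
  · rw [div_le_iff₀ hZ]; exact hGle ξ k
  · have h := bessel_char (S ×ˢ (univ : Finset κ)) (fun s : ι × κ => ψ s.1 * τ s.2)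
      (fun s hs s' hs' h => by
        simp only [coe_product, Set.mem_prod, mem_coe] at hs hs'
        exact Prod.ext_iff.2 (hinj _ hs.1 _ hs'.1 _ _ h)) f
    rw [hfs2, Finset.sum_product, ← hn] at h
    have h2 : (∑ ξ ∈ S, ∑ k, (‖G ξ k‖ / n) ^ 2) * n ^ 2 ≤ e * n ^ 2 := by
      rw [Finset.sum_mul]
      simp_rw [Finset.sum_mul]
      refine le_trans (le_of_eq ?_) (h.trans_eq (by ring))
      refine Finset.sum_congr rfl fun ξ _ => Finset.sum_congr rfl fun k _ => ?_
      rw [← mul_pow, ← hFn]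
    exact le_of_mul_le_mul_right h2 (by positivity)
  · intro ω hω hω1
    have h1 : lam * (e * n) ≤ ∑ ξ ∈ S, ‖a ξ‖ * ‖G ξ k0‖ := by
      have e1 : ∑ z, u z * (starRingEnd ℂ) (f z) = ((∑ z, ‖u z‖ * ‖f z‖ : ℝ) : ℂ) := by
        push_cast
        refine Finset.sum_congr rfl fun z _ => ?_
        rw [hfn]
        simp only [hf]
        split_ifs with h
        · have : (‖u z‖ : ℂ) ≠ 0 := by exact_mod_cast (hl.trans h).ne'
          rw [map_div₀, Complex.conj_ofReal, mul_div_assoc', Complex.mul_conj, div_eq_iff this,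
            Complex.normSq_eq_norm_sq]
          push_cast; ring
        · simp
      have e2 : ∑ z, u z * (starRingEnd ℂ) (f z) = ∑ ξ ∈ S, a ξ * (starRingEnd ℂ) (G ξ k0) := by
        simp only [hu, hG, map_sum, Finset.sum_mul, Finset.mul_sum, hk0]
        rw [Finset.sum_comm]
        refine Finset.sum_congr rfl fun ξ _ => Finset.sum_congr rfl fun z _ => ?_
        simp
        ring
      calc lam * (e * n) = ∑ z, lam * ‖f z‖ := by rw [← hfs, Finset.mul_sum]
        _ ≤ ∑ z, ‖u z‖ * ‖f z‖ := by
          refine Finset.sum_le_sum fun z _ => ?_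
          rw [hfn]
          split_ifs with h
          · simpa using h.le
          · simp
        _ = ‖∑ z, u z * (starRingEnd ℂ) (f z)‖ := by
          rw [e1, Complex.norm_of_nonneg (Finset.sum_nonneg fun _ _ => by positivity)]
        _ ≤ _ := by
          rw [e2]
          refine (norm_sum_le _ _).trans (le_of_eq (Finset.sum_congr rfl fun ξ _ => ?_))
          rw [norm_mul, RCLike.norm_conj]
    have h2 : (∑ ξ ∈ S, ‖a ξ‖ * ‖G ξ k0‖) ≤ ∑ ξ ∈ S, ‖a ξ‖ * (√(ω ξ) * ‖G ξ k0‖) := by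
      refine Finset.sum_le_sum fun ξ hξ => ?_
      by_cases h : a ξ = 0
      · simp [h]
      · refine mul_le_mul_of_nonneg_left (le_mul_of_one_le_left (norm_nonneg _) ?_) (norm_nonneg _)
        exact Real.one_le_sqrt.2 (hω1 ξ hξ h)
    have h3 : lam * e ≤ ∑ ξ ∈ S, ‖a ξ‖ * (√(ω ξ) * (‖G ξ k0‖ / n)) := by
      refine le_of_mul_le_mul_right ?_ hZ
      rw [mul_assoc, Finset.sum_mul]
      refine (h1.trans h2).trans (le_of_eq (Finset.sum_congr rfl fun ξ _ => ?_))
      field_simp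
    have he0 : 0 ≤ e := by
      refine nonneg_of_mul_nonneg_left ?_ hZ
      rw [he]; exact Nat.cast_nonneg _
    calc lam ^ 2 * e ^ 2 = (lam * e) ^ 2 := by ring
      _ ≤ (∑ ξ ∈ S, ‖a ξ‖ * (√(ω ξ) * (‖G ξ k0‖ / n))) ^ 2 := pow_le_pow_left₀ (by positivity) h3 2
      _ ≤ (∑ ξ ∈ S, ‖a ξ‖ ^ 2) * ∑ ξ ∈ S, (√(ω ξ) * (‖G ξ k0‖ / n)) ^ 2 :=
        Finset.sum_mul_sq_le_sq_mul_sq _ _ _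
      _ ≤ 1 * ∑ ξ ∈ S, (√(ω ξ) * (‖G ξ k0‖ / n)) ^ 2 :=
        mul_le_mul_of_nonneg_right ha (Finset.sum_nonneg fun _ _ => by positivity)
      _ = _ := by
        rw [one_mul]
        exact Finset.sum_congr rfl fun ξ _ => by rw [mul_pow, Real.sq_sqrt (hω ξ)]
  · intro ω Θ c B hω hΘ hB
    have key : ∀ k, (∑ ξ ∈ S, ((ω ξ * ‖G ξ k‖ ^ 2 : ℝ) : ℂ)) = ∑ z, ∑ z', f z * (starRingEnd ℂ) (f z') *
        ((∑ ξ ∈ S, (ω ξ : ℂ) * ψ ξ (z' - z)) * τ k (z' - z)) := by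
      intro k
      have e1 : ∀ ξ, ((ω ξ * ‖G ξ k‖ ^ 2 : ℝ) : ℂ) = ∑ z, ∑ z', f z * (starRingEnd ℂ) (f z') *
          ((ω ξ : ℂ) * ψ ξ (z' - z) * τ k (z' - z)) := by
        intro ξ
        have : ((ω ξ * ‖G ξ k‖ ^ 2 : ℝ) : ℂ) = ω ξ * (G ξ k * (starRingEnd ℂ) (G ξ k)) := by
          rw [Complex.mul_conj, Complex.normSq_eq_norm_sq]; push_cast; ring
        rw [this, hG]
        simp only [map_sum, map_mul, Complex.conj_conj, AddChar.mul_apply]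
        rw [Finset.sum_mul_sum, Finset.mul_sum]
        refine Finset.sum_congr rfl fun z _ => ?_
        rw [Finset.mul_sum]
        refine Finset.sum_congr rfl fun z' _ => ?_
        rw [sub_eq_add_neg, AddChar.map_add_eq_mul, AddChar.map_add_eq_mul, AddChar.map_neg_eq_conj,
          AddChar.map_neg_eq_conj]
        ring
      simp_rw [e1]
      rw [Finset.sum_comm]
      refine Finset.sum_congr rfl fun z _ => ?_
      rw [Finset.sum_comm]
      refine Finset.sum_congr rfl fun z' _ => ?_
      rw [← Finset.mul_sum, Finset.sum_mul]
    have hA : (∑ ξ ∈ S, ((ω ξ * ‖G ξ k0‖ ^ 2 : ℝ) : ℂ)) =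
        (∑ z, ∑ z', f z * (starRingEnd ℂ) (f z') *
          ((∑ ξ ∈ S, (ω ξ : ℂ) * ψ ξ (z' - z)) * (1 - Θ (z' - z)))) +
        ∑ k, c k * ∑ ξ ∈ S, ((ω ξ * ‖G ξ k‖ ^ 2 : ℝ) : ℂ) := by
      have e2 : ∑ k, c k * ∑ ξ ∈ S, ((ω ξ * ‖G ξ k‖ ^ 2 : ℝ) : ℂ) =
          ∑ z, ∑ z', f z * (starRingEnd ℂ) (f z') *
          ((∑ ξ ∈ S, (ω ξ : ℂ) * ψ ξ (z' - z)) * (Θ (z' - z))) := by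
        simp_rw [key, Finset.mul_sum]
        rw [Finset.sum_comm]
        refine Finset.sum_congr rfl fun z _ => ?_
        rw [Finset.sum_comm]
        refine Finset.sum_congr rfl fun z' _ => ?_
        rw [hΘ, Finset.mul_sum (f := fun k => c k * τ k (z' - z)), Finset.mul_sum]
        refine Finset.sum_congr rfl fun k _ => ?_
        ring
      rw [e2, key, ← Finset.sum_add_distrib]
      refine Finset.sum_congr rfl fun z _ => ?_
      rw [← Finset.sum_add_distrib]
      refine Finset.sum_congr rfl fun z' _ => ?_
      rw [hk0]; simp; ring
    have hA2 : ∑ ξ ∈ S, ω ξ * ‖G ξ k0‖ ^ 2 ≤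
        B * (e * n) ^ 2 + ∑ k, ‖c k‖ * ∑ ξ ∈ S, ω ξ * ‖G ξ k‖ ^ 2 := by
      have h0 : ∀ k, 0 ≤ ∑ ξ ∈ S, ω ξ * ‖G ξ k‖ ^ 2 := fun k =>
        Finset.sum_nonneg fun ξ _ => mul_nonneg (hω ξ) (by positivity)
      have := congrArg norm hA
      rw [← Complex.ofReal_sum, Complex.norm_of_nonneg (h0 k0)] at this
      rw [this]
      refine (norm_add_le _ _).trans (add_le_add ?_ ?_)
      · rw [← hfs, sq, Finset.sum_mul_sum, Finset.mul_sum]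
        refine (norm_sum_le _ _).trans (Finset.sum_le_sum fun z _ => ?_)
        rw [Finset.mul_sum]
        refine (norm_sum_le _ _).trans (Finset.sum_le_sum fun z' _ => ?_)
        rw [norm_mul, norm_mul, RCLike.norm_conj, norm_mul, mul_comm B]
        exact mul_le_mul_of_nonneg_left (hB _) (by positivity)
      · refine (norm_sum_le _ _).trans (Finset.sum_le_sum fun k _ => ?_)
        rw [norm_mul, ← Complex.ofReal_sum, Complex.norm_of_nonneg (h0 k)]
    have hn2 : (0 : ℝ) < n ^ 2 := by positivity
    have e3 : ∀ k, ∑ ξ ∈ S, ω ξ * (‖G ξ k‖ / n) ^ 2 = (∑ ξ ∈ S, ω ξ * ‖G ξ k‖ ^ 2) / n ^ 2 := by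
      intro k
      rw [Finset.sum_div]
      exact Finset.sum_congr rfl fun ξ _ => by rw [div_pow]; ring
    simp_rw [e3]
    rw [div_le_iff₀ hn2]
    refine hA2.trans (le_of_eq ?_)
    rw [add_mul, Finset.sum_mul]
    congr 1
    · ring
    · exact Finset.sum_congr rfl fun k _ => by field_simp

/-- The divisor bound. -/
lemma card_divisors_le_rpow (ε : ℝ) (hε : 0 < ε) :
    ∃ C : ℝ, 1 ≤ C ∧ ∀ n : ℕ, n ≠ 0 → (n.divisors.card : ℝ) ≤ C * (n : ℝ) ^ ε := by
  obtain ⟨A, hA1, hA⟩ : ∃ A : ℝ, 1 ≤ A ∧ ∀ a : ℕ, ((a : ℝ) + 1) ≤ A * (2 : ℝ) ^ (ε * a) := by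
    have hl : 0 < Real.log 2 * ε := mul_pos (Real.log_pos one_lt_two) hε
    refine ⟨1 + 1 / (Real.log 2 * ε), by have := one_div_pos.2 hl; linarith, fun a => ?_⟩
    rw [Real.rpow_def_of_pos two_pos, ← mul_assoc]
    have h1 := Real.add_one_le_exp (Real.log 2 * ε * a)
    have h2 : (1 : ℝ) ≤ Real.exp (Real.log 2 * ε * a) := Real.one_le_exp (by positivity)
    have h3 : (a : ℝ) ≤ 1 / (Real.log 2 * ε) * Real.exp (Real.log 2 * ε * a) := by
      rw [div_mul_eq_mul_div, le_div_iff₀ hl]; linarith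
    linarith
  set K : ℕ := ⌈(2 : ℝ) ^ (1 / ε)⌉₊ with hK
  refine ⟨A ^ K, one_le_pow₀ hA1, fun n hn => ?_⟩
  rw [Nat.card_divisors hn]
  have h1 : ∀ p ∈ n.primeFactors, ((n.factorization p + 1 : ℕ) : ℝ) ≤
      (if p < K then A else 1) * ((p : ℝ) ^ n.factorization p) ^ ε := by
    intro p hp
    have hp2 : 2 ≤ p := (Nat.prime_of_mem_primeFactors hp).two_le
    have hp2' : (2 : ℝ) ≤ p := by exact_mod_cast hp2
    push_cast
    rw [← Real.rpow_natCast, ← Real.rpow_mul (by positivity), mul_comm (n.factorization p : ℝ) ε]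
    split_ifs with h
    · refine (hA _).trans (mul_le_mul_of_nonneg_left ?_ (by linarith))
      exact Real.rpow_le_rpow two_pos.le hp2' (by positivity)
    · have h2 : (2 : ℝ) ≤ (p : ℝ) ^ ε := by
        have h3 : (2 : ℝ) ^ (1 / ε) ≤ p := (Nat.le_ceil _).trans (by exact_mod_cast not_lt.1 h)
        calc (2 : ℝ) = ((2 : ℝ) ^ (1 / ε)) ^ ε := by
              rw [← Real.rpow_mul two_pos.le, one_div_mul_cancel hε.ne', Real.rpow_one]
          _ ≤ _ := Real.rpow_le_rpow (by positivity) h3 hε.le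
      rw [one_mul, Real.rpow_mul (by positivity), Real.rpow_natCast]
      refine le_trans ?_ (pow_le_pow_left₀ two_pos.le h2 _)
      exact_mod_cast Nat.lt_two_pow_self
  push_cast
  push_cast at h1
  refine (Finset.prod_le_prod (fun _ _ => by positivity) h1).trans ?_
  rw [Finset.prod_mul_distrib, Real.finsetProd_rpow _ _ (fun _ _ => by positivity)]
  have h4 : (∏ p ∈ n.primeFactors, ((p : ℝ) ^ n.factorization p)) = n := by
    exact_mod_cast Nat.prod_factorization_pow_eq_self hn
  rw [h4]
  refine mul_le_mul_of_nonneg_right ?_ (by positivity)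
  rw [Finset.prod_ite, Finset.prod_const_one, mul_one, Finset.prod_const]
  refine pow_le_pow_right₀ hA1 ?_
  refine (Finset.card_le_card (t := range K) fun p hp => ?_).trans_eq (card_range K)
  simp only [mem_filter] at hp
  exact mem_range.2 hp.2

lemma sum_inv_le_rpow (ε : ℝ) (hε : 0 < ε) (hε1 : ε ≤ 1) (n : ℕ) (hn : 1 ≤ n) :
    ∑ i ∈ Icc 1 n, (1 : ℝ) / i ≤ 1 / ε * (n : ℝ) ^ ε := by
  have h := harmonic_le_one_add_log n
  rw [harmonic_eq_sum_Icc] at h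
  push_cast at h
  simp_rw [one_div] at *
  refine h.trans ?_
  have hn' : (0 : ℝ) < n := by exact_mod_cast hn
  have h1 := Real.add_one_le_exp (Real.log n * ε)
  rw [← Real.rpow_def_of_pos hn'] at h1
  rw [← div_eq_inv_mul, le_div_iff₀ hε]
  linarith

lemma sum_min_sq_le {A : ℝ} (hA : 0 < A) {L : ℕ} (hL : 1 ≤ L) (J : ℕ) :
    ∑ k ∈ Icc 1 J, (if L ∣ k then (min A (1 / (k : ℝ))) ^ 2 else 0) ≤ 4 * A / L := by
  have hL' : (0 : ℝ) < L := by exact_mod_cast hL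
  rw [← Finset.sum_filter]
  have hs : (Icc 1 J).filter (fun k => L ∣ k) ⊆ (range J).image fun i => L * (i + 1) := by
    intro k hk
    simp only [mem_filter, mem_Icc] at hk
    obtain ⟨⟨h1, h2⟩, j, rfl⟩ := hk
    have hj : 1 ≤ j := by
      rcases Nat.eq_zero_or_pos j with h | h
      · subst h; simp at h1
      · exact h
    simp only [mem_image, mem_range]
    refine ⟨j - 1, ?_, ?_⟩
    · have : j ≤ L * j := Nat.le_mul_of_pos_left _ (by omega)
      omega
    · rw [Nat.sub_add_cancel hj]
  refine (Finset.sum_le_sum_of_subset_of_nonneg hs fun _ _ _ => by positivity).trans ?_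
  rw [Finset.sum_image (by intro x _ y _ h; simpa [show L ≠ 0 by omega] using h)]
  have h1 : ∀ i ∈ range J, (min A (1 / ((L * (i + 1) : ℕ) : ℝ))) ^ 2 ≤
      4 * A ^ 2 * (1 / (1 + (A * L) * ((i + 1 : ℕ) : ℝ)) ^ 2) := by
    intro i _
    have hx : (0 : ℝ) < ((L * (i + 1) : ℕ) : ℝ) := by positivity
    have e1 : (A * L) * ((i + 1 : ℕ) : ℝ) = A * ((L * (i + 1) : ℕ) : ℝ) := by push_cast; ring
    rw [e1]
    set x : ℝ := ((L * (i + 1) : ℕ) : ℝ)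
    have h2 : min A (1 / x) ≤ 2 * A / (1 + A * x) := by
      rw [le_div_iff₀ (by positivity)]
      have h3 : min A (1 / x) * x ≤ 1 := by
        calc _ ≤ 1 / x * x := mul_le_mul_of_nonneg_right (min_le_right _ _) hx.le
          _ = 1 := by field_simp
      have h4 : min A (1 / x) ≤ A := min_le_left _ _
      nlinarith
    calc _ ≤ (2 * A / (1 + A * x)) ^ 2 :=
          pow_le_pow_left₀ (le_min hA.le (by positivity)) h2 2
      _ = _ := by rw [div_pow]; ring
  refine (Finset.sum_le_sum h1).trans ?_
  rw [← Finset.mul_sum]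
  refine (mul_le_mul_of_nonneg_left (sum_inv_one_add_sq (X := A * L) (by positivity) J) (by positivity)).trans
    (le_of_eq ?_)
  field_simp

/-- The number of divisors of `k` in `[1, Q]`. -/
def tauLe (Q k : ℕ) : ℕ := #{d ∈ Icc 1 Q | d ∣ k}

lemma tauLe_pow_eq (Q k m : ℕ) :
    ((tauLe Q k : ℝ)) ^ m = ∑ d ∈ Fintype.piFinset (fun _ : Fin m => Icc 1 Q),
      if ∀ i, d i ∣ k then (1 : ℝ) else 0 := by
  rw [Finset.sum_boole]
  have : (Fintype.piFinset (fun _ : Fin m => Icc 1 Q)).filter (fun d => ∀ i, d i ∣ k) =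
      Fintype.piFinset (fun _ : Fin m => (Icc 1 Q).filter (fun d => d ∣ k)) := by
    ext d
    simp only [mem_filter, Fintype.mem_piFinset]
    exact ⟨fun h i => ⟨h.1 i, h.2 i⟩, fun h => ⟨fun i => (h i).1, fun i => (h i).2⟩⟩
  rw [this, Fintype.card_piFinset]
  simp [tauLe]

lemma sum_tauLe_pow_le (m : ℕ) (ε : ℝ) (hε : 0 < ε) :
    ∃ C : ℝ, 0 ≤ C ∧ ∀ Q : ℕ, 1 ≤ Q → ∀ A : ℝ, 0 < A → ∀ J : ℕ,
      ∑ k ∈ Icc 1 J, (min A (1 / (k : ℝ))) ^ 2 * (tauLe Q k : ℝ) ^ m ≤ C * A * (Q : ℝ) ^ ε := by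
  classical
  rcases Nat.eq_zero_or_pos m with hm | hm
  · subst hm
    refine ⟨4, by norm_num, fun Q hQ A hA J => ?_⟩
    have h := sum_min_sq_le hA le_rfl J
    simp only [one_dvd, if_true] at h
    have hQ1 : (1 : ℝ) ≤ (Q : ℝ) ^ ε := Real.one_le_rpow (by exact_mod_cast hQ) hε.le
    simp only [pow_zero, mul_one]
    refine h.trans ?_
    rw [Nat.cast_one, div_one]
    exact le_mul_of_one_le_right (by positivity) hQ1
  have hm' : (0 : ℝ) < m := by exact_mod_cast hm
  set η : ℝ := min 1 (ε / (m * (m + 1))) with hη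
  have hη0 : 0 < η := lt_min one_pos (by positivity)
  obtain ⟨D, hD1, hD⟩ := card_divisors_le_rpow η hη0
  refine ⟨4 * (D ^ m * (1 / η)), by positivity, fun Q hQ A hA J => ?_⟩
  have hQ' : (1 : ℝ) ≤ Q := by exact_mod_cast hQ
  have h1 : ∀ d ∈ Fintype.piFinset (fun _ : Fin m => Icc 1 Q),
      ∑ k ∈ Icc 1 J, (if ∀ i, d i ∣ k then (min A (1 / (k : ℝ))) ^ 2 else 0) ≤
        4 * A * ∑ l ∈ Icc 1 (Q ^ m), (if ∀ i, d i ∣ l then (1 : ℝ) / l else 0) := by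
    intro d hd
    simp only [Fintype.mem_piFinset, mem_Icc] at hd
    set L : ℕ := Finset.univ.lcm d
    have hL0 : 1 ≤ L := by
      rw [Nat.one_le_iff_ne_zero]
      intro h
      rw [Finset.lcm_eq_zero_iff] at h
      obtain ⟨i, _, hi⟩ := h
      have := (hd i).1; omega
    have hdvd : ∀ k : ℕ, (∀ i, d i ∣ k) ↔ L ∣ k := by
      intro k
      rw [Finset.lcm_dvd_iff]; simp
    have hLQ : L ≤ Q ^ m := by
      have : L ∣ ∏ i, d i := Finset.lcm_dvd fun i hi => Finset.dvd_prod_of_mem d hi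
      refine (Nat.le_of_dvd (Finset.prod_pos fun i _ => (hd i).1) this).trans ?_
      refine (Finset.prod_le_prod' fun i _ => (hd i).2).trans ?_
      simp
    simp_rw [hdvd]
    refine (sum_min_sq_le hA hL0 J).trans ?_
    rw [div_eq_mul_one_div]
    refine mul_le_mul_of_nonneg_left ?_ (by positivity)
    refine le_trans (le_of_eq ?_) (Finset.single_le_sum (f := fun l : ℕ => if L ∣ l then (1 : ℝ) / l else 0)
      (fun l _ => by positivity) (mem_Icc.2 ⟨hL0, hLQ⟩))
    simp
  have h2 : ∑ k ∈ Icc 1 J, (min A (1 / (k : ℝ))) ^ 2 * (tauLe Q k : ℝ) ^ m =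
      ∑ d ∈ Fintype.piFinset (fun _ : Fin m => Icc 1 Q),
        ∑ k ∈ Icc 1 J, (if ∀ i, d i ∣ k then (min A (1 / (k : ℝ))) ^ 2 else 0) := by
    rw [Finset.sum_comm]
    refine Finset.sum_congr rfl fun k _ => ?_
    rw [tauLe_pow_eq, Finset.mul_sum]
    exact Finset.sum_congr rfl fun d _ => by rw [mul_ite, mul_one, mul_zero]
  rw [h2]
  refine (Finset.sum_le_sum h1).trans ?_
  rw [← Finset.mul_sum, Finset.sum_comm]
  have h3 : ∀ l ∈ Icc 1 (Q ^ m), (∑ d ∈ Fintype.piFinset (fun _ : Fin m => Icc 1 Q),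
      if ∀ i, d i ∣ l then (1 : ℝ) / l else 0) ≤ (D * ((Q : ℝ) ^ m) ^ η) ^ m * (1 / l) := by
    intro l hl
    rw [mem_Icc] at hl
    have : ∀ d : Fin m → ℕ, (if ∀ i, d i ∣ l then (1 : ℝ) / l else 0) =
        (if ∀ i, d i ∣ l then (1 : ℝ) else 0) * (1 / l) := fun d => by rw [ite_mul, one_mul, zero_mul]
    simp_rw [this]
    rw [← Finset.sum_mul, ← tauLe_pow_eq]
    refine mul_le_mul_of_nonneg_right (pow_le_pow_left₀ (by positivity) ?_ m) (by positivity)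
    have h4 : tauLe Q l ≤ l.divisors.card := by
      refine Finset.card_le_card fun d hd => ?_
      rw [mem_filter] at hd
      rw [Nat.mem_divisors]; exact ⟨hd.2, by omega⟩
    calc (tauLe Q l : ℝ) ≤ l.divisors.card := by exact_mod_cast h4
      _ ≤ D * (l : ℝ) ^ η := hD l (by omega)
      _ ≤ _ := by
        refine mul_le_mul_of_nonneg_left (Real.rpow_le_rpow (by positivity) ?_ hη0.le) (by linarith)
        exact_mod_cast hl.2
  have h5 : ∑ l ∈ Icc 1 (Q ^ m), (1 : ℝ) / l ≤ 1 / η * ((Q : ℝ) ^ m) ^ η := by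
    have := sum_inv_le_rpow η hη0 (min_le_left _ _) (Q ^ m) (Nat.one_le_pow _ _ hQ)
    simpa using this
  calc _ ≤ 4 * A * ∑ l ∈ Icc 1 (Q ^ m), (D * ((Q : ℝ) ^ m) ^ η) ^ m * (1 / (l : ℝ)) :=
        mul_le_mul_of_nonneg_left (Finset.sum_le_sum h3) (by positivity)
    _ ≤ 4 * A * ((D * ((Q : ℝ) ^ m) ^ η) ^ m * (1 / η * ((Q : ℝ) ^ m) ^ η)) := by
        rw [← Finset.mul_sum]
        exact mul_le_mul_of_nonneg_left (mul_le_mul_of_nonneg_left h5 (by positivity)) (by positivity)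
    _ = 4 * (D ^ m * (1 / η)) * A * (((Q : ℝ) ^ m) ^ η) ^ (m + 1) := by ring
    _ ≤ _ := by
        refine mul_le_mul_of_nonneg_left ?_ (by positivity)
        rw [← Real.rpow_natCast (Q : ℝ) m, ← Real.rpow_mul (by positivity), ← Real.rpow_natCast,
          ← Real.rpow_mul (by positivity)]
        refine Real.rpow_le_rpow_of_exponent_le hQ' ?_
        have h6 : η ≤ ε / (m * (m + 1)) := min_le_right _ _
        rw [le_div_iff₀ (by positivity)] at h6
        push_cast
        nlinarith

/-- Moment bound for the majorant of the Fourier coefficients of the major arcs. -/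
lemma major_moment (m : ℕ) (hm : 2 ≤ m) :
    ∃ C : ℝ, 0 ≤ C ∧ ∀ Q : ℕ, 1 ≤ Q → ∀ A : ℝ, 0 < A → ∀ J : ℕ,
      ∑ k ∈ Icc 1 J, (min A (1 / (k : ℝ)) *
        ∑ q ∈ Icc 1 Q, (1 / (q : ℝ)) * ∑ d ∈ q.divisors, if d ∣ k then (d : ℝ) else 0) ^ m ≤
        C * A ^ (m - 1) * Q := by
  classical
  obtain ⟨C, hC, h⟩ := sum_tauLe_pow_le m (1 / 2) (by norm_num)
  have hm' : (0 : ℝ) < m := by positivity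
  set η : ℝ := 1 / (2 * m) with hη
  have hη0 : 0 < η := by positivity
  have hη1 : η ≤ 1 := by
    rw [hη, div_le_one (by positivity)]
    have : (2 : ℝ) ≤ m := by exact_mod_cast hm
    linarith
  refine ⟨(1 / η) ^ m * C, by positivity, fun Q hQ A hA J => ?_⟩
  have hQ' : (1 : ℝ) ≤ Q := by exact_mod_cast hQ
  set H : ℝ := 1 / η * (Q : ℝ) ^ η with hH
  have hS : ∀ k : ℕ, ∑ q ∈ Icc 1 Q, (1 / (q : ℝ)) * ∑ d ∈ q.divisors, (if d ∣ k then (d : ℝ) else 0) ≤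
      H * tauLe Q k := by
    intro k
    have e1 : ∀ q ∈ Icc 1 Q, (1 / (q : ℝ)) * ∑ d ∈ q.divisors, (if d ∣ k then (d : ℝ) else 0) =
        ∑ d ∈ Icc 1 Q, if d ∣ k then (if d ∣ q then (d : ℝ) / q else 0) else 0 := by
      intro q hq
      rw [mem_Icc] at hq
      have : q.divisors = (Icc 1 Q).filter (fun d => d ∣ q) := by
        ext d
        simp only [Nat.mem_divisors, mem_filter, mem_Icc]
        constructor
        · rintro ⟨h1, h2⟩
          have h3 := Nat.le_of_dvd (by omega) h1
          have h4 := Nat.pos_of_dvd_of_pos h1 (by omega)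
          exact ⟨⟨h4, by omega⟩, h1⟩
        · rintro ⟨h1, h2⟩; exact ⟨h2, by omega⟩
      rw [this, Finset.sum_filter, Finset.mul_sum]
      refine Finset.sum_congr rfl fun d _ => ?_
      split_ifs <;> ring
    rw [Finset.sum_congr rfl e1, Finset.sum_comm]
    have e2 : H * tauLe Q k = ∑ d ∈ Icc 1 Q, if d ∣ k then H else 0 := by
      rw [tauLe, ← Finset.sum_filter, Finset.sum_const, nsmul_eq_mul]; ring
    rw [e2]
    refine Finset.sum_le_sum fun d hd => ?_
    rw [mem_Icc] at hd
    split_ifs with hdk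
    · refine le_trans ?_ (sum_inv_le_rpow η hη0 hη1 Q hQ)
      rw [← Finset.sum_filter]
      have hs : (Icc 1 Q).filter (fun q => d ∣ q) ⊆ (Icc 1 Q).image fun r => d * r := by
        intro q hq
        simp only [mem_filter, mem_Icc] at hq
        obtain ⟨⟨h1, h2⟩, r, rfl⟩ := hq
        refine mem_image.2 ⟨r, mem_Icc.2 ⟨?_, ?_⟩, rfl⟩
        · rcases Nat.eq_zero_or_pos r with h | h
          · subst h; simp at h1
          · exact h
        · exact (Nat.le_mul_of_pos_left r (by omega)).trans h2
      refine (Finset.sum_le_sum_of_subset_of_nonneg hs fun _ _ _ => by positivity).trans ?_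
      rw [Finset.sum_image (by intro x _ y _ h; simpa [show d ≠ 0 by omega] using h)]
      refine Finset.sum_le_sum fun r hr => le_of_eq ?_
      have : (d : ℝ) ≠ 0 := by exact_mod_cast (show d ≠ 0 by omega)
      push_cast
      rw [div_mul_eq_div_div, div_self this]
    · simp
  have h1 : ∀ k ∈ Icc 1 J, (min A (1 / (k : ℝ)) *
        ∑ q ∈ Icc 1 Q, (1 / (q : ℝ)) * ∑ d ∈ q.divisors, if d ∣ k then (d : ℝ) else 0) ^ m ≤
        (H ^ m * A ^ (m - 2)) * ((min A (1 / (k : ℝ))) ^ 2 * (tauLe Q k : ℝ) ^ m) := by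
    intro k _
    have h0 : 0 ≤ min A (1 / (k : ℝ)) := le_min hA.le (by positivity)
    rw [mul_pow]
    have h2 : (min A (1 / (k : ℝ))) ^ m ≤ A ^ (m - 2) * (min A (1 / (k : ℝ))) ^ 2 := by
      conv_lhs => rw [← Nat.sub_add_cancel hm, pow_add]
      exact mul_le_mul_of_nonneg_right (pow_le_pow_left₀ h0 (min_le_left _ _) _) (by positivity)
    have h3 := pow_le_pow_left₀ (Finset.sum_nonneg fun q _ => mul_nonneg (by positivity)
      (Finset.sum_nonneg fun d _ => by positivity)) (hS k) m
    refine (mul_le_mul h2 h3 (by positivity) (by positivity)).trans (le_of_eq ?_)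
    rw [mul_pow]; ring
  refine (Finset.sum_le_sum h1).trans ?_
  rw [← Finset.mul_sum]
  refine (mul_le_mul_of_nonneg_left (h Q hQ A hA J) (by positivity)).trans (le_of_eq ?_)
  have e3 : A ^ (m - 2) * A = A ^ (m - 1) := by
    rw [← pow_succ]; congr 1; omega
  have e4 : H ^ m = (1 / η) ^ m * (Q : ℝ) ^ (1 / 2 : ℝ) := by
    rw [hH, mul_pow, ← Real.rpow_natCast ((Q : ℝ) ^ η), ← Real.rpow_mul (by positivity)]
    congr 2
    rw [hη]; field_simp
  have e5 : (Q : ℝ) ^ (1 / 2 : ℝ) * (Q : ℝ) ^ (1 / 2 : ℝ) = Q := by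
    rw [← Real.rpow_add (by positivity)]; norm_num
  calc _ = (1 / η) ^ m * C * (A ^ (m - 2) * A) * ((Q : ℝ) ^ (1 / 2 : ℝ) * (Q : ℝ) ^ (1 / 2 : ℝ)) := by
        rw [e4]; ring
    _ = _ := by rw [e3, e5]

lemma ee_nat_mul (n : ℕ) (θ : ℝ) : ee (n * θ) = ee θ ^ n := by
  rw [ee, ee, ← Complex.exp_nat_mul]; congr 1; push_cast; ring

lemma ee_eq_one_iff (θ : ℝ) : ee θ = 1 ↔ ∃ z : ℤ, θ = z := by
  constructor
  · intro h
    have := four_nd_le θ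
    rw [h, sub_self, norm_zero] at this
    refine ⟨round θ, ?_⟩
    have h0 : nd θ = 0 := le_antisymm (by linarith) (nd_nonneg θ)
    rw [nd, abs_eq_zero] at h0
    linarith
  · rintro ⟨z, rfl⟩; exact ee_int z

lemma norm_geom_ee_le (n : ℕ) (θ : ℝ) : ‖∑ i ∈ range n, ee θ ^ i‖ * (2 * nd θ) ≤ 1 := by
  have h1 : (∑ i ∈ range n, ee θ ^ i) * (ee θ - 1) = ee θ ^ n - 1 := geom_sum_mul _ _
  have h2 : ‖∑ i ∈ range n, ee θ ^ i‖ * ‖ee θ - 1‖ ≤ 2 := by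
    rw [← norm_mul, h1]
    refine (norm_sub_le _ _).trans ?_
    rw [norm_pow, norm_ee]; norm_num
  have h3 := mul_le_mul_of_nonneg_left (four_nd_le θ) (norm_nonneg (∑ i ∈ range n, ee θ ^ i))
  linarith

lemma norm_complete_sum_le {r : ℕ} (hr : 1 ≤ r) (k : ℤ) :
    ‖∑ b ∈ range r, ee (b * (k / r : ℝ))‖ ≤ if (r : ℤ) ∣ k then (r : ℝ) else 0 := by
  have hr' : (r : ℝ) ≠ 0 := by exact_mod_cast (show r ≠ 0 by omega)
  split_ifs with h
  · refine (norm_sum_le _ _).trans ?_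
    simp [norm_ee]
  · simp_rw [ee_nat_mul]
    have h1 : ee (k / r : ℝ) ≠ 1 := by
      rw [Ne, ee_eq_one_iff]
      rintro ⟨z, hz⟩
      refine h ⟨z, ?_⟩
      rw [div_eq_iff hr'] at hz
      have : (k : ℝ) = ((r * z : ℤ) : ℝ) := by rw [hz]; push_cast; ring
      exact_mod_cast this
    rw [geom_sum_eq h1, ← ee_nat_mul, mul_div_cancel₀ _ hr', ee_int]
    simp

/-- Bound for Ramanujan sums. -/
lemma norm_ramanujan_le {q : ℕ} (hq : 1 ≤ q) (k : ℤ) :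
    ‖∑ a ∈ (range q).filter (fun a => a.Coprime q), ee (a * (k / q : ℝ))‖ ≤
      ∑ d ∈ q.divisors, if (d : ℤ) ∣ k then (d : ℝ) else 0 := by
  classical
  have hq' : (q : ℝ) ≠ 0 := by exact_mod_cast (show q ≠ 0 by omega)
  have hmob : ∀ a : ℕ, (if a.Coprime q then (1 : ℂ) else 0) =
      ∑ d ∈ q.divisors, if d ∣ a then ((ArithmeticFunction.moebius d : ℤ) : ℂ) else 0 := by
    intro a
    have h1 := congrFun (congrArg DFunLike.coe ArithmeticFunction.coe_zeta_mul_moebius) (a.gcd q)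
    rw [ArithmeticFunction.coe_zeta_mul_apply, ArithmeticFunction.one_apply] at h1
    have h2 : (a.gcd q).divisors = q.divisors.filter (fun d => d ∣ a) := by
      ext d
      simp only [Nat.mem_divisors, mem_filter, Nat.dvd_gcd_iff, Ne, Nat.gcd_eq_zero_iff]
      constructor
      · rintro ⟨⟨h1, h2⟩, _⟩; exact ⟨⟨h2, by omega⟩, h1⟩
      · rintro ⟨⟨h1, h2⟩, h3⟩; exact ⟨⟨h3, h1⟩, by omega⟩
    rw [← Finset.sum_filter, ← h2]
    have h3 := congrArg (fun z : ℤ => (z : ℂ)) h1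
    simp only [Int.cast_sum] at h3
    rw [h3]
    simp only [Nat.Coprime]
    split_ifs <;> simp
  have e1 : ∑ a ∈ (range q).filter (fun a => a.Coprime q), ee (a * (k / q : ℝ)) =
      ∑ d ∈ q.divisors, ((ArithmeticFunction.moebius d : ℤ) : ℂ) *
        ∑ b ∈ range (q / d), ee (b * (k / (q / d : ℕ) : ℝ)) := by
    have e2 : ∀ a : ℕ, (if a.Coprime q then ee (a * (k / q : ℝ)) else 0) =
        ∑ d ∈ q.divisors, (if d ∣ a then ((ArithmeticFunction.moebius d : ℤ) : ℂ) * ee (a * (k / q : ℝ)) else 0) := by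
      intro a
      have := congrArg (· * ee (a * (k / q : ℝ))) (hmob a)
      simp only [Finset.sum_mul, ite_mul, one_mul, zero_mul] at this
      exact this
    rw [Finset.sum_filter]
    simp_rw [e2]
    rw [Finset.sum_comm]
    refine Finset.sum_congr rfl fun d hd => ?_
    rw [Nat.mem_divisors] at hd
    obtain ⟨r, hr⟩ := hd.1
    have hd0 : 0 < d := Nat.pos_of_dvd_of_pos hd.1 (by omega)
    have hdr : (d : ℝ) ≠ 0 := by exact_mod_cast hd0.ne'
    have hqd : q / d = r := by rw [hr]; exact Nat.mul_div_cancel_left r hd0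
    rw [hqd, ← Finset.sum_filter, Finset.mul_sum]
    have hs : (range q).filter (fun a => d ∣ a) = (range r).image fun b => d * b := by
      ext a
      simp only [mem_filter, mem_range, mem_image]
      constructor
      · rintro ⟨h1, b, rfl⟩
        exact ⟨b, lt_of_mul_lt_mul_left (hr ▸ h1) (Nat.zero_le d), rfl⟩
      · rintro ⟨b, h1, rfl⟩
        exact ⟨by rw [hr]; exact Nat.mul_lt_mul_of_pos_left h1 hd0, b, rfl⟩
    rw [hs, Finset.sum_image (by intro x _ y _ h; simpa [hd0.ne'] using h)]
    refine Finset.sum_congr rfl fun b _ => ?_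
    congr 2
    rw [hr]; push_cast
    rw [mul_div_assoc', mul_div_assoc', mul_assoc, mul_div_mul_left _ _ hdr]
  rw [e1]
  refine (norm_sum_le _ _).trans ?_
  rw [← Nat.sum_div_divisors q (fun d => if (d : ℤ) ∣ k then (d : ℝ) else 0)]
  refine Finset.sum_le_sum fun d hd => ?_
  rw [Nat.mem_divisors] at hd
  have hd0 : 0 < d := Nat.pos_of_dvd_of_pos hd.1 (by omega)
  rw [norm_mul]
  have h1 : ‖((ArithmeticFunction.moebius d : ℤ) : ℂ)‖ ≤ 1 := by
    rw [Complex.norm_intCast]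
    exact_mod_cast ArithmeticFunction.abs_moebius_le_one
  refine (mul_le_of_le_one_left (norm_nonneg _) h1).trans (norm_complete_sum_le ?_ k)
  exact Nat.div_pos (Nat.le_of_dvd (by omega) hd.1) hd0

lemma stdAddChar_intCast {T : ℕ} [NeZero T] (j : ℤ) : ZMod.stdAddChar (j : ZMod T) = ee (j / T) := by
  rw [ZMod.stdAddChar_coe, ee]; congr 1; push_cast; ring

/-- Fourier inversion on `ZMod T`. -/
lemma zmod_fourier {T : ℕ} [NeZero T] (f : ZMod T → ℂ) (j : ZMod T) :
    f j = ∑ k : ZMod T, ((1 / (T : ℂ)) * ∑ l, f l * ZMod.stdAddChar (-(k * l))) * ZMod.stdAddChar (k * j) := by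
  have hT : (T : ℂ) ≠ 0 := by exact_mod_cast NeZero.ne T
  have h1 : ∀ l : ZMod T, ∑ k : ZMod T, ZMod.stdAddChar (-(k * l)) * ZMod.stdAddChar (k * j) =
      if l = j then (T : ℂ) else 0 := by
    intro l
    have h2 : ∀ k : ZMod T, (ZMod.stdAddChar (-(k * l)) * ZMod.stdAddChar (k * j) : ℂ) =
        ZMod.stdAddChar (k * (j - l)) := by
      intro k
      rw [← AddChar.map_add_eq_mul]; congr 1; ring
    simp_rw [h2]
    have h3 := AddChar.sum_mulShift (j - l) (ZMod.isPrimitive_stdAddChar T)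
    rw [h3, ZMod.card]
    simp only [sub_eq_zero, eq_comm (a := j)]
    split_ifs <;> simp
  have h4 : ∑ k : ZMod T, ((1 / (T : ℂ)) * ∑ l, f l * ZMod.stdAddChar (-(k * l))) * ZMod.stdAddChar (k * j) =
      ∑ l, (1 / (T : ℂ)) * f l * ∑ k : ZMod T, ZMod.stdAddChar (-(k * l)) * ZMod.stdAddChar (k * j) := by
    simp_rw [Finset.mul_sum, Finset.sum_mul]
    rw [Finset.sum_comm]
    exact Finset.sum_congr rfl fun l _ => Finset.sum_congr rfl fun k _ => by ring
  rw [h4]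
  simp_rw [h1]
  simp [hT, mul_comm]

/-- Half-length (in grid steps) of the major arc with denominator `q`. -/
def arcLen (T N Q q : ℕ) : ℕ := T * Q / (q * N ^ 2)

/-- Parameters `(q, a, i)` of points of the major arcs. -/
def arcSet (T N Q : ℕ) : Finset (Σ _ : ℕ, ℕ × ℕ) :=
  (Icc 1 Q).sigma fun q => ((range q).filter fun a => a.Coprime q) ×ˢ range (2 * arcLen T N Q q + 1)

/-- The grid point with parameters `(q, a, i)`. -/
def arcPt (T N Q : ℕ) (s : Σ _ : ℕ, ℕ × ℕ) : ℤ :=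
  s.2.1 * (T / s.1 : ℕ) + (s.2.2 - arcLen T N Q s.1)

lemma arcPt_injOn {T N Q : ℕ} [NeZero T] (hN : 1 ≤ N) (hQN : 2 * Q ^ 2 < N ^ 2)
    (hT : ∀ q, 1 ≤ q → q ≤ Q → q ∣ T) :
    Set.InjOn (fun s => ((arcPt T N Q s : ℤ) : ZMod T)) (arcSet T N Q) := by
  rintro ⟨q, a, i⟩ hs ⟨q', a', i'⟩ hs' h
  simp only [arcSet, coe_sigma, Set.mem_sigma_iff, mem_coe, mem_Icc, mem_product, mem_filter, mem_range]
    at hs hs'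
  obtain ⟨⟨hq1, hqQ⟩, ⟨ha, haq⟩, hi⟩ := hs
  obtain ⟨⟨hq1', hqQ'⟩, ⟨ha', haq'⟩, hi'⟩ := hs'
  obtain ⟨s, hs⟩ := hT q hq1 hqQ
  obtain ⟨s', hs'⟩ := hT q' hq1' hqQ'
  have hT0 : 0 < T := Nat.pos_of_ne_zero (NeZero.ne T)
  have hts : T / q = s := by rw [hs]; exact Nat.mul_div_cancel_left s (by omega)
  have hts' : T / q' = s' := by rw [hs']; exact Nat.mul_div_cancel_left s' (by omega)
  simp only [arcPt, hts, hts'] at h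
  rw [ZMod.intCast_eq_intCast_iff_dvd_sub] at h
  obtain ⟨z, hz⟩ := h
  set B : ℕ := arcLen T N Q q with hB
  set B' : ℕ := arcLen T N Q q' with hB'
  have hBle : B * (q * N ^ 2) ≤ T * Q := Nat.div_mul_le_self _ _
  have hBle' : B' * (q' * N ^ 2) ≤ T * Q := Nat.div_mul_le_self _ _
  have key : (T : ℤ) * (a' * q - a * q' - z * q * q') = q * q' * ((i - B) - (i' - B')) := by
    have e1 : (T : ℤ) = q * s := by exact_mod_cast hs
    have e2 : (T : ℤ) = q' * s' := by exact_mod_cast hs'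
    linear_combination q * q' * hz + a' * q * e2 - a * q' * e1
  set w : ℤ := a' * q - a * q' - z * q * q' with hw
  have hib : |((i : ℤ) - B) - (i' - B')| ≤ B + B' := by
    rw [abs_le]; constructor <;> omega
  have hlt : |w| < 1 := by
    have h1 : (T : ℤ) * |w| = q * q' * |((i : ℤ) - B) - (i' - B')| := by
      have := congrArg abs key
      rw [abs_mul, abs_mul, abs_mul, Nat.abs_cast, Nat.abs_cast, Nat.abs_cast] at this
      exact this
    have h2 : (T : ℤ) * N ^ 2 * |w| ≤ T * (2 * Q ^ 2) := by
      have hb1 : (B : ℤ) * (q * N ^ 2) ≤ T * Q := by exact_mod_cast hBle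
      have hb2 : (B' : ℤ) * (q' * N ^ 2) ≤ T * Q := by exact_mod_cast hBle'
      have hqz : (q : ℤ) ≤ Q := by exact_mod_cast hqQ
      have hqz' : (q' : ℤ) ≤ Q := by exact_mod_cast hqQ'
      have hTQ : (0 : ℤ) ≤ T * Q := by positivity
      calc (T : ℤ) * N ^ 2 * |w| = N ^ 2 * (T * |w|) := by ring
        _ = N ^ 2 * (q * q' * |((i : ℤ) - B) - (i' - B')|) := by rw [h1]
        _ ≤ N ^ 2 * (q * q' * (B + B')) := by gcongr
        _ = (B * (q * N ^ 2)) * q' + (B' * (q' * N ^ 2)) * q := by ring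
        _ ≤ (T * Q) * Q + (T * Q) * Q := by gcongr
        _ = _ := by ring
    have h3 : (T : ℤ) * (2 * Q ^ 2) < T * N ^ 2 := by
      have : (2 * Q ^ 2 : ℤ) < N ^ 2 := by exact_mod_cast hQN
      have hT0' : (0 : ℤ) < T := by exact_mod_cast hT0
      nlinarith
    by_contra! hc
    have hTN : (0 : ℤ) ≤ T * N ^ 2 := by positivity
    nlinarith
  have hw0 : w = 0 := Int.abs_lt_one_iff.1 hlt
  rw [hw0, mul_zero] at key
  have hii : ((i : ℤ) - B) - (i' - B') = 0 := by
    rcases mul_eq_zero.1 key.symm with h | h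
    · rcases mul_eq_zero.1 h with h | h <;> (exfalso; omega)
    · exact h
  have hd1 : (q : ℤ) ∣ q' := by
    have : (q : ℤ) ∣ a * q' := ⟨a' - z * q', by rw [hw] at hw0; linear_combination -hw0⟩
    exact (IsCoprime.dvd_of_dvd_mul_left (Nat.isCoprime_iff_coprime.2 haq.symm) this)
  have hd2 : (q' : ℤ) ∣ q := by
    have : (q' : ℤ) ∣ a' * q := ⟨a + z * q, by rw [hw] at hw0; linear_combination hw0⟩
    exact (IsCoprime.dvd_of_dvd_mul_left (Nat.isCoprime_iff_coprime.2 haq'.symm) this)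
  have hqq : q = q' := Nat.dvd_antisymm (by exact_mod_cast hd1) (by exact_mod_cast hd2)
  subst hqq
  have haa : (a' : ℤ) - a = z * q := by
    have hq0 : (q : ℤ) ≠ 0 := by omega
    refine mul_right_cancel₀ hq0 ?_
    rw [hw] at hw0; linear_combination hw0
  have hz0 : z = 0 := by
    by_contra hz0
    have h1 : (q : ℤ) ≤ |z * q| := by
      rw [abs_mul, Nat.abs_cast]
      exact le_mul_of_one_le_left (by positivity) (Int.one_le_abs hz0)
    rw [← haa] at h1
    rcases le_abs.1 h1 with h | h <;> omega
  rw [hz0, zero_mul] at haa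
  have ha3 : a = a' := by omega
  have hi3 : i = i' := by omega
  rw [ha3, hi3]

/-- Indicator of the major arcs. -/
noncomputable def arcInd (T N Q : ℕ) (j : ZMod T) : ℂ :=
  ∑ s ∈ arcSet T N Q, if ((arcPt T N Q s : ℤ) : ZMod T) = j then 1 else 0

lemma arcInd_eq {T N Q : ℕ} [NeZero T] (hN : 1 ≤ N) (hQN : 2 * Q ^ 2 < N ^ 2)
    (hT : ∀ q, 1 ≤ q → q ≤ Q → q ∣ T) (j : ZMod T) :
    arcInd T N Q j = 1 ∨ (arcInd T N Q j = 0 ∧ ∀ s ∈ arcSet T N Q, ((arcPt T N Q s : ℤ) : ZMod T) ≠ j) := by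
  classical
  by_cases h : ∃ s ∈ arcSet T N Q, ((arcPt T N Q s : ℤ) : ZMod T) = j
  · left
    obtain ⟨s, hs, hj⟩ := h
    rw [arcInd, Finset.sum_eq_single_of_mem s hs, if_pos hj]
    intro s' hs' hne
    rw [if_neg]
    intro hj'
    exact hne (arcPt_injOn hN hQN hT hs' hs (hj'.trans hj.symm))
  · right
    push Not at h
    refine ⟨Finset.sum_eq_zero fun s hs => if_neg (h s hs), h⟩

lemma arc_coeff_eq {T N Q : ℕ} [NeZero T] (hT : ∀ q, 1 ≤ q → q ≤ Q → q ∣ T) (k : ℤ) :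
    ∑ l : ZMod T, arcInd T N Q l * ZMod.stdAddChar (-((k : ZMod T) * l)) =
      ∑ q ∈ Icc 1 Q, (∑ a ∈ (range q).filter (fun a => a.Coprime q), ee (a * ((-k : ℤ) / q : ℝ))) *
        (ee ((arcLen T N Q q : ℝ) * (k / T)) * ∑ i ∈ range (2 * arcLen T N Q q + 1), ee ((-k : ℤ) / T) ^ i) := by
  have hT0 : (T : ℝ) ≠ 0 := by exact_mod_cast NeZero.ne T
  simp_rw [arcInd, Finset.sum_mul]
  rw [Finset.sum_comm]
  simp only [ite_mul, one_mul, zero_mul, Finset.sum_ite_eq, mem_univ, if_true]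
  rw [arcSet, Finset.sum_sigma]
  refine Finset.sum_congr rfl fun q hq => ?_
  rw [mem_Icc] at hq
  have hq0 : (q : ℝ) ≠ 0 := by exact_mod_cast (show q ≠ 0 by omega)
  rw [Finset.sum_product]
  refine Finset.sum_congr rfl fun a _ => ?_
  rw [Finset.mul_sum, Finset.mul_sum]
  refine Finset.sum_congr rfl fun i _ => ?_
  have e1 : (-((k : ZMod T) * ((arcPt T N Q ⟨q, a, i⟩ : ℤ) : ZMod T))) =
      ((-(k * arcPt T N Q ⟨q, a, i⟩) : ℤ) : ZMod T) := by push_cast; ring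
  rw [e1, stdAddChar_intCast, ← ee_nat_mul, ← ee_add, ← ee_add]
  congr 1
  simp only [arcPt]
  obtain ⟨s, hs⟩ := hT q hq.1 hq.2
  have hts : T / q = s := by rw [hs]; exact Nat.mul_div_cancel_left s (by omega)
  have hs' : (T : ℝ) = q * s := by exact_mod_cast hs
  rw [hts]
  have hs0 : (s : ℝ) ≠ 0 := by
    intro h; rw [h, mul_zero] at hs'; exact hT0 hs'
  push_cast
  rw [hs']
  field_simp
  ring

lemma arc_coeff_bound {T N Q q : ℕ} [NeZero T] (hN : 1 ≤ N) (hq : 1 ≤ q) (hqQ : q ≤ Q) (hNT : N ^ 2 ≤ T)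
    (k : ZMod T) :
    (1 / (T : ℝ)) * ‖∑ i ∈ range (2 * arcLen T N Q q + 1), ee ((-k.valMinAbs : ℤ) / T) ^ i‖ ≤
      3 * Q / q * (1 / (N : ℝ) ^ 2) ∧
    (k ≠ 0 → (1 / (T : ℝ)) * ‖∑ i ∈ range (2 * arcLen T N Q q + 1), ee ((-k.valMinAbs : ℤ) / T) ^ i‖ ≤
      3 * Q / q * (1 / (k.valMinAbs.natAbs : ℝ))) := by
  have hT0 : (0 : ℝ) < T := by exact_mod_cast Nat.pos_of_ne_zero (NeZero.ne T)
  have hq0 : (0 : ℝ) < q := by exact_mod_cast hq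
  have hN0 : (0 : ℝ) < N := by exact_mod_cast hN
  have hqQ' : (q : ℝ) ≤ Q := by exact_mod_cast hqQ
  have hNT' : (N : ℝ) ^ 2 ≤ T := by exact_mod_cast hNT
  constructor
  · have h1 : ‖∑ i ∈ range (2 * arcLen T N Q q + 1), ee ((-k.valMinAbs : ℤ) / T) ^ i‖ ≤
        2 * arcLen T N Q q + 1 := by
      refine (norm_sum_le _ _).trans ?_
      simp [norm_ee]
    have h2 : (arcLen T N Q q : ℝ) * (q * N ^ 2) ≤ T * Q := by
      exact_mod_cast Nat.div_mul_le_self (T * Q) (q * N ^ 2)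
    rw [div_mul_eq_mul_div, one_mul, div_mul_div_comm, mul_one, div_le_div_iff₀ hT0 (by positivity)]
    refine (mul_le_mul_of_nonneg_right h1 (by positivity)).trans ?_
    have h3 : (q : ℝ) * N ^ 2 ≤ Q * T := mul_le_mul hqQ' hNT' (by positivity) (by positivity)
    nlinarith
  · intro hk
    set m : ℕ := k.valMinAbs.natAbs with hm
    have hm0 : (0 : ℝ) < m := by
      have : k.valMinAbs ≠ 0 := by rwa [Ne, ZMod.valMinAbs_eq_zero]
      exact_mod_cast Int.natAbs_pos.2 this
    have hmT : (m : ℝ) ≤ T / 2 := by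
      have h1 := ZMod.natAbs_valMinAbs_le k
      have h2 : 2 * m ≤ T := by omega
      have h3 : (2 : ℝ) * m ≤ T := by exact_mod_cast h2
      linarith
    have habs : |((-k.valMinAbs : ℤ) : ℝ) / T| = m / T := by
      rw [abs_div, abs_of_pos hT0, Int.cast_neg, abs_neg, hm, Nat.cast_natAbs, Int.cast_abs]
    have hle1 : (m : ℝ) / T ≤ 1 / 2 := by rw [div_le_div_iff₀ hT0 two_pos]; linarith
    have hnd : (m : ℝ) / T ≤ nd (((-k.valMinAbs : ℤ) : ℝ) / T) := by
      have := nd_ge_min (((-k.valMinAbs : ℤ) : ℝ) / T) (by rw [habs]; linarith)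
      rw [habs, min_eq_left (by linarith)] at this
      exact this
    have h1 := norm_geom_ee_le (2 * arcLen T N Q q + 1) (((-k.valMinAbs : ℤ) : ℝ) / T)
    set S := ‖∑ i ∈ range (2 * arcLen T N Q q + 1), ee ((-k.valMinAbs : ℤ) / T) ^ i‖
    have h2 : S * (2 * (m / T)) ≤ 1 :=
      (mul_le_mul_of_nonneg_left (by linarith) (norm_nonneg _)).trans h1
    have h3 : 1 / (T : ℝ) * S ≤ 1 / m := by
      rw [le_div_iff₀ hm0]
      have : S * (2 * (m / T)) = 2 * (1 / T * S * m) := by ring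
      have h0 : 0 ≤ 1 / T * S * m := by positivity
      linarith
    refine h3.trans (le_mul_of_one_le_left (by positivity) ?_)
    rw [le_div_iff₀ hq0]; linarith

/-- Fourier coefficients of the indicator of the major arcs. -/
lemma majArc_coeff {T N Q : ℕ} [NeZero T] (hN : 1 ≤ N) (hQN : 6 * Q ^ 2 ≤ N ^ 2) (hNT : N ^ 2 ≤ T)
    (hT : ∀ q, 1 ≤ q → q ≤ Q → q ∣ T) :
    ∃ c : ZMod T → ℂ, (∀ j, arcInd T N Q j = ∑ k, c k * ZMod.stdAddChar (k * j)) ∧ ‖c 0‖ ≤ 1 / 2 ∧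
      ∀ k ≠ 0, ‖c k‖ ≤ 3 * Q * (min (1 / (N : ℝ) ^ 2) (1 / (k.valMinAbs.natAbs : ℝ)) *
        ∑ q ∈ Icc 1 Q, (1 / (q : ℝ)) * ∑ d ∈ q.divisors, if d ∣ k.valMinAbs.natAbs then (d : ℝ) else 0) := by
  have hT0 : (0 : ℝ) < T := by exact_mod_cast Nat.pos_of_ne_zero (NeZero.ne T)
  refine ⟨fun k => (1 / (T : ℂ)) * ∑ l, arcInd T N Q l * ZMod.stdAddChar (-(k * l)),
    fun j => zmod_fourier _ j, ?_, ?_⟩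
  · have h := arc_coeff_eq (N := N) hT 0
    have e0 : ((0 : ZMod T)) = ((0 : ℤ) : ZMod T) := by simp
    simp only
    rw [e0, h, Finset.mul_sum]
    refine (norm_sum_le _ _).trans ?_
    have h1 : ∀ q ∈ Icc 1 Q, ‖1 / (T : ℂ) * ((∑ a ∈ (range q).filter (fun a => a.Coprime q),
        ee (a * ((-(0 : ℤ) : ℤ) / q : ℝ))) * (ee ((arcLen T N Q q : ℝ) * ((0 : ℤ) / T)) *
          ∑ i ∈ range (2 * arcLen T N Q q + 1), ee ((-(0 : ℤ) : ℤ) / T) ^ i))‖ ≤ 3 * Q / (N : ℝ) ^ 2 := by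
      intro q hq
      rw [mem_Icc] at hq
      have hq0 : (0 : ℝ) < q := by exact_mod_cast hq.1
      have h2 := (arc_coeff_bound (T := T) hN hq.1 hq.2 hNT 0).1
      rw [ZMod.valMinAbs_zero] at h2
      rw [norm_mul, norm_mul, norm_mul, norm_ee, one_mul, norm_div, norm_one, Complex.norm_natCast]
      have h3 : ‖∑ a ∈ (range q).filter (fun a => a.Coprime q), ee (a * ((-(0 : ℤ) : ℤ) / q : ℝ))‖ ≤ q := by
        refine (norm_sum_le _ _).trans ?_
        simp only [norm_ee, Finset.sum_const, nsmul_eq_mul, mul_one]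
        exact_mod_cast (Finset.card_filter_le _ _).trans_eq (card_range q)
      rw [mul_left_comm]
      refine (mul_le_mul h3 h2 (by positivity) (by positivity)).trans (le_of_eq ?_)
      field_simp
    refine (Finset.sum_le_sum h1).trans ?_
    rw [Finset.sum_const, Nat.card_Icc, nsmul_eq_mul, Nat.add_sub_cancel]
    have hN0 : (0 : ℝ) < N := by exact_mod_cast hN
    have : (6 : ℝ) * Q ^ 2 ≤ N ^ 2 := by exact_mod_cast hQN
    rw [mul_div_assoc', div_le_div_iff₀ (by positivity) two_pos]
    nlinarith
  · intro k hk
    have h := arc_coeff_eq (T := T) (N := N) hT k.valMinAbs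
    rw [ZMod.coe_valMinAbs] at h
    simp only
    rw [h, Finset.mul_sum]
    refine (norm_sum_le _ _).trans ?_
    rw [Finset.mul_sum, Finset.mul_sum]
    refine Finset.sum_le_sum fun q hq => ?_
    rw [mem_Icc] at hq
    have hq0 : (0 : ℝ) < q := by exact_mod_cast hq.1
    obtain ⟨h1, h2⟩ := arc_coeff_bound (T := T) hN hq.1 hq.2 hNT k
    have h3 := norm_ramanujan_le hq.1 (-k.valMinAbs)
    have e3 : ∀ d : ℕ, ((d : ℤ) ∣ -k.valMinAbs) = (d ∣ k.valMinAbs.natAbs) := by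
      intro d
      rw [dvd_neg, Int.natCast_dvd]
    simp_rw [e3] at h3
    have h4 : 1 / (T : ℝ) * ‖∑ i ∈ range (2 * arcLen T N Q q + 1), ee ((-k.valMinAbs : ℤ) / T) ^ i‖ ≤
        3 * Q / q * min (1 / (N : ℝ) ^ 2) (1 / (k.valMinAbs.natAbs : ℝ)) := by
      rw [mul_min_of_nonneg _ _ (by positivity)]
      exact le_min h1 (h2 hk)
    rw [norm_mul, norm_mul, norm_mul, norm_ee, one_mul, norm_div, norm_one, Complex.norm_natCast,
      mul_left_comm]
    refine (mul_le_mul h3 h4 (by positivity) (Finset.sum_nonneg fun d _ => by positivity)).trans (le_of_eq ?_)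
    ring

/-- The character `(j, y) ↦ e((y·ξ + j|ξ|²)/T)` of the discrete space-time torus. -/
noncomputable def psi {n : ℕ} (T : ℕ) [NeZero T] (ξ : Fin n → ℤ) : AddChar (ZMod T × (Fin n → ZMod T)) ℂ :=
  (ZMod.stdAddChar (N := T)).compAddMonoidHom
    (AddMonoidHom.mk' (fun z => ∑ i, z.2 i * (ξ i : ZMod T) + z.1 * ∑ i, (ξ i : ZMod T) ^ 2) (by
      intro z w
      simp only [Prod.fst_add, Prod.snd_add, Pi.add_apply, add_mul, Finset.sum_add_distrib]
      ring))

/-- The character `(j, y) ↦ e(kj/T)` of the discrete space-time torus. -/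
noncomputable def tau (n : ℕ) {T : ℕ} [NeZero T] (k : ZMod T) : AddChar (ZMod T × (Fin n → ZMod T)) ℂ :=
  (ZMod.stdAddChar (N := T)).compAddMonoidHom
    (AddMonoidHom.mk' (fun z => k * z.1) (by intro z w; simp [mul_add]))

lemma psi_apply {n T : ℕ} [NeZero T] (ξ : Fin n → ℤ) (z : ZMod T × (Fin n → ZMod T)) :
    psi T ξ z = ZMod.stdAddChar (∑ i, z.2 i * (ξ i : ZMod T) + z.1 * ∑ i, (ξ i : ZMod T) ^ 2) := rfl

lemma tau_apply {n T : ℕ} [NeZero T] (k : ZMod T) (z : ZMod T × (Fin n → ZMod T)) :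
    tau n k z = ZMod.stdAddChar (k * z.1) := rfl

lemma tau_zero (n : ℕ) {T : ℕ} [NeZero T] : tau n (0 : ZMod T) = 1 := by
  ext z
  rw [tau_apply, zero_mul, AddChar.map_zero_eq_one, AddChar.one_apply]

lemma psi_intCast {n T : ℕ} [NeZero T] (ξ : Fin n → ℤ) (j : ℤ) (y : Fin n → ℤ) :
    psi T ξ ((j : ZMod T), fun i => (y i : ZMod T)) =
      ee (∑ i, ((y i / T : ℝ) * ξ i + (j / T : ℝ) * (ξ i : ℝ) ^ 2)) := by
  rw [psi_apply]
  have : (∑ i, (y i : ZMod T) * (ξ i : ZMod T) + (j : ZMod T) * ∑ i, (ξ i : ZMod T) ^ 2) =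
      ((∑ i, (y i * ξ i + j * ξ i ^ 2) : ℤ) : ZMod T) := by
    push_cast
    rw [Finset.sum_add_distrib, Finset.mul_sum]
  simp only
  rw [this, stdAddChar_intCast]
  congr 1
  push_cast
  rw [Finset.sum_div]
  exact Finset.sum_congr rfl fun i _ => by ring

lemma psi_tau_inj {n T N : ℕ} [NeZero T] (hT : 8 * N < T) (c : Fin n → ℤ) {ξ ξ' : Fin n → ℤ}
    (h1 : ξ ∈ cube c N) (h2 : ξ' ∈ cube c N) {k k' : ZMod T} (h : psi T ξ * tau n k = psi T ξ' * tau n k') :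
    ξ = ξ' ∧ k = k' := by
  have key : ξ = ξ' := by
    funext i
    have h3 := DFunLike.congr_fun h ((0 : ZMod T), (Pi.single i 1 : Fin n → ZMod T))
    simp only [AddChar.mul_apply, psi_apply, tau_apply, mul_zero, zero_mul, add_zero,
      AddChar.map_zero_eq_one, mul_one] at h3
    have h4 := ZMod.injective_stdAddChar h3
    simp only [Pi.single_apply, ite_mul, one_mul, zero_mul, Finset.sum_ite_eq', mem_univ, if_true] at h4
    rw [ZMod.intCast_eq_intCast_iff_dvd_sub] at h4
    rw [cube, Fintype.mem_piFinset] at h1 h2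
    have h5 := mem_Icc.1 (h1 i)
    have h6 := mem_Icc.1 (h2 i)
    have := Int.eq_zero_of_abs_lt_dvd h4 (by rw [abs_lt]; constructor <;> omega)
    omega
  refine ⟨key, ?_⟩
  subst key
  have h3 := DFunLike.congr_fun h ((1 : ZMod T), (0 : Fin n → ZMod T))
  simp only [AddChar.mul_apply] at h3
  have h4 := mul_left_cancel₀ (by rw [psi_apply]; intro h0; have := AddChar.norm_apply (ZMod.stdAddChar (N := T)) (∑ i, (0 : Fin n → ZMod T) i * (ξ i : ZMod T) + 1 * ∑ i, (ξ i : ZMod T) ^ 2); simp only at h0; rw [h0] at this; simp at this) h3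
  rw [tau_apply, tau_apply] at h4
  simpa using ZMod.injective_stdAddChar h4

/-- Proportion of a finite set on which a function exceeds a level. -/
noncomputable def lvl {Z : Type*} [Fintype Z] (u : Z → ℂ) (lam : ℝ) : ℝ :=
  (#{z | lam < ‖u z‖} : ℝ) / Fintype.card Z

/-- The discrete Schrödinger wave. -/
noncomputable def gw {n : ℕ} (T : ℕ) [NeZero T] (S : Finset (Fin n → ℤ)) (a : (Fin n → ℤ) → ℂ)
    (z : ZMod T × (Fin n → ZMod T)) : ℂ := ∑ ξ ∈ S, a ξ * psi T ξ z

lemma lvl_nonneg {Z : Type*} [Fintype Z] (u : Z → ℂ) (lam : ℝ) : 0 ≤ lvl u lam := by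
  unfold lvl; positivity

lemma sum_pow_weight_le {κ : Type*} (s : Finset κ) (w g : κ → ℝ) (hw : ∀ k ∈ s, 0 ≤ w k) (hg : ∀ k ∈ s, 0 ≤ g k)
    {e D : ℝ} {m : ℕ} (hm : 1 ≤ m) (he : 0 < e) (hge : ∑ k ∈ s, g k ≤ e) (hgD : ∀ k ∈ s, g k ≤ D) :
    (∑ k ∈ s, w k * g k) ^ m ≤ e ^ (m - 1) * (D * ∑ k ∈ s, w k ^ m) := by
  obtain ⟨m, rfl⟩ : ∃ m', m = m' + 1 := ⟨m - 1, by omega⟩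
  have hG : 0 ≤ ∑ k ∈ s, g k := Finset.sum_nonneg hg
  set G := ∑ k ∈ s, g k with hGd
  have hR : 0 ≤ D * ∑ k ∈ s, w k ^ (m + 1) := by
    rw [Finset.mul_sum]
    exact Finset.sum_nonneg fun k hk => mul_nonneg ((hg k hk).trans (hgD k hk)) (pow_nonneg (hw k hk) _)
  rcases hG.eq_or_lt with h0 | h0
  · have h1 : ∀ k ∈ s, g k = 0 := (Finset.sum_eq_zero_iff_of_nonneg hg).1 (hGd.symm.trans h0.symm)
    rw [Finset.sum_eq_zero fun k hk => by rw [h1 k hk, mul_zero], zero_pow (by omega)]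
    exact mul_nonneg (pow_nonneg he.le _) hR
  · have h1 := Real.pow_arith_mean_le_arith_mean_pow s (fun k => g k / G) w
      (fun k hk => div_nonneg (hg k hk) h0.le) (by rw [← Finset.sum_div, ← hGd, div_self h0.ne']) hw (m + 1)
    have h2 : ∑ k ∈ s, g k / G * w k = (∑ k ∈ s, w k * g k) / G := by
      rw [Finset.sum_div]; exact Finset.sum_congr rfl fun k _ => by ring
    have h3 : ∑ k ∈ s, g k / G * w k ^ (m + 1) = (∑ k ∈ s, g k * w k ^ (m + 1)) / G := by
      rw [Finset.sum_div]; exact Finset.sum_congr rfl fun k _ => by ring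
    rw [h2, h3, div_pow, div_le_div_iff₀ (by positivity) h0] at h1
    have h4 : (∑ k ∈ s, w k * g k) ^ (m + 1) ≤ G ^ m * ∑ k ∈ s, g k * w k ^ (m + 1) := by
      rw [pow_succ G, ← mul_assoc] at h1
      have := le_of_mul_le_mul_right h1 h0
      linarith
    refine h4.trans ?_
    rw [Nat.add_sub_cancel]
    have h5 : ∑ k ∈ s, g k * w k ^ (m + 1) ≤ D * ∑ k ∈ s, w k ^ (m + 1) := by
      rw [Finset.mul_sum]
      exact Finset.sum_le_sum fun k hk => mul_le_mul_of_nonneg_right (hgD k hk) (pow_nonneg (hw k hk) _)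
    exact mul_le_mul (pow_le_pow_left₀ h0.le hge _) h5
      (Finset.sum_nonneg fun k hk => mul_nonneg (hg k hk) (pow_nonneg (hw k hk) _)) (pow_nonneg he.le _)

lemma sum_zmod_le {T : ℕ} [NeZero T] {f : ℕ → ℝ} (hf : ∀ i, 0 ≤ f i) :
    ∑ k : ZMod T, f k.valMinAbs.natAbs ≤ f 0 + 2 * ∑ i ∈ range T, f (i + 1) := by
  classical
  have h1 : ∑ k : ZMod T, f k.valMinAbs.natAbs ≤ ∑ i ∈ Icc (-(T : ℤ)) T, f i.natAbs := by
    rw [← Finset.sum_image (f := fun i : ℤ => f i.natAbs) (s := univ) (g := fun k : ZMod T => k.valMinAbs)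
      (fun x _ y _ h => ZMod.valMinAbs_inj.1 h)]
    refine Finset.sum_le_sum_of_subset_of_nonneg ?_ fun i _ _ => hf _
    intro i hi
    rw [mem_image] at hi
    obtain ⟨k, -, rfl⟩ := hi
    have := ZMod.natAbs_valMinAbs_le k
    rw [mem_Icc]
    omega
  rwa [sum_Icc_natAbs] at h1

lemma exists_dirichlet (t : ℝ) {N : ℕ} (hN : 1 ≤ N) : ∃ (q : ℕ) (a : ℤ), 1 ≤ q ∧ q ≤ 64 * N ∧
    IsCoprime a (q : ℤ) ∧ |t - a / q| ≤ 1 / (64 * N * q) := by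
  obtain ⟨r, h1, h2⟩ := Real.exists_rat_abs_sub_le_and_den_le t (n := 64 * N) (by omega)
  have hd : (0 : ℝ) < r.den := by exact_mod_cast r.den_pos
  have hN' : (0 : ℝ) < N := by exact_mod_cast hN
  refine ⟨r.den, r.num, r.den_pos, h2, ?_, ?_⟩
  · rw [Int.isCoprime_iff_gcd_eq_one]
    exact r.reduced
  · rw [Rat.cast_def] at h1
    refine h1.trans ?_
    push_cast
    exact one_div_le_one_div_of_le (by positivity) (mul_le_mul_of_nonneg_right (by linarith) hd.le)

lemma grid_kernel_sq_le {n N T : ℕ} [NeZero T] (hN : 1 ≤ N) (c : Fin n → ℤ) (z : ZMod T × (Fin n → ZMod T)) :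
    ‖∑ ξ ∈ cube c N, (bw c N ξ : ℂ) * psi T ξ z‖ ^ 2 ≤
      (20000 * ∑ h ∈ Icc (-((16 * N : ℕ) : ℤ)) (16 * N : ℕ), Pm N (h * ((z.1.val : ℝ) / T))) ^ n := by
  refine le_trans (le_of_eq ?_) (kernel_sq_le hN c ((z.1.val : ℝ) / T) (fun i => ((z.2 i).val : ℝ) / T))
  congr 2
  refine Finset.sum_congr rfl fun ξ _ => ?_
  congr 1
  have h := psi_intCast ξ (T := T) (z.1.val : ℤ) (fun i => ((z.2 i).val : ℤ))
  have e : z = ((((z.1.val : ℤ)) : ZMod T), fun i => ((((z.2 i).val : ℤ)) : ZMod T)) := by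
    ext <;> simp
  rw [e, h]
  simp

lemma off_arc_le {N T Q : ℕ} [NeZero T] (hN : 1 ≤ N) (hQ : 1 ≤ Q) (hT : ∀ q, 1 ≤ q → q ≤ 64 * N → q ∣ T)
    (j : ZMod T) (h : ∀ s ∈ arcSet T N Q, ((arcPt T N Q s : ℤ) : ZMod T) ≠ j) :
    ∑ h ∈ Icc (-((16 * N : ℕ) : ℤ)) (16 * N : ℕ), Pm N (h * ((j.val : ℝ) / T)) ≤ 10000000 * N ^ 2 / Q := by
  obtain ⟨q, a, hq, hqN, hco, hβ⟩ := exists_dirichlet ((j.val : ℝ) / T) hN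
  set β := (j.val : ℝ) / T - a / q with hβd
  obtain ⟨h1, h2⟩ := sum_Pm_le hq hqN a hco β hβ
  have e : (a : ℝ) / q + β = (j.val : ℝ) / T := by rw [hβd]; ring
  rw [e] at h1 h2
  have hQ0 : (0 : ℝ) < Q := by exact_mod_cast hQ
  have hN0 : (0 : ℝ) < N := by exact_mod_cast hN
  have hq0 : (0 : ℝ) < q := by exact_mod_cast hq
  set W := ∑ h ∈ Icc (-((16 * N : ℕ) : ℤ)) (16 * N : ℕ), Pm N (h * ((j.val : ℝ) / T)) with hS
  have hS0 : 0 ≤ W := Finset.sum_nonneg fun _ _ => Pm_nonneg _ _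
  rw [le_div_iff₀ hQ0]
  by_cases hqQ : q ≤ Q
  swap
  · refine le_trans (mul_le_mul_of_nonneg_left ?_ hS0) h1
    exact_mod_cast (not_le.1 hqQ).le
  by_cases hb : q * |β| * N ^ 2 ≤ Q
  swap
  · have h3 : W * Q ≤ W * (q * |β|) * N ^ 2 := by
      rw [mul_assoc]; exact mul_le_mul_of_nonneg_left (not_le.1 hb).le hS0
    nlinarith
  exfalso
  have hT0 : (0 : ℝ) < T := by exact_mod_cast Nat.pos_of_ne_zero (NeZero.ne T)
  obtain ⟨s, hs⟩ := hT q hq hqN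
  have hTs : T / q = s := by rw [hs]; exact Nat.mul_div_cancel_left s (by omega)
  set i : ℤ := (j.val : ℤ) - a * s with hi
  have hsT : (T : ℝ) = q * s := by exact_mod_cast hs
  have hs0 : (s : ℝ) ≠ 0 := by
    intro h; rw [h, mul_zero] at hsT; exact hT0.ne' hsT
  have hiβ : (i : ℝ) = β * T := by
    rw [hi, hβd, hsT]; push_cast; field_simp
  have hle : i.natAbs ≤ arcLen T N Q q := by
    rw [arcLen, Nat.le_div_iff_mul_le (by positivity)]
    have : (i.natAbs : ℝ) * (q * N ^ 2) ≤ T * Q := by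
      rw [Nat.cast_natAbs, Int.cast_abs, hiβ, abs_mul, abs_of_pos hT0]
      calc |β| * T * (q * N ^ 2) = T * (q * |β| * N ^ 2) := by ring
        _ ≤ _ := mul_le_mul_of_nonneg_left hb hT0.le
    exact_mod_cast this
  have ha0 := Int.emod_nonneg a (show (q : ℤ) ≠ 0 by omega)
  have ha1 := Int.emod_lt_of_pos a (show (0 : ℤ) < q by omega)
  refine h ⟨q, (a % q).toNat, (i + arcLen T N Q q).toNat⟩ ?_ ?_
  · simp only [arcSet, mem_sigma, mem_product, mem_filter, mem_range, mem_Icc]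
    refine ⟨⟨hq, hqQ⟩, ⟨by omega, ?_⟩, by omega⟩
    rw [← Nat.isCoprime_iff_coprime, Int.toNat_of_nonneg ha0]
    have : IsCoprime (a - q * (a / q)) (q : ℤ) := by
      have := IsCoprime.add_mul_left_left hco (-(a / q))
      rwa [mul_neg, ← sub_eq_add_neg] at this
    rwa [Int.emod_def]
  · have hj : j = (((j.val : ℤ)) : ZMod T) := by simp
    rw [hj, ZMod.intCast_eq_intCast_iff_dvd_sub]
    simp only [arcPt]
    rw [hTs, Int.toNat_of_nonneg ha0, Int.toNat_of_nonneg (by omega)]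
    have hTz : (T : ℤ) = q * s := by exact_mod_cast hs
    refine ⟨a / q, ?_⟩
    rw [Int.emod_def, hTz]
    have : (j.val : ℤ) = i + a * s := by rw [hi]; ring
    rw [this]; ring

lemma card_cube_le {n N : ℕ} (hN : 1 ≤ N) (c : Fin n → ℤ) : (#(cube c N) : ℝ) ≤ (9 * N : ℝ) ^ n := by
  rw [cube, Fintype.card_piFinset]
  have h : ∀ i, #(Icc (c i - 4 * (N : ℤ)) (c i + 4 * N)) ≤ 9 * N := by
    intro i; rw [Int.card_Icc]; omega
  have := Finset.prod_le_prod' (s := univ) fun i _ => h i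
  rw [Finset.prod_const, card_univ, Fintype.card_fin] at this
  exact_mod_cast this

lemma norm_gw_sq_le {n T : ℕ} [NeZero T] (S : Finset (Fin n → ℤ)) (a : (Fin n → ℤ) → ℂ)
    (z : ZMod T × (Fin n → ZMod T)) : ‖gw T S a z‖ ^ 2 ≤ #S * ∑ ξ ∈ S, ‖a ξ‖ ^ 2 := by
  have h : ‖gw T S a z‖ ≤ ∑ ξ ∈ S, ‖a ξ‖ := by
    refine (norm_sum_le _ _).trans (le_of_eq ?_)
    simp
  exact (pow_le_pow_left₀ (norm_nonneg _) h 2).trans (sq_sum_le_card_mul_sum_sq)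

lemma exists_of_lvl_pos {Z : Type*} [Fintype Z] {u : Z → ℂ} {lam : ℝ} (h : 0 < lvl u lam) :
    ∃ z, lam < ‖u z‖ := by
  by_contra! hz
  rw [lvl, Finset.filter_false_of_mem fun z _ => not_lt.2 (hz z)] at h
  simp at h

lemma lvl_mul_card {Z : Type*} [Fintype Z] [Nonempty Z] (u : Z → ℂ) (lam : ℝ) :
    lvl u lam * Fintype.card Z = #{z | lam < ‖u z‖} :=
  div_mul_cancel₀ _ (by exact_mod_cast Fintype.card_ne_zero)

/-- Large level sets: distributional estimate for `λ ≳ N^{n/4}`, with `λ⁴ = μⁿ`. -/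
lemma large_level (n m : ℕ) (hn : 1 ≤ n) (hm : 2 ≤ m) : ∃ C : ℝ, 1 ≤ C ∧ ∀ N : ℕ, 1 ≤ N → ∀ (T : ℕ) [NeZero T],
    (∀ q, 1 ≤ q → q ≤ 64 * N → q ∣ T) → N ^ 2 ≤ T → 8 * N < T → ∀ (c : Fin n → ℤ) (a : (Fin n → ℤ) → ℂ),
    (∀ ξ, a ξ ≠ 0 → ∀ i, |ξ i - c i| ≤ N) → ∑ ξ ∈ cube c N, ‖a ξ‖ ^ 2 ≤ 1 →
    ∀ lam μ : ℝ, 0 < lam → 0 < μ → lam ^ 4 = μ ^ n → C * N ≤ μ →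
      lvl (gw T (cube c N) a) lam ^ (m - 1) * lam ^ (2 * m) * μ ^ (m + 1) ≤ C * (N : ℝ) ^ (n + 4) := by
  classical
  obtain ⟨D, hD0, hD⟩ := major_moment m hm
  set K : ℝ := 3200000000000 with hK
  set C₁ : ℝ := 4 ^ m * 9 ^ n * (2 * D * 3 ^ m) * (2 * K) ^ (m + 1) with hC₁
  have hC₁0 : 0 ≤ C₁ := by positivity
  refine ⟨C₁ + 7 * K, by rw [hK]; linarith, ?_⟩
  intro N hN T _ hT hNT hT8 c a hsupp ha lam μ hl hμ hlμ hμN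
  set u := gw T (cube c N) a with hu
  set e := lvl u lam with he
  have hN0 : (1 : ℝ) ≤ N := by exact_mod_cast hN
  have he0 : 0 ≤ e := lvl_nonneg _ _
  rcases he0.eq_or_lt with h0 | he0
  · rw [← h0, zero_pow (by omega)]
    simp only [zero_mul]; positivity
  obtain ⟨z, hz⟩ := exists_of_lvl_pos he0
  have hlam2 : lam ^ 2 ≤ (9 * N : ℝ) ^ n := by
    refine (pow_le_pow_left₀ hl.le hz.le 2).trans ((norm_gw_sq_le _ _ _).trans ?_)
    exact (mul_le_of_le_one_right (by positivity) ha).trans (card_cube_le hN c)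
  have hμ81 : μ ≤ 81 * N ^ 2 := by
    refine le_of_pow_le_pow_left₀ (n := n) (by omega) (by positivity) ?_
    calc μ ^ n = (lam ^ 2) ^ 2 := by rw [← hlμ]; ring
      _ ≤ ((9 * N : ℝ) ^ n) ^ 2 := pow_le_pow_left₀ (by positivity) hlam2 2
      _ = (81 * N ^ 2 : ℝ) ^ n := by rw [← pow_mul, mul_comm n 2, pow_mul]; congr 1; ring
  have hx1 : 1 ≤ K * N ^ 2 / μ := by
    rw [le_div_iff₀ hμ, one_mul, hK]; nlinarith
  set Q : ℕ := ⌈K * N ^ 2 / μ⌉₊ with hQ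
  have hQle : (Q : ℝ) ≤ 2 * K * N ^ 2 / μ := by
    have := Nat.ceil_lt_add_one (show 0 ≤ K * N ^ 2 / μ by positivity)
    have e2 : 2 * K * N ^ 2 / μ = K * N ^ 2 / μ + K * N ^ 2 / μ := by ring
    rw [e2]; linarith
  have hQge : K * N ^ 2 / μ ≤ Q := Nat.le_ceil _
  have hQ1 : 1 ≤ Q := by
    have : (1 : ℝ) ≤ Q := hx1.trans hQge
    exact_mod_cast this
  have hQN : 7 * Q ≤ 2 * N := by
    have h1 : 2 * K * N ^ 2 / μ ≤ 2 * N / 7 := by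
      rw [div_le_div_iff₀ hμ (by norm_num)]
      have : 7 * K * N ≤ μ := le_trans (mul_le_mul_of_nonneg_right (by linarith) (by positivity)) hμN
      nlinarith
    have h2 : (7 : ℝ) * Q ≤ 2 * N := by linarith
    exact_mod_cast h2
  have hQN6 : 6 * Q ^ 2 ≤ N ^ 2 := by nlinarith
  have hTQ : ∀ q, 1 ≤ q → q ≤ Q → q ∣ T := fun q h1 h2 => hT q h1 (by omega)
  obtain ⟨d, hd, hd0, hdk⟩ := majArc_coeff (T := T) hN hQN6 hNT hTQ
  obtain ⟨F, hF0, hFe, hFs, hF1, hF2⟩ := tt_star (cube c N) (psi T) (tau n)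
    (fun ξ h1 ξ' h2 k k' h => psi_tau_inj hT8 c h1 h2 h) 0 (tau_zero n) a ha (e := e) hl (lvl_mul_card u lam)
  have hω1 := hF1 (bw c N) (bw_nonneg c N) fun ξ _ h => (bw_eq_one hN (hsupp ξ h)).ge
  have hω2 := hF2 (bw c N) (fun z => arcInd T N Q z.1) d (lam ^ 2 / 4) (bw_nonneg c N)
    (fun z => by rw [hd]; rfl) (by
      intro z
      rcases arcInd_eq hN (by nlinarith [Nat.pos_of_ne_zero (show N ≠ 0 by omega)]) hTQ z.1 with h | ⟨h, h'⟩
      · rw [h]; simp; positivity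
      · rw [h, sub_zero, norm_one, mul_one]
        refine le_of_pow_le_pow_left₀ two_ne_zero (by positivity) ((grid_kernel_sq_le hN c z).trans ?_)
        have h1 := off_arc_le hN hQ1 hT z.1 h'
        have h2 : 20000 * ∑ h ∈ Icc (-((16 * N : ℕ) : ℤ)) (16 * N : ℕ), Pm N (h * ((z.1.val : ℝ) / T)) ≤ μ / 16 := by
          refine (mul_le_mul_of_nonneg_left h1 (by norm_num)).trans ?_
          rw [mul_div_assoc', div_le_div_iff₀ (by exact_mod_cast hQ1) (by norm_num)]
          rw [div_le_iff₀ hμ] at hQge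
          rw [hK] at hQge
          nlinarith
        refine (pow_le_pow_left₀ (mul_nonneg (by norm_num) (Finset.sum_nonneg fun _ _ => Pm_nonneg _ _)) h2 n).trans ?_
        rw [div_pow, div_pow, ← hlμ]
        have h16 : (16 : ℝ) ≤ 16 ^ n := by
          calc (16 : ℝ) = 16 ^ 1 := by norm_num
            _ ≤ 16 ^ n := pow_le_pow_right₀ (by norm_num) hn
        rw [← pow_mul]
        norm_num
        exact div_le_div_of_nonneg_left (by positivity) (by norm_num) h16)
  set g : ZMod T → ℝ := fun k => ∑ ξ ∈ cube c N, bw c N ξ * F ξ k ^ 2 with hg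
  change lam ^ 2 * e ^ 2 ≤ g 0 at hω1
  change g 0 ≤ _ + ∑ k, ‖d k‖ * g k at hω2
  have hg0 : ∀ k, 0 ≤ g k := fun k => Finset.sum_nonneg fun ξ _ => mul_nonneg (bw_nonneg _ _ _) (sq_nonneg _)
  rw [← Finset.add_sum_erase _ _ (mem_univ (0 : ZMod T))] at hω2
  have hmain : lam ^ 2 * e ^ 2 / 4 ≤ ∑ k ∈ univ.erase 0, ‖d k‖ * g k := by
    have : ‖d 0‖ * g 0 ≤ 1 / 2 * g 0 := mul_le_mul_of_nonneg_right hd0 (hg0 0)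
    linarith
  have hgs : ∑ k ∈ univ.erase 0, g k ≤ e := by
    refine (Finset.sum_le_sum_of_subset_of_nonneg (Finset.erase_subset _ _) fun k _ _ => hg0 k).trans ?_
    rw [hg, Finset.sum_comm]
    refine le_trans (Finset.sum_le_sum fun ξ _ => Finset.sum_le_sum fun k _ => ?_) hFs
    exact mul_le_of_le_one_left (sq_nonneg _) (bw_le_one c hN ξ)
  have hgD : ∀ k ∈ univ.erase (0 : ZMod T), g k ≤ (9 * N : ℝ) ^ n * e ^ 2 := by
    intro k _
    calc g k ≤ ∑ ξ ∈ cube c N, e ^ 2 := Finset.sum_le_sum fun ξ _ =>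
            (mul_le_of_le_one_left (sq_nonneg _) (bw_le_one c hN ξ)).trans (pow_le_pow_left₀ (hF0 ξ k) (hFe ξ k) 2)
      _ = #(cube c N) * e ^ 2 := by rw [Finset.sum_const, nsmul_eq_mul]
      _ ≤ _ := mul_le_mul_of_nonneg_right (card_cube_le hN c) (by positivity)
  have hpw := sum_pow_weight_le (univ.erase 0) (fun k => ‖d k‖) g (fun k _ => norm_nonneg _) (fun k _ => hg0 k)
    (show 1 ≤ m by omega) he0 hgs hgD
  have hΓ : ∑ k ∈ univ.erase (0 : ZMod T), ‖d k‖ ^ m ≤ 2 * D * 3 ^ m * (Q ^ (m + 1) * (1 / (N : ℝ) ^ 2) ^ (m - 1)) := by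
    set f : ℕ → ℝ := fun k => if k = 0 then 0 else (min (1 / (N : ℝ) ^ 2) (1 / (k : ℝ)) *
        ∑ q ∈ Icc 1 Q, (1 / (q : ℝ)) * ∑ d ∈ q.divisors, if d ∣ k then (d : ℝ) else 0) ^ m with hf
    have hf0 : ∀ i, 0 ≤ f i := by
      intro i
      simp only [hf]
      split_ifs
      · exact le_rfl
      · refine pow_nonneg (mul_nonneg (by positivity) (Finset.sum_nonneg fun q _ =>
          mul_nonneg (by positivity) (Finset.sum_nonneg fun d _ => ?_))) _
        split_ifs <;> positivity
    have h1 : ∑ k ∈ univ.erase (0 : ZMod T), ‖d k‖ ^ m ≤ (3 * Q) ^ m * ∑ k : ZMod T, f k.valMinAbs.natAbs := by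
      rw [Finset.mul_sum]
      refine le_trans (Finset.sum_le_sum fun k hk => ?_)
        (Finset.sum_le_sum_of_subset_of_nonneg (Finset.erase_subset _ _)
          fun k _ _ => mul_nonneg (by positivity) (hf0 _))
      have hk0 := (mem_erase.1 hk).1
      have h3 : k.valMinAbs.natAbs ≠ 0 := by
        rwa [Ne, Int.natAbs_eq_zero, ZMod.valMinAbs_eq_zero]
      rw [hf]; simp only
      rw [if_neg h3, ← mul_pow]
      exact pow_le_pow_left₀ (norm_nonneg _) (hdk k hk0) m
    refine h1.trans ?_
    have h2 := sum_zmod_le (T := T) hf0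
    have h3 : f 0 = 0 := by simp [hf]
    have h4 : ∑ i ∈ range T, f (i + 1) = ∑ k ∈ Icc 1 T, f k := by
      rw [Finset.range_eq_Ico, Finset.sum_Ico_add' f 0 T 1]
      rfl
    have h5 : ∑ k ∈ Icc 1 T, f k ≤ D * (1 / (N : ℝ) ^ 2) ^ (m - 1) * Q := by
      refine le_trans (le_of_eq (Finset.sum_congr rfl fun k hk => ?_)) (hD Q hQ1 (1 / (N : ℝ) ^ 2) (by positivity) T)
      rw [hf]; simp only
      rw [if_neg (by have := (mem_Icc.1 hk).1; omega)]
    rw [h3, h4, zero_add] at h2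
    refine (mul_le_mul_of_nonneg_left (h2.trans (mul_le_mul_of_nonneg_left h5 zero_le_two)) (by positivity)).trans
      (le_of_eq ?_)
    rw [mul_pow, pow_succ]; ring
  have hstep : (lam ^ 2 * e ^ 2 / 4) ^ m ≤ e ^ (m - 1) * ((9 * N : ℝ) ^ n * e ^ 2 *
      (2 * D * 3 ^ m * (Q ^ (m + 1) * (1 / (N : ℝ) ^ 2) ^ (m - 1)))) :=
    (pow_le_pow_left₀ (by positivity) hmain m).trans (hpw.trans
      (mul_le_mul_of_nonneg_left (mul_le_mul_of_nonneg_left hΓ (by positivity)) (by positivity)))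
  obtain ⟨r, rfl⟩ : ∃ r, m = r + 1 := ⟨m - 1, by omega⟩
  rw [Nat.add_sub_cancel] at *
  have hc : e ^ r * lam ^ (2 * (r + 1)) ≤ 4 ^ (r + 1) * ((9 * N : ℝ) ^ n *
      (2 * D * 3 ^ (r + 1) * (Q ^ (r + 1 + 1) * (1 / (N : ℝ) ^ 2) ^ r))) := by
    have hpos : 0 < e ^ (r + 2) := by positivity
    refine le_of_mul_le_mul_left ?_ hpos
    rw [div_pow, div_le_iff₀ (by positivity)] at hstep
    calc e ^ (r + 2) * (e ^ r * lam ^ (2 * (r + 1))) = (lam ^ 2 * e ^ 2) ^ (r + 1) := by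
          rw [mul_pow, ← pow_mul, ← pow_mul]; ring
      _ ≤ _ := hstep
      _ = _ := by ring
  have hQμ : (Q : ℝ) * μ ≤ 2 * K * N ^ 2 := (le_div_iff₀ hμ).1 hQle
  calc e ^ r * lam ^ (2 * (r + 1)) * μ ^ (r + 1 + 1)
      ≤ 4 ^ (r + 1) * ((9 * N : ℝ) ^ n *
      (2 * D * 3 ^ (r + 1) * (Q ^ (r + 1 + 1) * (1 / (N : ℝ) ^ 2) ^ r))) * μ ^ (r + 1 + 1) :=
        mul_le_mul_of_nonneg_right hc (by positivity)
    _ = 4 ^ (r + 1) * 9 ^ n * (2 * D * 3 ^ (r + 1)) * (N ^ n * (1 / (N : ℝ) ^ 2) ^ r) * (Q * μ) ^ (r + 1 + 1) := by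
        rw [mul_pow, mul_pow]; ring
    _ ≤ 4 ^ (r + 1) * 9 ^ n * (2 * D * 3 ^ (r + 1)) * (N ^ n * (1 / (N : ℝ) ^ 2) ^ r) *
        (2 * K * N ^ 2) ^ (r + 1 + 1) :=
        mul_le_mul_of_nonneg_left (pow_le_pow_left₀ (by positivity) hQμ _) (by positivity)
    _ = C₁ * (N : ℝ) ^ (n + 4) := by
        rw [hC₁, mul_pow, one_div, inv_pow]
        have : (N : ℝ) ≠ 0 := by positivity
        field_simp
        ring
    _ ≤ _ := mul_le_mul_of_nonneg_right (by rw [hK]; linarith) (by positivity)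

/-- Level sets are controlled by the times at which a majorant `k` of the kernel is large. -/
lemma low_level {n N T : ℕ} [NeZero T] (hT : 8 * N < T) (c : Fin n → ℤ) (a : (Fin n → ℤ) → ℂ)
    (ha : ∑ ξ ∈ cube c N, ‖a ξ‖ ^ 2 ≤ 1) (ω : (Fin n → ℤ) → ℝ) (hω0 : ∀ ξ, 0 ≤ ω ξ) {B : ℝ} (hB : 0 ≤ B)
    (hω1 : ∀ ξ, ω ξ ≤ B) (hω : ∀ ξ, a ξ ≠ 0 → 1 ≤ ω ξ) (k : ZMod T → ℝ)
    (hk : ∀ z : ZMod T × (Fin n → ZMod T), ‖∑ ξ ∈ cube c N, (ω ξ : ℂ) * psi T ξ z‖ ≤ k z.1)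
    {lam : ℝ} (hl : 0 < lam) :
    lvl (gw T (cube c N) a) lam * lam ^ 2 ≤ 2 * B * ((#{j | lam ^ 2 / 2 < k j} : ℝ) / T) := by
  classical
  set e := lvl (gw T (cube c N) a) lam with he
  have hT0 : (0 : ℝ) < T := by exact_mod_cast Nat.pos_of_ne_zero (NeZero.ne T)
  set θ : ℝ := (#{j | lam ^ 2 / 2 < k j} : ℝ) / T with hθ
  have hθ0 : 0 ≤ θ := by positivity
  rcases (lvl_nonneg (gw T (cube c N) a) lam).eq_or_lt with h0 | h0
  · rw [he, ← h0, zero_mul]; positivity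
  obtain ⟨F, hF0, hFe, hFs, hF1, hF2⟩ := tt_star (cube c N) (psi T) (tau n)
    (fun ξ h1 ξ' h2 k k' h => psi_tau_inj hT c h1 h2 h) 0 (tau_zero n) a ha (e := e) hl (lvl_mul_card _ lam)
  set Θ : ZMod T → ℂ := fun j => if lam ^ 2 / 2 < k j then 1 else 0 with hΘ
  set d : ZMod T → ℂ := fun k => (1 / (T : ℂ)) * ∑ l, Θ l * ZMod.stdAddChar (-(k * l)) with hd
  have hdθ : ∀ k, ‖d k‖ ≤ θ := by
    intro k
    rw [hd]
    simp only
    rw [norm_mul, norm_div, norm_one, Complex.norm_natCast, hθ, one_div_mul_eq_div]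
    refine div_le_div_of_nonneg_right ((norm_sum_le _ _).trans ?_) hT0.le
    rw [Finset.card_filter]
    push_cast
    refine Finset.sum_le_sum fun l _ => ?_
    rw [norm_mul, AddChar.norm_apply, mul_one, hΘ]
    simp only
    split_ifs <;> simp
  have h1 := hF1 ω hω0 fun ξ _ h => hω ξ h
  have h2 := hF2 ω (fun z => Θ z.1) d (lam ^ 2 / 2) hω0 (fun z => zmod_fourier Θ z.1) (by
    intro z
    rw [hΘ]
    simp only
    split_ifs with h
    · simp; positivity
    · rw [sub_zero, norm_one, mul_one]
      exact (hk z).trans (not_lt.1 h))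
  have h3 : ∑ k, ‖d k‖ * ∑ ξ ∈ cube c N, ω ξ * F ξ k ^ 2 ≤ θ * (B * e) := by
    calc _ ≤ ∑ k, θ * (B * ∑ ξ ∈ cube c N, F ξ k ^ 2) := by
            refine Finset.sum_le_sum fun k _ => mul_le_mul (hdθ k) ?_
              (Finset.sum_nonneg fun ξ _ => mul_nonneg (hω0 ξ) (sq_nonneg _)) hθ0
            rw [Finset.mul_sum]
            exact Finset.sum_le_sum fun ξ _ => mul_le_mul_of_nonneg_right (hω1 ξ) (sq_nonneg _)
      _ = θ * (B * ∑ ξ ∈ cube c N, ∑ k, F ξ k ^ 2) := by rw [← Finset.mul_sum, ← Finset.mul_sum, Finset.sum_comm]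
      _ ≤ _ := mul_le_mul_of_nonneg_left (mul_le_mul_of_nonneg_left hFs hB) hθ0
  have h4 : lam ^ 2 * e ^ 2 ≤ 2 * B * θ * e := by linarith
  refine le_of_mul_le_mul_right ?_ h0
  calc e * lam ^ 2 * e = lam ^ 2 * e ^ 2 := by ring
    _ ≤ _ := h4

lemma mul_dvd_of_dvd_sub_of_dvd_add {D x y x₀ y₀ x' y' m : ℤ} (h0 : x₀ ^ 2 + D * y₀ ^ 2 = m)
    (h1 : x ^ 2 + D * y ^ 2 = m) (h2 : x' ^ 2 + D * y' ^ 2 = m) (hm : m ≠ 0)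
    (c0 : IsCoprime x₀ y₀) (c1 : IsCoprime x y)
    (hg : Int.gcd (x₀ * y - x * y₀) m = Int.gcd (x₀ * y' - x' * y₀) m) :
    m ∣ 4 * D * (x * y' - x' * y) := by
  set d : ℤ := (Int.gcd (x₀ * y - x * y₀) m : ℤ) with hd
  have key : ∀ x y : ℤ, x ^ 2 + D * y ^ 2 = m → (Int.gcd (x₀ * y - x * y₀) m : ℤ) = d →
      d ∣ x₀ * y - x * y₀ ∧ m / d ∣ x₀ * y + x * y₀ := by
    intro x y hxy hdd
    have e1 : d ∣ x₀ * y - x * y₀ := hdd ▸ Int.gcd_dvd_left _ _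
    refine ⟨e1, ?_⟩
    have e2 : d ∣ m := hdd ▸ Int.gcd_dvd_right _ _
    have hd0 : d ≠ 0 := fun h => hm (by rw [h] at e2; exact zero_dvd_iff.1 e2)
    obtain ⟨P, hP⟩ := e1
    obtain ⟨e, he⟩ := e2
    have hco : IsCoprime e P := by
      have h3 : Int.gcd (d * P) (d * e) = d.natAbs := by
        rw [← hP, ← he]; rw [← hdd]; simp
      rw [Int.gcd_mul_left] at h3
      rw [isCoprime_comm, Int.isCoprime_iff_gcd_eq_one]
      exact Nat.eq_of_mul_eq_mul_left (Int.natAbs_pos.2 hd0) (by rw [h3, mul_one])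
    rw [he, Int.mul_ediv_cancel_left _ hd0]
    refine hco.dvd_of_dvd_mul_left ?_
    have h4 : d * P * (x₀ * y + x * y₀) = d * (e * (y ^ 2 - y₀ ^ 2)) := by
      rw [← hP, ← mul_assoc, ← he]
      linear_combination y ^ 2 * h0 - y₀ ^ 2 * hxy
    rw [mul_assoc] at h4
    exact ⟨_, mul_left_cancel₀ hd0 h4⟩
  obtain ⟨a1, a2⟩ := key x y h1 rfl
  obtain ⟨b1, b2⟩ := key x' y' h2 (by rw [hd, hg])
  have e2 : d ∣ m := Int.gcd_dvd_right _ _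
  have hde : d * (m / d) = m := Int.mul_ediv_cancel' e2
  set e := m / d
  have cy0 : IsCoprime m y₀ := by
    rw [← h0]
    have : IsCoprime (x₀ ^ 2) y₀ := c0.pow_left
    simpa [pow_two, mul_assoc, mul_comm, mul_left_comm] using this.add_mul_left_left (D * y₀)
  have cy : IsCoprime m y := by
    rw [← h1]
    have : IsCoprime (x ^ 2) y := c1.pow_left
    simpa [pow_two, mul_assoc, mul_comm, mul_left_comm] using this.add_mul_left_left (D * y)
  have hdm : d ∣ m := e2
  have hem : e ∣ m := ⟨d, by rw [mul_comm]; exact hde.symm⟩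
  set k := x * y' - x' * y with hk
  have hdk : d ∣ k := by
    refine (cy0.of_isCoprime_of_dvd_left hdm).dvd_of_dvd_mul_left ?_
    have : y₀ * k = y * (x₀ * y' - x' * y₀) - y' * (x₀ * y - x * y₀) := by rw [hk]; ring
    rw [this]
    exact dvd_sub (b1.mul_left _) (a1.mul_left _)
  have hek : e ∣ k := by
    refine (cy0.of_isCoprime_of_dvd_left hem).dvd_of_dvd_mul_left ?_
    have : y₀ * k = y' * (x₀ * y + x * y₀) - y * (x₀ * y' + x' * y₀) := by rw [hk]; ring
    rw [this]
    exact dvd_sub (a2.mul_left _) (b2.mul_left _)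
  have hfk : d * e ∣ (Int.gcd d e : ℤ) * k := by
    rw [Int.gcd_eq_gcd_ab, add_mul]
    refine dvd_add ?_ ?_
    · rw [mul_assoc]; exact mul_dvd_mul_left d (hek.mul_left _)
    · rw [mul_comm d e, mul_assoc]; exact mul_dvd_mul_left e (hdk.mul_left _)
  set f : ℤ := (Int.gcd d e : ℤ) with hf
  have hfd : f ∣ d := Int.gcd_dvd_left _ _
  have hfe : f ∣ e := Int.gcd_dvd_right _ _
  have hfm : f ∣ m := hfd.trans hdm
  have h2x : f ∣ 2 * x := by
    refine (cy0.of_isCoprime_of_dvd_left hfm).dvd_of_dvd_mul_left ?_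
    have : y₀ * (2 * x) = (x₀ * y + x * y₀) - (x₀ * y - x * y₀) := by ring
    rw [this]
    exact dvd_sub (hfe.trans a2) (hfd.trans a1)
  have h4D : f ∣ 4 * D := by
    refine ((cy.of_isCoprime_of_dvd_left hfm).pow_right (n := 2)).dvd_of_dvd_mul_left ?_
    have : y ^ 2 * (4 * D) = 4 * m - (2 * x) * (2 * x) := by rw [← h1]; ring
    rw [this]
    exact dvd_sub (hfm.mul_left _) (h2x.mul_left _)
  rw [← hde]
  exact hfk.trans (mul_dvd_mul_right h4D k)

lemma card_primitive_rep_le {D m : ℕ} (hD : 1 ≤ D) (hm : 1 ≤ m) (S : Finset (ℤ × ℤ))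
    (hS : ∀ s ∈ S, s.1 ^ 2 + D * s.2 ^ 2 = m) (hc : ∀ s ∈ S, IsCoprime s.1 s.2) :
    #S ≤ (2 * (8 * D + 1)) * #m.divisors := by
  classical
  rcases S.eq_empty_or_nonempty with rfl | ⟨⟨x₀, y₀⟩, h0⟩
  · simp
  have hm0 : (m : ℤ) ≠ 0 := by omega
  refine Finset.card_le_mul_card_image_of_maps_to (f := fun s : ℤ × ℤ => Int.gcd (x₀ * s.2 - s.1 * y₀) m)
    (fun s _ => Nat.mem_divisors.2 ⟨by simpa using Int.gcd_dvd_natAbs_right (x₀ * s.2 - s.1 * y₀) (m : ℤ), by omega⟩) _ ?_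
  intro b _
  rcases (S.filter fun s : ℤ × ℤ => Int.gcd (x₀ * s.2 - s.1 * y₀) m = b).eq_empty_or_nonempty with h | ⟨⟨x, y⟩, hxy⟩
  · rw [h]; simp
  rw [mem_filter] at hxy
  have hxm := hS _ hxy.1
  simp only at hxm
  have hcard : #(Icc (-(4 * D : ℤ)) (4 * D) ×ˢ (univ : Finset Bool)) = 2 * (8 * D + 1) := by
    rw [card_product, Int.card_Icc, card_univ, Fintype.card_bool]; omega
  have hdvd : ∀ s ∈ S.filter (fun s : ℤ × ℤ => Int.gcd (x₀ * s.2 - s.1 * y₀) m = b),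
      (m : ℤ) ∣ 4 * D * (x * s.2 - s.1 * y) := by
    intro s hs
    rw [mem_filter] at hs
    exact mul_dvd_of_dvd_sub_of_dvd_add (hS _ h0) hxm (hS _ hs.1) hm0 (hc _ h0) (hc _ hxy.1) (hxy.2.trans hs.2.symm)
  rw [← hcard]
  refine Finset.card_le_card_of_injOn (fun s => (4 * D * (x * s.2 - s.1 * y) / m, decide (0 ≤ x * s.1 + D * y * s.2))) ?_ ?_
  · intro s hs
    obtain ⟨j, hj⟩ := hdvd s hs
    rw [mem_coe, mem_filter] at hs
    have hsm := hS _ hs.1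
    simp only [coe_product, coe_univ, Set.mem_prod, Set.mem_univ, and_true, coe_Icc]
    rw [hj, Int.mul_ediv_cancel_left _ hm0, Set.mem_Icc, ← abs_le]
    have h3 : (x * s.2 - s.1 * y) ^ 2 ≤ (m : ℤ) ^ 2 := by
      have e : (m : ℤ) ^ 2 = (x * s.1 + D * y * s.2) ^ 2 + D * (x * s.2 - s.1 * y) ^ 2 := by
        rw [pow_two (m : ℤ)]
        nth_rewrite 1 [← hxm]
        rw [← hsm]; ring
      have hD' : (1 : ℤ) ≤ D := by exact_mod_cast hD
      nlinarith [sq_nonneg (x * s.1 + D * y * s.2), sq_nonneg (x * s.2 - s.1 * y)]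
    have h4 := abs_le_of_sq_le_sq h3 (by omega)
    have h5 : (m : ℤ) * |j| ≤ m * (4 * D) := by
      calc (m : ℤ) * |j| = |4 * D * (x * s.2 - s.1 * y)| := by rw [hj, abs_mul, Nat.abs_cast]
        _ = 4 * D * |x * s.2 - s.1 * y| := by rw [abs_mul, abs_of_nonneg (by positivity)]
        _ ≤ 4 * D * m := mul_le_mul_of_nonneg_left h4 (by positivity)
        _ = _ := by ring
    exact le_of_mul_le_mul_left h5 (by omega)
  · intro s hs t ht hst
    have d1 := hdvd s hs
    have d2 := hdvd t ht
    rw [mem_coe, mem_filter] at hs ht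
    simp only [Prod.mk.injEq] at hst
    obtain ⟨h1, h2⟩ := hst
    have hsm := hS _ hs.1
    have htm := hS _ ht.1
    have h3 : 4 * (D : ℤ) * (x * s.2 - s.1 * y) = 4 * D * (x * t.2 - t.1 * y) := by
      rw [← Int.mul_ediv_cancel' d1, ← Int.mul_ediv_cancel' d2, h1]
    have h4 := mul_left_cancel₀ (show (4 * (D : ℤ)) ≠ 0 by omega) h3
    have e : ∀ s : ℤ × ℤ, s.1 ^ 2 + D * s.2 ^ 2 = m →
        (x * s.1 + D * y * s.2) ^ 2 = (m : ℤ) ^ 2 - D * (x * s.2 - s.1 * y) ^ 2 := by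
      intro s hs
      rw [pow_two (m : ℤ)]
      nth_rewrite 1 [← hxm]
      rw [← hs]; ring
    have h5 : (x * s.1 + D * y * s.2) ^ 2 = (x * t.1 + D * y * t.2) ^ 2 := by rw [e s hsm, e t htm, h4]
    have h6 : x * s.1 + D * y * s.2 = x * t.1 + D * y * t.2 := by
      rw [decide_eq_decide] at h2
      rcases sq_eq_sq_iff_eq_or_eq_neg.1 h5 with h | h
      · exact h
      · by_cases hp : 0 ≤ x * s.1 + D * y * s.2
        · have := h2.1 hp; omega
        · have : ¬ 0 ≤ x * t.1 + D * y * t.2 := fun h' => hp (h2.2 h')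
          omega
    ext
    · refine mul_left_cancel₀ hm0 ?_
      rw [← hxm]
      linear_combination x * h6 - D * y * h4
    · refine mul_left_cancel₀ hm0 ?_
      rw [← hxm]
      linear_combination y * h6 + x * h4

/-- Number of representations of `m` by the form `x² + Dy²`. -/
lemma card_rep_le {D m : ℕ} (hD : 1 ≤ D) (hm : 1 ≤ m) (S : Finset (ℤ × ℤ))
    (hS : ∀ s ∈ S, s.1 ^ 2 + D * s.2 ^ 2 = m) :
    #S ≤ (2 * (8 * D + 1)) * #m.divisors ^ 2 := by
  classical
  rw [pow_two, ← mul_assoc]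
  have hg0 : ∀ s ∈ S, Int.gcd s.1 s.2 ≠ 0 := by
    intro s hs h
    rw [Int.gcd_eq_zero_iff] at h
    have := hS s hs
    rw [h.1, h.2] at this
    simp at this; omega
  have hgm : ∀ s ∈ S, Int.gcd s.1 s.2 ^ 2 ∣ m := by
    intro s hs
    have h1 : ((Int.gcd s.1 s.2 ^ 2 : ℕ) : ℤ) ∣ m := by
      rw [← hS s hs]
      push_cast
      exact dvd_add (pow_dvd_pow_of_dvd (Int.gcd_dvd_left _ _) 2) ((pow_dvd_pow_of_dvd (Int.gcd_dvd_right _ _) 2).mul_left _)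
    exact_mod_cast h1
  refine Finset.card_le_mul_card_image_of_maps_to (f := fun s : ℤ × ℤ => Int.gcd s.1 s.2)
    (fun s hs => Nat.mem_divisors.2 ⟨(dvd_pow_self _ two_ne_zero).trans (hgm s hs), by omega⟩) _ ?_
  intro g _
  rcases (S.filter fun s : ℤ × ℤ => Int.gcd s.1 s.2 = g).eq_empty_or_nonempty with h | ⟨s₀, hs₀⟩
  · rw [h]; simp
  rw [mem_filter] at hs₀
  have hg : g ≠ 0 := hs₀.2 ▸ hg0 _ hs₀.1
  have hgd : g ^ 2 ∣ m := hs₀.2 ▸ hgm _ hs₀.1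
  obtain ⟨m', hm'⟩ := hgd
  have hm'1 : 1 ≤ m' := by
    rcases Nat.eq_zero_or_pos m' with h | h
    · rw [h, mul_zero] at hm'; omega
    · exact h
  have hgz : (g : ℤ) ≠ 0 := by exact_mod_cast hg
  set F := S.filter fun s : ℤ × ℤ => Int.gcd s.1 s.2 = g with hF
  have hsplit : ∀ s ∈ F, s.1 = g * (s.1 / g) ∧ s.2 = g * (s.2 / g) := by
    intro s hs
    rw [mem_filter] at hs
    rw [← hs.2]
    exact ⟨(Int.mul_ediv_cancel' (Int.gcd_dvd_left _ _)).symm, (Int.mul_ediv_cancel' (Int.gcd_dvd_right _ _)).symm⟩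
  have hinj : Set.InjOn (fun s : ℤ × ℤ => (s.1 / (g : ℤ), s.2 / (g : ℤ))) F := by
    intro s hs t ht hst
    simp only [Prod.mk.injEq] at hst
    obtain ⟨a1, a2⟩ := hsplit s hs
    obtain ⟨b1, b2⟩ := hsplit t ht
    ext
    · rw [a1, b1, hst.1]
    · rw [a2, b2, hst.2]
  rw [← Finset.card_image_of_injOn hinj]
  refine (card_primitive_rep_le hD hm'1 _ ?_ ?_).trans (Nat.mul_le_mul_left _
    (Finset.card_le_card (Nat.divisors_subset_of_dvd (by omega) ⟨g ^ 2, by rw [hm', mul_comm]⟩)))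
  · intro s' hs'
    rw [mem_image] at hs'
    obtain ⟨s, hs, rfl⟩ := hs'
    obtain ⟨a1, a2⟩ := hsplit s hs
    have h1 := hS s (mem_filter.1 hs).1
    rw [a1, a2, hm'] at h1
    simp only
    refine mul_left_cancel₀ (pow_ne_zero 2 hgz) ?_
    push_cast at h1
    rw [← h1]; ring
  · intro s' hs'
    rw [mem_image] at hs'
    obtain ⟨s, hs, rfl⟩ := hs'
    rw [mem_filter] at hs
    simp only
    rw [Int.isCoprime_iff_gcd_eq_one, ← hs.2]
    exact Int.gcd_div_gcd_div_gcd (Nat.pos_of_ne_zero (hg0 s hs.1))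

lemma card_rep_le_rpow (D : ℕ) (hD : 1 ≤ D) (ε : ℝ) (hε : 0 < ε) : ∃ C : ℝ, 1 ≤ C ∧ ∀ (N : ℕ), 1 ≤ N → ∀ m : ℤ,
    m ≤ 1000 * N ^ 2 → ∀ S : Finset (ℤ × ℤ), (∀ s ∈ S, s.1 ^ 2 + D * s.2 ^ 2 = m) → (#S : ℝ) ≤ C * (N : ℝ) ^ ε := by
  obtain ⟨K, hK1, hK⟩ := card_divisors_le_rpow (ε / 4) (by positivity)
  set C : ℝ := (2 * (8 * D + 1)) * K ^ 2 * 1000 ^ (ε / 2) with hC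
  have hC1 : 1 ≤ C := by
    have h1 : (1 : ℝ) ≤ 1000 ^ (ε / 2) := Real.one_le_rpow (by norm_num) (by positivity)
    have h2 : (1 : ℝ) ≤ K ^ 2 := one_le_pow₀ hK1
    have h3 : (1 : ℝ) ≤ 2 * (8 * D + 1) := by
      have : (0 : ℝ) ≤ D := Nat.cast_nonneg _
      linarith
    rw [hC]
    exact one_le_mul_of_one_le_of_one_le (one_le_mul_of_one_le_of_one_le h3 h2) h1
  refine ⟨C, hC1, ?_⟩
  intro N hN m hm S hS
  have hN1 : (1 : ℝ) ≤ N := by exact_mod_cast hN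
  have hNε : (1 : ℝ) ≤ (N : ℝ) ^ ε := Real.one_le_rpow hN1 hε.le
  have hD' : (1 : ℤ) ≤ D := by exact_mod_cast hD
  rcases lt_or_ge 0 m with h0 | h0
  · obtain ⟨k, rfl⟩ : ∃ k : ℕ, m = k := ⟨m.toNat, by omega⟩
    have hk1 : 1 ≤ k := by omega
    have h1 := card_rep_le hD hk1 S hS
    have h2 := hK k (by omega)
    have hkN : (k : ℝ) ≤ 1000 * N ^ 2 := by exact_mod_cast hm
    have h3 : ((#k.divisors : ℕ) : ℝ) ^ 2 ≤ K ^ 2 * (1000 ^ (ε / 2) * (N : ℝ) ^ ε) := by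
      refine (pow_le_pow_left₀ (by positivity) h2 2).trans ?_
      rw [mul_pow]
      refine mul_le_mul_of_nonneg_left ?_ (by positivity)
      calc ((k : ℝ) ^ (ε / 4)) ^ 2 = (k : ℝ) ^ (ε / 2) := by
            rw [← Real.rpow_natCast, ← Real.rpow_mul (by positivity)]; congr 1; push_cast; ring
        _ ≤ (1000 * (N : ℝ) ^ 2) ^ (ε / 2) := Real.rpow_le_rpow (by positivity) hkN (by positivity)
        _ = _ := by
          rw [Real.mul_rpow (by norm_num) (by positivity), ← Real.rpow_natCast, ← Real.rpow_mul (by positivity)]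
          congr 2; push_cast; ring
    calc (#S : ℝ) ≤ (2 * (8 * D + 1)) * ((#k.divisors : ℕ) : ℝ) ^ 2 := by exact_mod_cast h1
      _ ≤ (2 * (8 * D + 1)) * (K ^ 2 * (1000 ^ (ε / 2) * (N : ℝ) ^ ε)) :=
          mul_le_mul_of_nonneg_left h3 (by positivity)
      _ = _ := by rw [hC]; ring
  · have h1 : #S ≤ 1 := by
      rw [Finset.card_le_one]
      have key : ∀ s ∈ S, s = (0, 0) := by
        intro s hs
        have := hS s hs
        have h3 : s.1 ^ 2 = 0 := by nlinarith [sq_nonneg s.1, sq_nonneg s.2]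
        have h4 : s.2 ^ 2 = 0 := by nlinarith [sq_nonneg s.1, sq_nonneg s.2]
        ext
        · exact pow_eq_zero_iff two_ne_zero |>.1 h3
        · exact pow_eq_zero_iff two_ne_zero |>.1 h4
      intro a ha b hb
      rw [key a ha, key b hb]
    calc (#S : ℝ) ≤ 1 := by exact_mod_cast h1
      _ ≤ _ := one_le_mul_of_one_le_of_one_le hC1 hNε

lemma sum_norm_sq_le_mult {Z ι : Type*} [AddCommGroup Z] [Fintype Z] (I : Finset ι) (X : ι → AddChar Z ℂ)
    (c : ι → ℂ) {R : ℝ} [DecidableEq (AddChar Z ℂ)] (hR : ∀ i ∈ I, (#{i' ∈ I | X i' = X i} : ℝ) ≤ R) :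
    ∑ z, ‖∑ i ∈ I, c i * X i z‖ ^ 2 ≤ Fintype.card Z * (R * ∑ i ∈ I, ‖c i‖ ^ 2) := by
  classical
  have h1 : ((∑ z, ‖∑ i ∈ I, c i * X i z‖ ^ 2 : ℝ) : ℂ) =
      ∑ i ∈ I, ∑ i' ∈ I, c i * (starRingEnd ℂ) (c i') * (if X i' = X i then (Fintype.card Z : ℂ) else 0) := by
    push_cast
    have h2 : ∀ z, ((‖∑ i ∈ I, c i * X i z‖ : ℂ)) ^ 2 =
        ∑ i ∈ I, ∑ i' ∈ I, c i * (starRingEnd ℂ) (c i') * (X i - X i') z := by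
      intro z
      rw [← Complex.mul_conj', map_sum, Finset.sum_mul_sum]
      refine Finset.sum_congr rfl fun i _ => Finset.sum_congr rfl fun i' _ => ?_
      rw [map_mul, AddChar.sub_apply, AddChar.map_neg_eq_conj]; ring
    simp_rw [h2]
    rw [Finset.sum_comm]
    refine Finset.sum_congr rfl fun i _ => ?_
    rw [Finset.sum_comm]
    refine Finset.sum_congr rfl fun i' _ => ?_
    rw [← Finset.mul_sum, AddChar.sum_eq_ite]
    congr 1
    simp only [sub_eq_zero, eq_comm]
  have h3 : ∑ z, ‖∑ i ∈ I, c i * X i z‖ ^ 2 ≤ ∑ i ∈ I, ∑ i' ∈ I,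
      (‖c i‖ ^ 2 + ‖c i'‖ ^ 2) / 2 * (if X i' = X i then (Fintype.card Z : ℝ) else 0) := by
    have h4 : (∑ z, ‖∑ i ∈ I, c i * X i z‖ ^ 2) = ‖((∑ z, ‖∑ i ∈ I, c i * X i z‖ ^ 2 : ℝ) : ℂ)‖ := by
      rw [Complex.norm_real, Real.norm_of_nonneg (by positivity)]
    rw [h4, h1]
    refine (norm_sum_le _ _).trans (Finset.sum_le_sum fun i _ => (norm_sum_le _ _).trans
      (Finset.sum_le_sum fun i' _ => ?_))
    rw [norm_mul, norm_mul, RCLike.norm_conj]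
    split_ifs
    · rw [Complex.norm_natCast]
      refine mul_le_mul_of_nonneg_right ?_ (by positivity)
      nlinarith [sq_nonneg (‖c i‖ - ‖c i'‖)]
    · simp
  have h5 : ∀ i ∈ I, ∑ i' ∈ I, (if X i' = X i then (Fintype.card Z : ℝ) else 0) ≤ Fintype.card Z * R := by
    intro i hi
    rw [← Finset.sum_filter, Finset.sum_const, nsmul_eq_mul, mul_comm]
    exact mul_le_mul_of_nonneg_left (hR i hi) (by positivity)
  have h6 : ∑ i ∈ I, ∑ i' ∈ I, (‖c i‖ ^ 2 + ‖c i'‖ ^ 2) / 2 * (if X i' = X i then (Fintype.card Z : ℝ) else 0) =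
      ∑ i ∈ I, ‖c i‖ ^ 2 * ∑ i' ∈ I, (if X i' = X i then (Fintype.card Z : ℝ) else 0) := by
    have e1 : ∑ i ∈ I, ∑ i' ∈ I, ‖c i'‖ ^ 2 / 2 * (if X i' = X i then (Fintype.card Z : ℝ) else 0) =
        ∑ i ∈ I, ∑ i' ∈ I, ‖c i‖ ^ 2 / 2 * (if X i' = X i then (Fintype.card Z : ℝ) else 0) := by
      rw [Finset.sum_comm]
      refine Finset.sum_congr rfl fun i _ => Finset.sum_congr rfl fun i' _ => ?_
      simp only [eq_comm]
    simp_rw [add_div, add_mul, Finset.sum_add_distrib]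
    rw [e1, ← Finset.sum_add_distrib]
    refine Finset.sum_congr rfl fun i _ => ?_
    rw [← Finset.mul_sum]; ring
  rw [h6] at h3
  refine h3.trans ?_
  rw [Finset.mul_sum, Finset.mul_sum]
  refine Finset.sum_le_sum fun i hi => (mul_le_mul_of_nonneg_left (h5 i hi) (by positivity)).trans (le_of_eq (by ring))

/-- Tuples of frequencies producing the same character have equal first and second moments. -/
lemma prod_psi_inj {n T r : ℕ} [NeZero T] (hr : r ≤ 3) {f g : Fin r → Fin n → ℤ}
    (hf : ∀ k, (∀ i, 8 * |f k i| < T) ∧ 8 * ∑ i, f k i ^ 2 < T)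
    (hg : ∀ k, (∀ i, 8 * |g k i| < T) ∧ 8 * ∑ i, g k i ^ 2 < T)
    (h : ∏ k, psi T (f k) = ∏ k, psi T (g k)) :
    (∀ i, ∑ k, f k i = ∑ k, g k i) ∧ ∑ k, ∑ i, f k i ^ 2 = ∑ k, ∑ i, g k i ^ 2 := by
  classical
  have hT0 : (0 : ℤ) < T := by exact_mod_cast Nat.pos_of_ne_zero (NeZero.ne T)
  have hap : ∀ (f : Fin r → Fin n → ℤ) z, (∏ k, psi T (f k)) z = ∏ k, psi T (f k) z := by
    intro f z
    exact AddChar.prod_apply _ _ _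
  have key : ∀ u v : Fin r → ℤ, (∀ k, 8 * |u k| < T) → (∀ k, 8 * |v k| < T) →
      ∏ k, ZMod.stdAddChar ((u k : ℤ) : ZMod T) = ∏ k, ZMod.stdAddChar ((v k : ℤ) : ZMod T) → ∑ k, u k = ∑ k, v k := by
    intro u v hu hv huv
    have hms : ∀ w : Fin r → ZMod T, ZMod.stdAddChar (∑ k, w k) = ∏ k, ZMod.stdAddChar (w k) := by
      intro w
      have := map_prod (ZMod.stdAddChar (N := T)).toMonoidHom (fun k => Multiplicative.ofAdd (w k)) univ
      simpa [← ofAdd_sum] using this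
    rw [← hms, ← hms] at huv
    have h4 := ZMod.injective_stdAddChar huv
    rw [← Int.cast_sum, ← Int.cast_sum, ZMod.intCast_eq_intCast_iff_dvd_sub] at h4
    have hb : ∀ w : Fin r → ℤ, (∀ k, 8 * |w k| < T) → 8 * |∑ k, w k| ≤ 3 * T := by
      intro w hw
      have h1 : 8 * |∑ k, w k| ≤ ∑ k : Fin r, (T : ℤ) := by
        calc 8 * |∑ k, w k| ≤ 8 * ∑ k, |w k| := mul_le_mul_of_nonneg_left (Finset.abs_sum_le_sum_abs _ _) (by norm_num)
          _ = ∑ k, 8 * |w k| := Finset.mul_sum _ _ _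
          _ ≤ _ := Finset.sum_le_sum fun k _ => (hw k).le
      rw [Finset.sum_const, card_univ, Fintype.card_fin, nsmul_eq_mul] at h1
      have : (r : ℤ) ≤ 3 := by exact_mod_cast hr
      nlinarith
    have h5 := hb u hu
    have h6 := hb v hv
    have h7 : |∑ k, v k - ∑ k, u k| ≤ |∑ k, v k| + |∑ k, u k| := abs_sub _ _
    have := Int.eq_zero_of_abs_lt_dvd h4 (by omega)
    omega
  constructor
  · intro i
    refine key (fun k => f k i) (fun k => g k i) (fun k => (hf k).1 i) (fun k => (hg k).1 i) ?_
    have h3 := DFunLike.congr_fun h ((0 : ZMod T), (Pi.single i 1 : Fin n → ZMod T))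
    rw [hap, hap] at h3
    simpa [psi_apply, Pi.single_apply] using h3
  · refine key (fun k => ∑ i, f k i ^ 2) (fun k => ∑ i, g k i ^ 2) (fun k => ?_) (fun k => ?_) ?_
    · rw [abs_of_nonneg (by positivity)]; exact (hf k).2
    · rw [abs_of_nonneg (by positivity)]; exact (hg k).2
    have h3 := DFunLike.congr_fun h ((1 : ZMod T), (0 : Fin n → ZMod T))
    rw [hap, hap] at h3
    simpa [psi_apply] using h3

/-- Moments of the discrete wave of even order `2r` in terms of multiplicities. -/
lemma sum_gw_pow_le {n T r : ℕ} [NeZero T] (hr : r ≤ 3) (S : Finset (Fin n → ℤ)) (a : (Fin n → ℤ) → ℂ)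
    (ha : ∑ ξ ∈ S, ‖a ξ‖ ^ 2 ≤ 1) (hT : ∀ ξ ∈ S, (∀ i, 8 * |ξ i| < T) ∧ 8 * ∑ i, ξ i ^ 2 < T) {R : ℝ}
    (hR : ∀ f : Fin r → Fin n → ℤ, (∀ k, f k ∈ S) → ∀ I : Finset (Fin r → Fin n → ℤ), (∀ g ∈ I, (∀ k, g k ∈ S) ∧
      (∀ i, ∑ k, g k i = ∑ k, f k i) ∧ ∑ k, ∑ i, g k i ^ 2 = ∑ k, ∑ i, f k i ^ 2) → (#I : ℝ) ≤ R) (hR0 : 0 ≤ R) :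
    ∑ z, ‖gw T S a z‖ ^ (2 * r) ≤ Fintype.card (ZMod T × (Fin n → ZMod T)) * R := by
  classical
  have h := sum_norm_sq_le_mult (Fintype.piFinset fun _ : Fin r => S) (fun f => ∏ k, psi T (f k))
    (fun f => ∏ k, a (f k)) (R := R) (by
      intro f hf
      rw [Fintype.mem_piFinset] at hf
      refine hR f hf _ ?_
      intro g hg
      rw [mem_filter, Fintype.mem_piFinset] at hg
      exact ⟨hg.1, prod_psi_inj hr (fun k => hT _ (hg.1 k)) (fun k => hT _ (hf k)) hg.2⟩)
  have e1 : ∀ z, ∑ f ∈ Fintype.piFinset fun _ : Fin r => S, (∏ k, a (f k)) * (∏ k, psi T (f k)) z = gw T S a z ^ r := by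
    intro z
    rw [gw, Finset.sum_pow']
    refine Finset.sum_congr rfl fun f _ => ?_
    rw [Finset.prod_mul_distrib]
    congr 1
    exact AddChar.prod_apply _ _ _
  have e2 : ∑ f ∈ Fintype.piFinset fun _ : Fin r => S, ‖∏ k, a (f k)‖ ^ 2 = (∑ ξ ∈ S, ‖a ξ‖ ^ 2) ^ r := by
    rw [Finset.sum_pow']
    refine Finset.sum_congr rfl fun f _ => ?_
    rw [norm_prod, Finset.prod_pow]
  simp_rw [e1, e2, norm_pow] at h
  simp_rw [mul_comm 2 r, pow_mul]
  refine h.trans (mul_le_mul_of_nonneg_left ?_ (by positivity))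
  exact mul_le_of_le_one_right hR0 (pow_le_one₀ (by positivity) ha)

lemma mem_cube_iff {n : ℕ} {c ξ : Fin n → ℤ} {N : ℕ} : ξ ∈ cube c N ↔ ∀ i, c i - 4 * N ≤ ξ i ∧ ξ i ≤ c i + 4 * N := by
  rw [cube, Fintype.mem_piFinset]
  simp only [mem_Icc]

lemma moment_one (ε : ℝ) (hε : 0 < ε) : ∃ C : ℝ, 1 ≤ C ∧ ∀ N : ℕ, 1 ≤ N → ∀ (T : ℕ) [NeZero T] (c : Fin 1 → ℤ)
    (a : (Fin 1 → ℤ) → ℂ), (∀ ξ ∈ cube c N, (∀ i, 8 * |ξ i| < T) ∧ 8 * ∑ i, ξ i ^ 2 < T) →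
    ∑ ξ ∈ cube c N, ‖a ξ‖ ^ 2 ≤ 1 →
    ∑ z, ‖gw T (cube c N) a z‖ ^ 6 ≤ Fintype.card (ZMod T × (Fin 1 → ZMod T)) * (C * (N : ℝ) ^ ε) := by
  classical
  obtain ⟨C, hC1, hC⟩ := card_rep_le_rpow 3 (by norm_num) ε hε
  refine ⟨C, hC1, fun N hN T _ c a hT ha => ?_⟩
  refine sum_gw_pow_le (r := 3) le_rfl _ a ha hT ?_ (by positivity)
  intro f hf I hI
  set F : (Fin 3 → Fin 1 → ℤ) → ℤ × ℤ := fun g => (g 0 0 + g 1 0 - 2 * g 2 0, g 0 0 - g 1 0) with hF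
  have hinj : Set.InjOn F I := by
    intro g hg g' hg' h
    have h1 := (hI g hg).2.1 0
    have h2 := (hI g' hg').2.1 0
    simp only [hF, Prod.mk.injEq] at h
    simp only [Fin.sum_univ_three] at h1 h2
    funext k i
    have hi : i = 0 := Subsingleton.elim _ _
    subst hi
    fin_cases k <;> simp <;> omega
  rw [← Finset.card_image_of_injOn hinj]
  refine hC N hN (6 * (∑ k, ∑ i, f k i ^ 2) - 2 * (∑ k, f k 0) ^ 2) ?_ _ ?_
  · have h0 := mem_cube_iff.1 (hf 0) 0
    have h1 := mem_cube_iff.1 (hf 1) 0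
    have h2 := mem_cube_iff.1 (hf 2) 0
    simp only [Fin.sum_univ_three, Fin.sum_univ_one]
    have e1 : (f 0 0 + f 1 0 - 2 * f 2 0) ^ 2 ≤ (16 * N) ^ 2 := sq_le_sq' (by omega) (by omega)
    have e2 : (f 0 0 - f 1 0) ^ 2 ≤ (8 * N) ^ 2 := sq_le_sq' (by omega) (by omega)
    nlinarith
  · intro s hs
    obtain ⟨g, hg, rfl⟩ := mem_image.1 hs
    obtain ⟨_, h2, h3⟩ := hI g hg
    rw [← h2 0, ← h3]
    simp only [hF, Fin.sum_univ_three, Fin.sum_univ_one]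
    push_cast
    ring

lemma moment_two (ε : ℝ) (hε : 0 < ε) : ∃ C : ℝ, 1 ≤ C ∧ ∀ N : ℕ, 1 ≤ N → ∀ (T : ℕ) [NeZero T] (c : Fin 2 → ℤ)
    (a : (Fin 2 → ℤ) → ℂ), (∀ ξ ∈ cube c N, (∀ i, 8 * |ξ i| < T) ∧ 8 * ∑ i, ξ i ^ 2 < T) →
    ∑ ξ ∈ cube c N, ‖a ξ‖ ^ 2 ≤ 1 →
    ∑ z, ‖gw T (cube c N) a z‖ ^ 4 ≤ Fintype.card (ZMod T × (Fin 2 → ZMod T)) * (C * (N : ℝ) ^ ε) := by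
  classical
  obtain ⟨C, hC1, hC⟩ := card_rep_le_rpow 1 (by norm_num) ε hε
  refine ⟨C, hC1, fun N hN T _ c a hT ha => ?_⟩
  refine sum_gw_pow_le (r := 2) (by norm_num) _ a ha hT ?_ (by positivity)
  intro f hf I hI
  set F : (Fin 2 → Fin 2 → ℤ) → ℤ × ℤ := fun g => (g 0 0 - g 1 0, g 0 1 - g 1 1) with hF
  have hinj : Set.InjOn F I := by
    intro g hg g' hg' h
    have h1 := (hI g hg).2.1
    have h2 := (hI g' hg').2.1
    simp only [hF, Prod.mk.injEq] at h
    have h10 := h1 0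
    have h11 := h1 1
    have h20 := h2 0
    have h21 := h2 1
    simp only [Fin.sum_univ_two] at h10 h11 h20 h21
    funext k i
    fin_cases k <;> fin_cases i <;> simp <;> omega
  rw [← Finset.card_image_of_injOn hinj]
  refine hC N hN (2 * (∑ k, ∑ i, f k i ^ 2) - ((∑ k, f k 0) ^ 2 + (∑ k, f k 1) ^ 2)) ?_ _ ?_
  · have h0 := mem_cube_iff.1 (hf 0)
    have h1 := mem_cube_iff.1 (hf 1)
    have h00 := h0 0
    have h01 := h0 1
    have h10 := h1 0
    have h11 := h1 1
    simp only [Fin.sum_univ_two]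
    have e1 : (f 0 0 - f 1 0) ^ 2 ≤ (8 * N) ^ 2 := sq_le_sq' (by omega) (by omega)
    have e2 : (f 0 1 - f 1 1) ^ 2 ≤ (8 * N) ^ 2 := sq_le_sq' (by omega) (by omega)
    nlinarith
  · intro s hs
    obtain ⟨g, hg, rfl⟩ := mem_image.1 hs
    obtain ⟨_, h2, h3⟩ := hI g hg
    rw [← h2 0, ← h2 1, ← h3]
    simp only [hF, Fin.sum_univ_two]
    push_cast
    ring

lemma moment_three (ε : ℝ) (hε : 0 < ε) : ∃ C : ℝ, 1 ≤ C ∧ ∀ N : ℕ, 1 ≤ N → ∀ (T : ℕ) [NeZero T] (c : Fin 3 → ℤ)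
    (a : (Fin 3 → ℤ) → ℂ), (∀ ξ ∈ cube c N, (∀ i, 8 * |ξ i| < T) ∧ 8 * ∑ i, ξ i ^ 2 < T) →
    ∑ ξ ∈ cube c N, ‖a ξ‖ ^ 2 ≤ 1 →
    ∑ z, ‖gw T (cube c N) a z‖ ^ 4 ≤ Fintype.card (ZMod T × (Fin 3 → ZMod T)) * (C * (N : ℝ) ^ (1 + ε)) := by
  classical
  obtain ⟨C, hC1, hC⟩ := card_rep_le_rpow 1 (by norm_num) ε hε
  refine ⟨17 * C, by linarith, fun N hN T _ c a hT ha => ?_⟩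
  have hN1 : (1 : ℝ) ≤ N := by exact_mod_cast hN
  refine sum_gw_pow_le (r := 2) (by norm_num) _ a ha hT ?_ (by positivity)
  intro f hf I hI
  set F : (Fin 2 → Fin 3 → ℤ) → ℤ × ℤ := fun g => (g 0 0 - g 1 0, g 0 1 - g 1 1) with hF
  have hfib : #I = ∑ d ∈ Icc (-(8 * N : ℤ)) (8 * N), #{g ∈ I | g 0 2 - g 1 2 = d} := by
    refine Finset.card_eq_sum_card_fiberwise fun g hg => ?_
    have h0 := mem_cube_iff.1 ((hI g hg).1 0) 2
    have h1 := mem_cube_iff.1 ((hI g hg).1 1) 2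
    rw [mem_coe, mem_Icc]
    constructor <;> linarith
  have hterm : ∀ d ∈ Icc (-(8 * N : ℤ)) (8 * N), (#{g ∈ I | g 0 2 - g 1 2 = d} : ℝ) ≤ C * (N : ℝ) ^ ε := by
    intro d _
    have hinj : Set.InjOn F ({g ∈ I | g 0 2 - g 1 2 = d} : Finset _) := by
      intro g hg g' hg' h
      rw [mem_coe, mem_filter] at hg hg'
      have h1 := (hI g hg.1).2.1
      have h2 := (hI g' hg'.1).2.1
      simp only [hF, Prod.mk.injEq] at h
      have h10 := h1 0
      have h11 := h1 1
      have h12 := h1 2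
      have h20 := h2 0
      have h21 := h2 1
      have h22 := h2 2
      have hd := hg.2
      have hd' := hg'.2
      simp only [Fin.sum_univ_two] at h10 h11 h20 h21 h12 h22
      funext k i
      fin_cases k <;> fin_cases i <;> simp <;> omega
    rw [← Finset.card_image_of_injOn hinj]
    refine hC N hN (2 * (∑ k, ∑ i, f k i ^ 2) - ((∑ k, f k 0) ^ 2 + (∑ k, f k 1) ^ 2 + (∑ k, f k 2) ^ 2) - d ^ 2) ?_ _ ?_
    · have h0 := mem_cube_iff.1 (hf 0)
      have h1 := mem_cube_iff.1 (hf 1)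
      have h00 := h0 0
      have h01 := h0 1
      have h02 := h0 2
      have h10 := h1 0
      have h11 := h1 1
      have h12 := h1 2
      simp only [Fin.sum_univ_two, Fin.sum_univ_three]
      have e1 : (f 0 0 - f 1 0) ^ 2 ≤ (8 * N) ^ 2 := sq_le_sq' (by omega) (by omega)
      have e2 : (f 0 1 - f 1 1) ^ 2 ≤ (8 * N) ^ 2 := sq_le_sq' (by omega) (by omega)
      have e3 : (f 0 2 - f 1 2) ^ 2 ≤ (8 * N) ^ 2 := sq_le_sq' (by omega) (by omega)
      nlinarith [sq_nonneg d]
    · intro s hs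
      obtain ⟨g, hg, rfl⟩ := mem_image.1 hs
      rw [mem_filter] at hg
      obtain ⟨_, h2, h3⟩ := hI g hg.1
      rw [← h2 0, ← h2 1, ← h2 2, ← h3, ← hg.2]
      simp only [hF, Fin.sum_univ_two, Fin.sum_univ_three]
      push_cast
      ring
  calc (#I : ℝ) = ∑ d ∈ Icc (-(8 * N : ℤ)) (8 * N), (#{g ∈ I | g 0 2 - g 1 2 = d} : ℝ) := by
        rw [hfib]; push_cast; rfl
    _ ≤ ∑ d ∈ Icc (-(8 * N : ℤ)) (8 * N), C * (N : ℝ) ^ ε := Finset.sum_le_sum hterm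
    _ = (16 * N + 1) * (C * (N : ℝ) ^ ε) := by
        rw [Finset.sum_const, nsmul_eq_mul, Int.card_Icc]
        congr 1
        have : (8 * (N : ℤ) + 1 - -(8 * N)).toNat = 16 * N + 1 := by omega
        rw [this]; push_cast; ring
    _ ≤ (17 * N) * (C * (N : ℝ) ^ ε) := mul_le_mul_of_nonneg_right (by linarith) (by positivity)
    _ = _ := by rw [Real.rpow_add (by positivity), Real.rpow_one]; ring

lemma exists_large_coord {n : ℕ} {v : Fin n → ℝ} (hv : ∑ i, v i ^ 2 = 1) : ∃ i, 1 ≤ n * |v i| := by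
  by_contra! h
  have hn : 0 < n := by
    rcases Nat.eq_zero_or_pos n with rfl | h
    · simp at hv
    · exact h
  have hn' : (0 : ℝ) < n := by exact_mod_cast hn
  have h1 : ∀ i, v i ^ 2 < 1 / n := by
    intro i
    have h2 := h i
    have h3 : |v i| < 1 / n := by rw [lt_div_iff₀ hn']; linarith
    have h4 : (1 : ℝ) / n ≤ 1 := by rw [div_le_one hn']; exact_mod_cast hn
    rw [← sq_abs]
    nlinarith [abs_nonneg (v i)]
  have h2 : ∑ i, v i ^ 2 < ∑ _i : Fin n, (1 : ℝ) / n :=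
    Finset.sum_lt_sum_of_nonempty ⟨⟨0, hn⟩, mem_univ _⟩ fun i _ => h1 i
  rw [hv, Finset.sum_const, card_univ, Fintype.card_fin, nsmul_eq_mul, mul_one_div_cancel hn'.ne'] at h2
  exact lt_irrefl _ h2

/-- Lattice points of a residue class in a thin slice of a box. -/
lemma card_strip_le {n : ℕ} {v : Fin n → ℝ} (hv : ∑ i, v i ^ 2 = 1) {q : ℕ} (hq : 1 ≤ q) {Λ D : ℝ} (hΛ : 0 ≤ Λ)
    (hD : 0 ≤ D) (S : Finset (Fin n → ℤ)) (h1 : ∀ h ∈ S, ∀ h' ∈ S, ∀ i, (q : ℤ) ∣ h i - h' i)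
    (h2 : ∀ h ∈ S, ∀ h' ∈ S, ∀ i, (h i : ℝ) - h' i ≤ Λ)
    (h3 : ∀ h ∈ S, ∀ h' ∈ S, ∑ i, v i * h i - ∑ i, v i * h' i ≤ D) :
    (#S : ℝ) ≤ (Λ / q + 1) ^ (n - 1) * (n * D / q + 1) := by
  classical
  obtain ⟨i0, hi0⟩ := exists_large_coord hv
  set X : ℝ := Λ / q + 1 with hX
  set pr : (Fin n → ℤ) → (Fin n → ℤ) := fun h => Function.update h i0 0 with hpr
  have himg : (#(S.image pr) : ℝ) ≤ X ^ (n - 1) := by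
    have hsub : S.image pr ⊆ Fintype.piFinset fun i => if i = i0 then {0} else S.image fun h => h i := by
      intro g hg
      obtain ⟨h, hh, rfl⟩ := mem_image.1 hg
      rw [Fintype.mem_piFinset]
      intro i
      by_cases hi : i = i0
      · subst hi; simp [hpr]
      · simp only [hi, if_false, hpr, Function.update_of_ne hi]
        exact mem_image_of_mem _ hh
    have hc := Finset.card_le_card hsub
    rw [Fintype.card_piFinset] at hc
    calc (#(S.image pr) : ℝ) ≤ ∏ i, (#(if i = i0 then {0} else S.image fun h => h i) : ℝ) := by exact_mod_cast hc
      _ ≤ ∏ i, (if i = i0 then 1 else X) := by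
        refine Finset.prod_le_prod (fun _ _ => by positivity) fun i _ => ?_
        split_ifs with hi
        · simp
        · refine card_le_of_dvd hq hΛ ?_ ?_
          · intro x hx y hy
            obtain ⟨h, hh, rfl⟩ := mem_image.1 hx
            obtain ⟨h', hh', rfl⟩ := mem_image.1 hy
            exact h1 h hh h' hh' i
          · intro x hx y hy
            obtain ⟨h, hh, rfl⟩ := mem_image.1 hx
            obtain ⟨h', hh', rfl⟩ := mem_image.1 hy
            exact h2 h hh h' hh' i
      _ = X ^ (n - 1) := by
        rw [← Finset.mul_prod_erase univ _ (mem_univ i0), if_pos rfl, one_mul]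
        rw [Finset.prod_congr rfl (g := fun _ => X) fun i hi => if_neg (Finset.ne_of_mem_erase hi), Finset.prod_const,
          Finset.card_erase_of_mem (mem_univ _), card_univ, Fintype.card_fin]
  have hfib : ∀ g ∈ S.image pr, (#{h ∈ S | pr h = g} : ℝ) ≤ n * D / q + 1 := by
    intro g _
    have hco : ∀ h ∈ S, ∀ h' ∈ S, pr h = g → pr h' = g → ∀ i, i ≠ i0 → h i = h' i := by
      intro h _ h' _ e e' i hi
      have := congrFun (e.trans e'.symm) i
      simpa [hpr, Function.update_of_ne hi] using this
    have hinj : Set.InjOn (fun h : Fin n → ℤ => h i0) ({h ∈ S | pr h = g} : Finset _) := by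
      intro h hh h' hh' e
      rw [mem_coe, mem_filter] at hh hh'
      funext i
      by_cases hi : i = i0
      · subst hi; exact e
      · exact hco h hh.1 h' hh'.1 hh.2 hh'.2 i hi
    rw [← Finset.card_image_of_injOn hinj]
    have key : ∀ h ∈ S, ∀ h' ∈ S, pr h = g → pr h' = g → |(h i0 : ℝ) - h' i0| ≤ n * D := by
      intro h hh h' hh' e e'
      have e1 : ∑ i, v i * h i - ∑ i, v i * h' i = v i0 * ((h i0 : ℝ) - h' i0) := by
        rw [← Finset.sum_sub_distrib, Finset.sum_eq_single i0]
        · ring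
        · intro i _ hi; rw [hco h hh h' hh' e e' i hi, sub_self]
        · simp
      have e2 : |v i0 * ((h i0 : ℝ) - h' i0)| ≤ D := by
        rw [abs_le, ← e1]
        have := h3 h hh h' hh'
        have := h3 h' hh' h hh
        constructor <;> linarith
      rw [abs_mul] at e2
      calc |(h i0 : ℝ) - h' i0| ≤ (n * |v i0|) * |(h i0 : ℝ) - h' i0| := le_mul_of_one_le_left (abs_nonneg _) hi0
        _ = n * (|v i0| * |(h i0 : ℝ) - h' i0|) := by ring
        _ ≤ _ := mul_le_mul_of_nonneg_left e2 (by positivity)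
    refine card_le_of_dvd hq (by positivity) ?_ ?_
    · intro x hx y hy
      obtain ⟨h, hh, rfl⟩ := mem_image.1 hx
      obtain ⟨h', hh', rfl⟩ := mem_image.1 hy
      exact h1 h (mem_filter.1 hh).1 h' (mem_filter.1 hh').1 i0
    · intro x hx y hy
      obtain ⟨h, hh, rfl⟩ := mem_image.1 hx
      obtain ⟨h', hh', rfl⟩ := mem_image.1 hy
      rw [mem_filter] at hh hh'
      exact (le_abs_self _).trans (key h hh.1 h' hh'.1 hh.2 hh'.2)
  calc (#S : ℝ) = ∑ g ∈ S.image pr, (#{h ∈ S | pr h = g} : ℝ) := by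
        rw [Finset.card_eq_sum_card_image pr S]; push_cast; rfl
    _ ≤ ∑ g ∈ S.image pr, (n * D / q + 1) := Finset.sum_le_sum hfib
    _ = #(S.image pr) * (n * D / q + 1) := by rw [Finset.sum_const, nsmul_eq_mul]
    _ ≤ _ := mul_le_mul_of_nonneg_right himg (by positivity)

/-- Multiples of a fixed lattice vector modulo `q` that fall in a thin slice of a box. -/
lemma card_multiples_strip_le {n : ℕ} {v : Fin n → ℝ} (hv : ∑ i, v i ^ 2 = 1) {q B : ℕ} (hq : 1 ≤ q) {Λ M : ℝ}
    (hΛ : 0 ≤ Λ) (hM : 0 ≤ M) (hMq : M ≤ q) (j : Fin n → ℤ) (hB : ∀ i, |j i| ≤ B) (hB1 : 1 ≤ B)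
    (hσ : ∑ i, v i * j i ≠ 0) (P : Finset (ℕ × (Fin n → ℤ))) (h0 : ∀ p ∈ P, p.1 < q)
    (h1 : ∀ p ∈ P, ∀ i, (q : ℤ) ∣ p.1 * j i - p.2 i)
    (h2 : ∀ p ∈ P, ∀ p' ∈ P, ∀ i, |(p.2 i : ℝ) - p'.2 i| ≤ Λ) (h3 : ∀ p ∈ P, |∑ i, v i * p.2 i| ≤ M) :
    (#P : ℝ) ≤ B * (Λ / q + 2) ^ (n - 1) * (n * (n + 2) + 1) * (2 * M / |∑ i, v i * j i| + 1) := by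
  classical
  set σ := ∑ i, v i * j i with hσd
  have hq0 : (0 : ℝ) < q := by exact_mod_cast hq
  have hB0 : (0 : ℝ) < B := by exact_mod_cast hB1
  have hvi : ∀ i, |v i| ≤ 1 := by
    intro i
    rw [← sq_le_one_iff_abs_le_one, ← hv]
    exact Finset.single_le_sum (f := fun i => v i ^ 2) (fun _ _ => sq_nonneg _) (mem_univ i)
  have hσB : |σ| ≤ n * B := by
    calc |σ| ≤ ∑ i, |v i * j i| := Finset.abs_sum_le_sum_abs _ _
      _ ≤ ∑ _i : Fin n, (B : ℝ) := by
        refine Finset.sum_le_sum fun i _ => ?_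
        rw [abs_mul]
        have : |(j i : ℝ)| ≤ B := by exact_mod_cast hB i
        exact (mul_le_of_le_one_left (abs_nonneg _) (hvi i)).trans this
      _ = _ := by rw [Finset.sum_const, card_univ, Fintype.card_fin, nsmul_eq_mul]
  have hσ0 : 0 < |σ| := abs_pos.2 hσ
  set l : ℕ × (Fin n → ℤ) → (Fin n → ℤ) := fun p i => (p.1 * j i - p.2 i) / q with hl
  have hlq : ∀ p ∈ P, ∀ i, (q : ℝ) * l p i = p.1 * j i - p.2 i := by
    intro p hp i
    have := Int.mul_ediv_cancel' (h1 p hp i)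
    exact_mod_cast this
  have hlv : ∀ p ∈ P, (q : ℝ) * ∑ i, v i * l p i = p.1 * σ - ∑ i, v i * p.2 i := by
    intro p hp
    rw [hσd, Finset.mul_sum, Finset.mul_sum, ← Finset.sum_sub_distrib]
    refine Finset.sum_congr rfl fun i _ => ?_
    have := hlq p hp i
    linear_combination v i * this
  have hblock : ∀ b ∈ range B, (#{p ∈ P | p.1 * B / q = b} : ℝ) ≤
      ((Λ / q + 2) ^ (n - 1) * (n * (n + 2) + 1)) * (2 * M / |σ| + 1) := by
    intro b _
    set Q : Finset (ℕ × (Fin n → ℤ)) := {p ∈ P | p.1 * B / q = b} with hQ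
    have hQP : ∀ p ∈ Q, p ∈ P := fun p hp => (mem_filter.1 hp).1
    have hcc : ∀ p ∈ Q, ∀ p' ∈ Q, |(p.1 : ℝ) - p'.1| * B ≤ q := by
      intro p hp p' hp'
      have e1 := (mem_filter.1 hp).2
      have e2 := (mem_filter.1 hp').2
      have d1 := Nat.div_add_mod (p.1 * B) q
      have d2 := Nat.div_add_mod (p'.1 * B) q
      have m1 := Nat.mod_lt (p.1 * B) hq
      have m2 := Nat.mod_lt (p'.1 * B) hq
      rw [e1] at d1
      rw [e2] at d2
      have f1 : p.1 * B ≤ p'.1 * B + q := by omega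
      have f2 : p'.1 * B ≤ p.1 * B + q := by omega
      have f1' : (p.1 : ℝ) * B ≤ p'.1 * B + q := by exact_mod_cast f1
      have f2' : (p'.1 : ℝ) * B ≤ p.1 * B + q := by exact_mod_cast f2
      rw [← abs_of_pos hB0, ← abs_mul, abs_le]
      constructor <;> linarith
    have himg : (#(Q.image l) : ℝ) ≤ (Λ / q + 2) ^ (n - 1) * (n * (n + 2) + 1) := by
      have := card_strip_le hv le_rfl (Λ := 1 + Λ / q) (D := n + 2) (by positivity) (by positivity) (Q.image l)
        (fun _ _ _ _ _ => by simp) (by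
          intro x hx y hy i
          obtain ⟨p, hp, rfl⟩ := mem_image.1 hx
          obtain ⟨p', hp', rfl⟩ := mem_image.1 hy
          have e1 := hlq p (hQP p hp) i
          have e2 := hlq p' (hQP p' hp') i
          have e3 := h2 p' (hQP p' hp') p (hQP p hp) i
          have e4 : |((p.1 : ℝ) - p'.1) * j i| ≤ q := by
            rw [abs_mul]
            have : |(j i : ℝ)| ≤ B := by exact_mod_cast hB i
            exact (mul_le_mul_of_nonneg_left this (abs_nonneg _)).trans (hcc p hp p' hp')
          have e5 := le_abs_self (((p.1 : ℝ) - p'.1) * j i)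
          have e6 := le_abs_self ((p'.2 i : ℝ) - p.2 i)
          have : (q : ℝ) * ((l p i : ℝ) - l p' i) ≤ q * (1 + Λ / q) := by
            rw [mul_add, mul_div_cancel₀ _ hq0.ne']; linarith
          exact le_of_mul_le_mul_left this hq0) (by
          intro x hx y hy
          obtain ⟨p, hp, rfl⟩ := mem_image.1 hx
          obtain ⟨p', hp', rfl⟩ := mem_image.1 hy
          have e1 := hlv p (hQP p hp)
          have e2 := hlv p' (hQP p' hp')
          have e3 := abs_le.1 (h3 p (hQP p hp))
          have e3' := abs_le.1 (h3 p' (hQP p' hp'))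
          have e4 : |((p.1 : ℝ) - p'.1) * σ| ≤ n * q := by
            rw [abs_mul]
            have := hcc p hp p' hp'
            have h6 : |(p.1 : ℝ) - p'.1| * |σ| ≤ |(p.1 : ℝ) - p'.1| * (n * B) :=
              mul_le_mul_of_nonneg_left hσB (abs_nonneg _)
            have h7 : (n : ℝ) * (|(p.1 : ℝ) - p'.1| * B) ≤ n * q := mul_le_mul_of_nonneg_left this (by positivity)
            linarith
          have e5 := le_abs_self (((p.1 : ℝ) - p'.1) * σ)
          have : (q : ℝ) * (∑ i, v i * (l p i : ℝ) - ∑ i, v i * (l p' i : ℝ)) ≤ q * (n + 2) := by linarith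
          exact le_of_mul_le_mul_left this hq0)
      refine this.trans (le_of_eq ?_)
      push_cast
      ring
    have hfib : ∀ g ∈ Q.image l, (#{p ∈ Q | l p = g} : ℝ) ≤ 2 * M / |σ| + 1 := by
      intro g _
      have hinj : Set.InjOn (fun p : ℕ × (Fin n → ℤ) => (p.1 : ℤ)) ({p ∈ Q | l p = g} : Finset _) := by
        intro p hp p' hp' e
        rw [mem_coe, mem_filter] at hp hp'
        have e' : p.1 = p'.1 := Int.ofNat.inj e
        refine Prod.ext e' (funext fun i => ?_)
        have e1 := hlq p (hQP p hp.1) i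
        have e2 := hlq p' (hQP p' hp'.1) i
        rw [hp.2] at e1
        rw [hp'.2, ← e'] at e2
        have : (p.2 i : ℝ) = p'.2 i := by linarith
        exact_mod_cast this
      rw [← Finset.card_image_of_injOn hinj]
      refine (card_le_of_dvd le_rfl (ℓ := 2 * M / |σ|) (by positivity) (fun _ _ _ _ => by simp) ?_).trans (by simp)
      intro x hx y hy
      obtain ⟨p, hp, rfl⟩ := mem_image.1 hx
      obtain ⟨p', hp', rfl⟩ := mem_image.1 hy
      rw [mem_filter] at hp hp'
      have e1 := hlv p (hQP p hp.1)
      have e2 := hlv p' (hQP p' hp'.1)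
      rw [hp.2] at e1
      rw [hp'.2] at e2
      have e3 := abs_le.1 (h3 p (hQP p hp.1))
      have e3' := abs_le.1 (h3 p' (hQP p' hp'.1))
      rw [le_div_iff₀ hσ0]
      have : |((p.1 : ℝ) - p'.1) * σ| ≤ 2 * M := by
        rw [abs_le]
        constructor <;> linarith
      rw [abs_mul] at this
      push_cast
      exact (mul_le_mul_of_nonneg_right (le_abs_self _) hσ0.le).trans this
    calc (#Q : ℝ) = ∑ g ∈ Q.image l, (#{p ∈ Q | l p = g} : ℝ) := by
          rw [Finset.card_eq_sum_card_image l Q]; push_cast; rfl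
      _ ≤ ∑ g ∈ Q.image l, (2 * M / |σ| + 1) := Finset.sum_le_sum hfib
      _ = #(Q.image l) * (2 * M / |σ| + 1) := by rw [Finset.sum_const, nsmul_eq_mul]
      _ ≤ _ := mul_le_mul_of_nonneg_right himg (by positivity)
  have hcard : #P = ∑ b ∈ range B, #{p ∈ P | p.1 * B / q = b} := by
    refine Finset.card_eq_sum_card_fiberwise fun p hp => ?_
    rw [mem_coe, mem_range, Nat.div_lt_iff_lt_mul hq, mul_comm B]
    exact Nat.mul_lt_mul_of_pos_right (h0 p hp) hB1
  calc (#P : ℝ) = ∑ b ∈ range B, (#{p ∈ P | p.1 * B / q = b} : ℝ) := by rw [hcard]; push_cast; rfl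
    _ ≤ ∑ b ∈ range B, ((Λ / q + 2) ^ (n - 1) * (n * (n + 2) + 1)) * (2 * M / |σ| + 1) := Finset.sum_le_sum hblock
    _ = _ := by rw [Finset.sum_const, card_range, nsmul_eq_mul]; ring

/-- Solutions of `a h ≡ j` modulo `q` in a thin slice of a box, summed over all reduced residues `a`. -/
lemma card_residue_strip_le {n : ℕ} {v : Fin n → ℝ} (hv : ∑ i, v i ^ 2 = 1) {q : ℕ} (hq : 1 ≤ q) {Λ M : ℝ}
    (hΛ : 0 ≤ Λ) (hM : 0 ≤ M) (j : Fin n → ℤ) (P : Finset (ℕ × (Fin n → ℤ)))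
    (h0 : ∀ p ∈ P, p.1 < q ∧ p.1.Coprime q) (h1 : ∀ p ∈ P, ∀ i, (q : ℤ) ∣ p.1 * p.2 i - j i)
    (h2 : ∀ p ∈ P, ∀ p' ∈ P, ∀ i, |(p.2 i : ℝ) - p'.2 i| ≤ Λ) (h3 : ∀ p ∈ P, |∑ i, v i * p.2 i| ≤ M) :
    (#P : ℝ) ≤ (Λ / q + 1) ^ (n - 1) * (2 * n * M + q) ∧
    ∀ B : ℕ, 1 ≤ B → M ≤ q → (∀ i, |j i| ≤ B) → ∑ i, v i * j i ≠ 0 →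
      (#P : ℝ) ≤ B * (Λ / q + 2) ^ (n - 1) * (n * (n + 2) + 1) * (2 * M / |∑ i, v i * j i| + 1) := by
  classical
  have hq0 : (0 : ℝ) < q := by exact_mod_cast hq
  constructor
  · have hcard : #P = ∑ b ∈ range q, #{p ∈ P | p.1 = b} :=
      Finset.card_eq_sum_card_fiberwise fun p hp => by
        rw [mem_coe, mem_range]; exact (h0 p hp).1
    have hfib : ∀ b ∈ range q, (#{p ∈ P | p.1 = b} : ℝ) ≤ (Λ / q + 1) ^ (n - 1) * (n * (2 * M) / q + 1) := by
      intro b _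
      have hinj : Set.InjOn (fun p : ℕ × (Fin n → ℤ) => p.2) ({p ∈ P | p.1 = b} : Finset _) := by
        intro p hp p' hp' e
        rw [mem_coe, mem_filter] at hp hp'
        exact Prod.ext (hp.2.trans hp'.2.symm) e
      rw [← Finset.card_image_of_injOn hinj]
      refine card_strip_le hv hq hΛ (by positivity) _ ?_ ?_ ?_
      · intro x hx y hy i
        obtain ⟨p, hp, rfl⟩ := mem_image.1 hx
        obtain ⟨p', hp', rfl⟩ := mem_image.1 hy
        rw [mem_filter] at hp hp'
        have d1 := h1 p hp.1 i
        have d2 := h1 p' hp'.1 i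
        rw [hp'.2, ← hp.2] at d2
        have d3 : (q : ℤ) ∣ p.1 * (p.2 i - p'.2 i) := by
          have := dvd_sub d1 d2
          have e : (p.1 : ℤ) * p.2 i - j i - (p.1 * p'.2 i - j i) = p.1 * (p.2 i - p'.2 i) := by ring
          rwa [e] at this
        exact (Nat.Coprime.isCoprime (h0 p hp.1).2).symm.dvd_of_dvd_mul_left d3
      · intro x hx y hy i
        obtain ⟨p, hp, rfl⟩ := mem_image.1 hx
        obtain ⟨p', hp', rfl⟩ := mem_image.1 hy
        exact (le_abs_self _).trans (h2 p (mem_filter.1 hp).1 p' (mem_filter.1 hp').1 i)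
      · intro x hx y hy
        obtain ⟨p, hp, rfl⟩ := mem_image.1 hx
        obtain ⟨p', hp', rfl⟩ := mem_image.1 hy
        have e1 := abs_le.1 (h3 p (mem_filter.1 hp).1)
        have e2 := abs_le.1 (h3 p' (mem_filter.1 hp').1)
        linarith
    calc (#P : ℝ) = ∑ b ∈ range q, (#{p ∈ P | p.1 = b} : ℝ) := by rw [hcard]; push_cast; rfl
      _ ≤ ∑ b ∈ range q, (Λ / q + 1) ^ (n - 1) * (n * (2 * M) / q + 1) := Finset.sum_le_sum hfib
      _ = _ := by rw [Finset.sum_const, card_range, nsmul_eq_mul]; field_simp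
  · intro B hB1 hMq hB hσ
    have : NeZero q := ⟨by omega⟩
    set I : ℕ × (Fin n → ℤ) → ℕ × (Fin n → ℤ) := fun p => (((p.1 : ZMod q)⁻¹).val, p.2) with hI
    have hunit : ∀ p ∈ P, ((p.1 : ZMod q)) * (p.1 : ZMod q)⁻¹ = 1 := fun p hp =>
      ZMod.coe_mul_inv_eq_one _ (h0 p hp).2
    have hinj : Set.InjOn I P := by
      intro p hp p' hp' e
      simp only [hI, Prod.mk.injEq] at e
      have e1 := ZMod.val_injective q e.1
      have u1 := hunit p hp
      have u2 := hunit p' hp'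
      have e2 : (p.1 : ZMod q) = p'.1 := by
        calc (p.1 : ZMod q) = p.1 * (p'.1 * (p'.1 : ZMod q)⁻¹) := by rw [u2, mul_one]
          _ = p'.1 * (p.1 * (p.1 : ZMod q)⁻¹) := by rw [e1]; ring
          _ = p'.1 := by rw [u1, mul_one]
      have e3 := (ZMod.natCast_eq_natCast_iff' _ _ _).1 e2
      rw [Nat.mod_eq_of_lt (h0 p hp).1, Nat.mod_eq_of_lt (h0 p' hp').1] at e3
      exact Prod.ext e3 e.2
    rw [← Finset.card_image_of_injOn hinj]
    refine card_multiples_strip_le hv hq hΛ hM hMq j hB hB1 hσ _ ?_ ?_ ?_ ?_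
    · intro x hx
      obtain ⟨p, hp, rfl⟩ := mem_image.1 hx
      exact ZMod.val_lt _
    · intro x hx i
      obtain ⟨p, hp, rfl⟩ := mem_image.1 hx
      have d := h1 p hp i
      rw [← ZMod.intCast_eq_intCast_iff_dvd_sub] at d
      rw [← ZMod.intCast_eq_intCast_iff_dvd_sub]
      push_cast at d ⊢
      rw [d, ZMod.natCast_zmod_val, ← mul_assoc, mul_comm _ (p.1 : ZMod q), hunit p hp, one_mul]
    · intro x hx y hy i
      obtain ⟨p, hp, rfl⟩ := mem_image.1 hx
      obtain ⟨p', hp', rfl⟩ := mem_image.1 hy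
      exact h2 p hp p' hp' i
    · intro x hx
      obtain ⟨p, hp, rfl⟩ := mem_image.1 hx
      exact h3 p hp

lemma abs_le_one_of_sum_sq {n : ℕ} {v : Fin n → ℝ} (hv : ∑ i, v i ^ 2 = 1) (i : Fin n) : |v i| ≤ 1 := by
  rw [← sq_le_one_iff_abs_le_one, ← hv]
  exact Finset.single_le_sum (f := fun i => v i ^ 2) (fun _ _ => sq_nonneg _) (mem_univ i)

lemma abs_dot_le {n : ℕ} {v : Fin n → ℝ} (hv : ∑ i, v i ^ 2 = 1) {x : Fin n → ℝ} {X : ℝ} (hx : ∀ i, |x i| ≤ X) :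
    |∑ i, v i * x i| ≤ n * X := by
  calc |∑ i, v i * x i| ≤ ∑ i, |v i * x i| := Finset.abs_sum_le_sum_abs _ _
    _ ≤ ∑ _i : Fin n, X := by
      refine Finset.sum_le_sum fun i _ => ?_
      rw [abs_mul]
      exact (mul_le_of_le_one_left (abs_nonneg _) (abs_le_one_of_sum_sq hv i)).trans (hx i)
    _ = _ := by rw [Finset.sum_const, card_univ, Fintype.card_fin, nsmul_eq_mul]

lemma block_bound {n M ρ s σ B D : ℝ} (hn : 1 ≤ n) (hM : 1 ≤ M) (hρ : 0 ≤ ρ) (hs : 0 < s) (hσ : 0 < σ)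
    (hσ2 : s ≤ 2 * σ) (hs1 : 1 ≤ s) (hB0 : 0 ≤ B) (hD : 0 ≤ D) (hB : B ≤ D + 64 * ρ + 66)
    (hDs : D ≤ s + 64 * (n * ρ)) : B * (2 * M / σ + 1) ≤ (600 * n + 400) * (M * (1 + ρ) + D) := by
  have k1 : 2 * M / σ ≤ 4 * M / s := by
    rw [div_le_div_iff₀ hσ hs]
    have := mul_le_mul_of_nonneg_left hσ2 (by linarith : 0 ≤ 2 * M)
    linarith
  have k2 : B ≤ ((128 * n + 67) * (1 + ρ)) * s := by
    have t1 : 64 * (n * ρ) + 64 * ρ + 66 ≤ (64 * (n * ρ) + 64 * ρ + 66) * s :=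
      le_mul_of_one_le_right (by positivity) hs1
    have t2 : (1 + (64 * (n * ρ) + 64 * ρ + 66)) * s ≤ ((128 * n + 67) * (1 + ρ)) * s := by
      refine mul_le_mul_of_nonneg_right ?_ hs.le
      have : 0 ≤ n * ρ := mul_nonneg (by linarith) hρ
      linarith
    linarith
  have k3 : B * (4 * M / s) ≤ 4 * M * ((128 * n + 67) * (1 + ρ)) := by
    rw [mul_div_assoc', div_le_iff₀ hs]
    have := mul_le_mul_of_nonneg_left k2 (by linarith : 0 ≤ 4 * M)
    linarith
  have k4 : B * (2 * M / σ) ≤ B * (4 * M / s) := mul_le_mul_of_nonneg_left k1 hB0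
  have k6 : 1 + ρ ≤ M * (1 + ρ) := le_mul_of_one_le_left (by positivity) hM
  have k8 : 0 ≤ n * (M * (1 + ρ)) := by positivity
  have k9 : 0 ≤ n * D := by positivity
  linarith

/-- Pairs `(a, h)` for which all the numbers `(a/q + β) h_i + v_i δ - r_i/N` are close to integers. -/
lemma strip_pairs_le {n : ℕ} {v : Fin n → ℝ} (hv : ∑ i, v i ^ 2 = 1) {N q : ℕ} (hN : 1 ≤ N) (hq : 1 ≤ q)
    (hqN : q ≤ 64 * N) {β : ℝ} (hβ : |β| ≤ 1 / (64 * N * q)) {Λ M δ ρ : ℝ} (hM : 1 ≤ M) (hΛ : 0 ≤ Λ) (hρ : 0 ≤ ρ)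
    (hΛ' : ∀ x : ℝ, |x| ≤ 32 * N → |x| * (N * |β|) ≤ 2 → |x| ≤ Λ) (r : Fin n → ℤ) (hr : ∀ i, |(r i : ℝ)| ≤ ρ)
    (P : Finset (ℕ × (Fin n → ℤ))) (h0 : ∀ p ∈ P, p.1 < q ∧ p.1.Coprime q)
    (h1 : ∀ p ∈ P, ∀ i, |(p.2 i : ℝ)| ≤ 16 * N) (h2 : ∀ p ∈ P, |∑ i, v i * p.2 i| ≤ M)
    (h3 : ∀ p ∈ P, ∀ i, ∃ k : ℤ, |(p.1 / q + β) * p.2 i + v i * δ - r i / N - k| ≤ 1 / N) :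
    (#P : ℝ) ≤ 131 ^ n * ((Λ / q + 2) ^ (n - 1) * (((n * (n + 2) + 1) * (600 * n + 400)) *
      (M * (1 + ρ) + q * |δ| + if q * |δ - (∑ i, v i * r i) / N| < 130 * n then (q : ℝ) else 0))) := by
  classical
  have hq0 : (0 : ℝ) < q := by exact_mod_cast hq
  have hq1 : (1 : ℝ) ≤ q := by exact_mod_cast hq
  have hN0 : (0 : ℝ) < N := by exact_mod_cast hN
  have hqN' : (q : ℝ) ≤ 64 * N := by exact_mod_cast hqN
  have hqN2 : (q : ℝ) / N ≤ 64 := by rw [div_le_iff₀ hN0]; exact hqN'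
  obtain ⟨i0, -⟩ := exists_large_coord hv
  have hn1 : (1 : ℝ) ≤ n := by
    have : 0 < n := i0.pos
    exact_mod_cast this
  set y : Fin n → ℝ := fun i => v i * δ - r i / N with hy
  set j : ℕ × (Fin n → ℤ) → (Fin n → ℤ) := fun p i =>
    p.1 * p.2 i - q * round ((p.1 / q + β) * p.2 i + v i * δ - r i / N) with hj
  have hj1 : ∀ p ∈ P, ∀ i, |(j p i : ℝ) + q * β * p.2 i + q * y i| ≤ q / N := by
    intro p hp i
    obtain ⟨k, hk⟩ := h3 p hp i
    have e1 := (round_le ((p.1 / q + β) * p.2 i + v i * δ - r i / N) k).trans hk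
    have e2 : (j p i : ℝ) + q * β * p.2 i + q * y i = q * ((p.1 / q + β) * p.2 i + v i * δ - r i / N -
        round ((p.1 / q + β) * p.2 i + v i * δ - r i / N)) := by
      simp only [hj, hy]; push_cast; field_simp; ring
    rw [e2, abs_mul, abs_of_pos hq0]
    calc _ ≤ (q : ℝ) * (1 / N) := mul_le_mul_of_nonneg_left e1 hq0.le
      _ = q / N := by ring
  have hj2 : ∀ p ∈ P, ∀ i, |(j p i : ℝ) + q * y i| ≤ 65 := by
    intro p hp i
    have e1 := hj1 p hp i
    have e2 : |q * β * p.2 i| ≤ 1 := by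
      rw [abs_mul, abs_mul, abs_of_pos hq0]
      calc q * |β| * |(p.2 i : ℝ)| ≤ q * (1 / (64 * N * q)) * (16 * N) := by
            gcongr; exact h1 p hp i
        _ ≤ 1 := by field_simp; norm_num
    have e3 := abs_le.1 (e1.trans hqN2)
    have e4 := abs_le.1 e2
    rw [abs_le]; constructor <;> linarith
  have himg : (#(P.image j) : ℝ) ≤ 131 ^ n := by
    have hsub : P.image j ⊆ Fintype.piFinset fun i => P.image fun p => j p i := by
      intro g hg
      obtain ⟨p, hp, rfl⟩ := mem_image.1 hg
      rw [Fintype.mem_piFinset]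
      exact fun i => mem_image_of_mem _ hp
    have hc := Finset.card_le_card hsub
    rw [Fintype.card_piFinset] at hc
    calc (#(P.image j) : ℝ) ≤ ∏ i, (#(P.image fun p => j p i) : ℝ) := by exact_mod_cast hc
      _ ≤ ∏ _i : Fin n, (131 : ℝ) := by
        refine Finset.prod_le_prod (fun _ _ => by positivity) fun i _ => ?_
        refine (card_le_of_dvd le_rfl (ℓ := 130) (by norm_num) (fun _ _ _ _ => by simp) ?_).trans (by norm_num)
        intro x hx y hy
        obtain ⟨p, hp, rfl⟩ := mem_image.1 hx
        obtain ⟨p', hp', rfl⟩ := mem_image.1 hy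
        have e1 := abs_le.1 (hj2 p hp i)
        have e2 := abs_le.1 (hj2 p' hp' i)
        linarith
      _ = _ := by rw [Finset.prod_const, card_univ, Fintype.card_fin]
  set s : ℝ := q * (δ - (∑ i, v i * r i) / N) with hs
  have hsy : s = q * ∑ i, v i * y i := by
    have : ∑ i, v i * y i = δ - (∑ i, v i * r i) / N := by
      calc ∑ i, v i * y i = ∑ i, (v i ^ 2 * δ - v i * r i / N) :=
            Finset.sum_congr rfl fun i _ => by simp only [hy]; ring
        _ = _ := by rw [Finset.sum_sub_distrib, ← Finset.sum_mul, hv, one_mul, Finset.sum_div]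
    rw [this]
  set X : ℝ := M * (1 + ρ) + q * |δ| + if q * |δ - (∑ i, v i * r i) / N| < 130 * n then (q : ℝ) else 0 with hX
  have hX1 : M ≤ X := by
    have : M ≤ M * (1 + ρ) := le_mul_of_one_le_right (by linarith) (by linarith)
    have h5 : (0 : ℝ) ≤ if q * |δ - (∑ i, v i * r i) / N| < 130 * n then (q : ℝ) else 0 := by
      split_ifs <;> positivity
    have : 0 ≤ q * |δ| := by positivity
    linarith
  have hX0 : 0 ≤ X := by linarith
  have hLq : 0 ≤ Λ / q := by positivity
  have hfib : ∀ g ∈ P.image j, (#{p ∈ P | j p = g} : ℝ) ≤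
      (Λ / q + 2) ^ (n - 1) * (((n * (n + 2) + 1) * (600 * n + 400)) * X) := by
    intro g hg
    obtain ⟨p0, hp0, rfl⟩ := mem_image.1 hg
    set Q : Finset (ℕ × (Fin n → ℤ)) := {p ∈ P | j p = j p0} with hQ
    have hQP : ∀ p ∈ Q, p ∈ P := fun p hp => (mem_filter.1 hp).1
    have hQj : ∀ p ∈ Q, j p = j p0 := fun p hp => (mem_filter.1 hp).2
    obtain ⟨b1, b2⟩ := card_residue_strip_le hv hq hΛ (by linarith : 0 ≤ M) (j p0) Q (fun p hp => h0 p (hQP p hp))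
      (fun p hp i => by
        rw [← hQj p hp]
        simp only [hj]
        exact ⟨round ((p.1 / q + β) * p.2 i + v i * δ - r i / N), by ring⟩)
      (fun p hp p' hp' i => by
        have e1 := hj1 p (hQP p hp) i
        have e2 := hj1 p' (hQP p' hp') i
        rw [hQj p hp] at e1
        rw [hQj p' hp'] at e2
        have e3 := abs_le.1 (h1 p (hQP p hp) i)
        have e4 := abs_le.1 (h1 p' (hQP p' hp') i)
        refine hΛ' _ (by rw [abs_le]; constructor <;> linarith) ?_
        have e5 : |q * β * ((p.2 i : ℝ) - p'.2 i)| ≤ 2 * (q / N) := by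
          have := abs_le.1 e1
          have := abs_le.1 e2
          rw [abs_le]; constructor <;> linarith
        rw [abs_mul, abs_mul, abs_of_pos hq0] at e5
        have e6 : (q : ℝ) * (|(p.2 i : ℝ) - p'.2 i| * (N * |β|)) ≤ q * 2 := by
          calc (q : ℝ) * (|(p.2 i : ℝ) - p'.2 i| * (N * |β|)) = (q * |β| * |(p.2 i : ℝ) - p'.2 i|) * N := by ring
            _ ≤ (2 * (q / N)) * N := mul_le_mul_of_nonneg_right e5 hN0.le
            _ = _ := by field_simp
        exact le_of_mul_le_mul_left e6 hq0)
      (fun p hp => h2 p (hQP p hp))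
    have hpow : (Λ / q + 1) ^ (n - 1) ≤ (Λ / q + 2) ^ (n - 1) := pow_le_pow_left₀ (by positivity) (by linarith) _
    have hn2 : (1 : ℝ) ≤ n * (n + 2) + 1 := by nlinarith
    have fin1 : 2 * n * M + q ≤ (2 * n + 1) * X → (#Q : ℝ) ≤
        (Λ / q + 2) ^ (n - 1) * (((n * (n + 2) + 1) * (600 * n + 400)) * X) := by
      intro h
      refine b1.trans (mul_le_mul hpow (h.trans ?_) (by positivity) (by positivity))
      refine mul_le_mul_of_nonneg_right ?_ hX0
      nlinarith
    rcases le_or_gt (q : ℝ) M with hc | hc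
    · exact fin1 (by nlinarith)
    by_cases hc2 : q * |δ - (∑ i, v i * r i) / N| < 130 * n
    · rw [if_pos hc2] at hX
      have : 0 ≤ q * |δ| := by positivity
      have : 0 ≤ M * (1 + ρ) := by positivity
      exact fin1 (by nlinarith)
    rw [if_neg hc2] at hX
    have hsa : |s| = q * |δ - (∑ i, v i * r i) / N| := by rw [hs, abs_mul, abs_of_pos hq0]
    rw [← hsa, not_lt] at hc2
    set σ : ℝ := ∑ i, v i * j p0 i with hσ
    have hσs : |σ + s| ≤ n * 65 := by
      have : σ + s = ∑ i, v i * ((j p0 i : ℝ) + q * y i) := by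
        rw [hσ, hsy, Finset.mul_sum, ← Finset.sum_add_distrib]
        exact Finset.sum_congr rfl fun i _ => by ring
      rw [this]
      exact abs_dot_le hv (hj2 p0 hp0)
    have hσ2 : |s| ≤ 2 * |σ| := by
      have : |s| ≤ |σ + s| + |σ| := by
        have := abs_sub (σ + s) σ
        rwa [add_sub_cancel_left] at this
      linarith
    have hs0 : 0 < |s| := by linarith
    have hσ0 : 0 < |σ| := by linarith
    have hvr : |q * ((∑ i, v i * r i) / N)| ≤ 64 * (n * ρ) := by
      rw [mul_div_left_comm, abs_mul, abs_of_nonneg (by positivity : (0 : ℝ) ≤ q / N), mul_comm]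
      exact mul_le_mul hqN2 (abs_dot_le hv hr) (abs_nonneg _) (by norm_num)
    have hqδ : q * |δ| ≤ |s| + 64 * (n * ρ) := by
      have e : q * δ = s + q * ((∑ i, v i * r i) / N) := by rw [hs]; ring
      rw [show (q : ℝ) * |δ| = |q * δ| by rw [abs_mul, abs_of_pos hq0], e]
      exact (abs_add_le _ _).trans (by linarith)
    set B : ℕ := ⌈q * |δ| + 64 * ρ + 65⌉₊ with hB
    have hBle : (B : ℝ) ≤ q * |δ| + 64 * ρ + 66 := by
      have := Nat.ceil_lt_add_one (by positivity : 0 ≤ q * |δ| + 64 * ρ + 65)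
      linarith
    have hB' := b2 B (by rw [hB, Nat.one_le_ceil_iff]; positivity) hc.le (fun i => by
      have e1 := hj2 p0 hp0 i
      have e2 : |q * y i| ≤ q * |δ| + 64 * ρ := by
        have : q * y i = q * (v i * δ) - q / N * r i := by simp only [hy]; ring
        rw [this]
        refine (abs_sub _ _).trans (add_le_add ?_ ?_)
        · rw [abs_mul, abs_of_pos hq0, abs_mul]
          exact mul_le_mul_of_nonneg_left (mul_le_of_le_one_left (abs_nonneg _) (abs_le_one_of_sum_sq hv i)) hq0.le
        · rw [abs_mul, abs_of_nonneg (by positivity : (0 : ℝ) ≤ q / N)]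
          exact mul_le_mul hqN2 (hr i) (abs_nonneg _) (by norm_num)
      have e3 : |(j p0 i : ℝ)| ≤ q * |δ| + 64 * ρ + 65 := by
        have := abs_le.1 e1
        have := abs_le.1 e2
        rw [abs_le]; constructor <;> linarith
      have e4 := e3.trans (Nat.le_ceil _)
      exact_mod_cast e4) (abs_pos.1 hσ0)
    have key : (B : ℝ) * (2 * M / |σ| + 1) ≤ (600 * n + 400) * X := by
      rw [hX, add_zero]
      exact block_bound hn1 hM hρ hs0 hσ0 hσ2 (by linarith) (Nat.cast_nonneg B) (by positivity) hBle hqδ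
    calc (#Q : ℝ) ≤ B * (Λ / q + 2) ^ (n - 1) * (n * (n + 2) + 1) * (2 * M / |σ| + 1) := hB'
      _ = (Λ / q + 2) ^ (n - 1) * ((n * (n + 2) + 1) * (B * (2 * M / |σ| + 1))) := by ring
      _ ≤ (Λ / q + 2) ^ (n - 1) * ((n * (n + 2) + 1) * ((600 * n + 400) * X)) := by gcongr
      _ = _ := by ring
  calc (#P : ℝ) = ∑ g ∈ P.image j, (#{p ∈ P | j p = g} : ℝ) := by
        rw [Finset.card_eq_sum_card_image j P]; push_cast; rfl
    _ ≤ ∑ g ∈ P.image j, _ := Finset.sum_le_sum hfib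
    _ = #(P.image j) * _ := by rw [Finset.sum_const, nsmul_eq_mul]
    _ ≤ _ := mul_le_mul_of_nonneg_right himg (by positivity)

lemma measurable_nd : Measurable nd := by
  have : nd = fun θ : ℝ => |θ - ((⌊θ + 1 / 2⌋ : ℤ) : ℝ)| := by
    funext θ; rw [nd, round_eq]
  rw [this]
  have h1 : Measurable fun θ : ℝ => ((⌊θ + 1 / 2⌋ : ℤ) : ℝ) :=
    (measurable_from_top (f := fun k : ℤ => (k : ℝ))).comp (Int.measurable_floor.comp (measurable_id.add_const _))
  exact (measurable_id.sub h1).abs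

lemma measurable_Pm (N : ℕ) : Measurable (Pm N) := by
  unfold Pm
  exact measurable_const.div ((measurable_const.add (measurable_const.mul measurable_nd)).pow_const 3)

lemma integrable_prod_Pm {n : ℕ} (N : ℕ) (ν : Measure ℝ) [IsProbabilityMeasure ν] (θ v : Fin n → ℝ) :
    Integrable (fun y => ∏ i, Pm N (θ i + v i * y)) ν := by
  refine Integrable.of_bound (C := (N : ℝ) ^ n) ?_ (Filter.Eventually.of_forall fun y => ?_)
  · refine (Finset.measurable_prod univ fun i _ => ?_).aestronglyMeasurable
    exact (measurable_Pm N).comp (measurable_const.add (measurable_const.mul measurable_id))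
  · rw [Real.norm_of_nonneg (Finset.prod_nonneg fun _ _ => Pm_nonneg _ _)]
    refine (Finset.prod_le_prod (fun _ _ => Pm_nonneg _ _) fun i _ => Pm_le N _).trans ?_
    rw [Finset.prod_const, card_univ, Fintype.card_fin]

/-- Law of the auxiliary shift that decouples a Gaussian strip cutoff of width `M`. -/
noncomputable def shiftLaw (M : ℝ) : Measure ℝ :=
  ProbabilityTheory.gaussianReal 0 (Real.toNNReal (1 / (π ^ 2 * M ^ 2)))

instance (M : ℝ) : IsProbabilityMeasure (shiftLaw M) := by
  unfold shiftLaw; infer_instance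

lemma integral_ee_shiftLaw {M : ℝ} (hM : 0 < M) (τ : ℝ) :
    ∫ y, ee (y * τ) ∂shiftLaw M = (Real.exp (-(2 * τ ^ 2 / M ^ 2)) : ℂ) := by
  have h := ProbabilityTheory.charFun_gaussianReal (μ := 0) (v := Real.toNNReal (1 / (π ^ 2 * M ^ 2))) (2 * π * τ)
  rw [charFun_apply_real] at h
  have e : ∀ y : ℝ, ee (y * τ) = Complex.exp (((2 * π * τ : ℝ) : ℂ) * y * Complex.I) := by
    intro y; rw [ee]; congr 1; push_cast; ring
  simp_rw [e]
  rw [shiftLaw, h, Complex.ofReal_exp, Real.coe_toNNReal _ (by positivity)]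
  congr 1
  have hM' : (M : ℂ) ≠ 0 := by exact_mod_cast hM.ne'
  have hpi : (π : ℂ) ≠ 0 := by exact_mod_cast Real.pi_ne_zero
  push_cast
  field_simp
  ring

lemma shiftVar_ne_zero {M : ℝ} (hM : 0 < M) : Real.toNNReal (1 / (π ^ 2 * M ^ 2)) ≠ 0 := by
  rw [← pos_iff_ne_zero, Real.toNNReal_pos]; positivity

lemma shiftLaw_ball_le {M : ℝ} (hM : 0 < M) (c : ℝ) {ℓ : ℝ} (hℓ : 0 ≤ ℓ) :
    (shiftLaw M).real (Metric.ball c ℓ) ≤ 4 * M * ℓ := by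
  have hp : ∀ x, ProbabilityTheory.gaussianPDF 0 (Real.toNNReal (1 / (π ^ 2 * M ^ 2))) x ≤ ENNReal.ofReal (2 * M) := by
    intro x
    refine ENNReal.ofReal_le_ofReal ?_
    rw [ProbabilityTheory.gaussianPDFReal, Real.coe_toNNReal _ (by positivity)]
    have h1 : Real.exp (-(x - 0) ^ 2 / (2 * (1 / (π ^ 2 * M ^ 2)))) ≤ 1 := by
      rw [Real.exp_le_one_iff, neg_div, neg_nonpos]; positivity
    have h2 : 1 / (2 * M) ≤ √(2 * π * (1 / (π ^ 2 * M ^ 2))) := by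
      refine Real.le_sqrt_of_sq_le ?_
      have : 2 * π * (1 / (π ^ 2 * M ^ 2)) = 2 / (π * M ^ 2) := by field_simp
      rw [this, div_pow, mul_pow, div_le_div_iff₀ (by positivity) (by positivity)]
      have := Real.pi_le_four
      nlinarith [sq_nonneg M]
    calc (√(2 * π * (1 / (π ^ 2 * M ^ 2))))⁻¹ * Real.exp (-(x - 0) ^ 2 / (2 * (1 / (π ^ 2 * M ^ 2)))) ≤
          (1 / (2 * M))⁻¹ * 1 := by gcongr
      _ = 2 * M := by simp
  rw [Measure.real, shiftLaw, ProbabilityTheory.gaussianReal_apply _ (shiftVar_ne_zero hM)]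
  refine ENNReal.toReal_le_of_le_ofReal (by positivity) ?_
  refine (lintegral_mono hp).trans ?_
  rw [setLIntegral_const, Real.volume_ball, ← ENNReal.ofReal_mul (by positivity)]
  exact ENNReal.ofReal_le_ofReal (by linarith)

lemma integral_abs_shiftLaw {M : ℝ} (hM : 0 < M) :
    Integrable (fun y : ℝ => |y|) (shiftLaw M) ∧ ∫ y, |y| ∂shiftLaw M ≤ 1 / M := by
  have hm : MemLp (id : ℝ → ℝ) 2 (shiftLaw M) := ProbabilityTheory.memLp_id_gaussianReal 2
  have hi : Integrable (fun y : ℝ => |y|) (shiftLaw M) := (hm.integrable (by norm_num)).abs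
  have hs : Integrable (fun y : ℝ => y ^ 2) (shiftLaw M) := hm.integrable_sq
  have hv : ∫ y, y ^ 2 ∂shiftLaw M = 1 / (π ^ 2 * M ^ 2) := by
    have h1 := ProbabilityTheory.variance_id_gaussianReal (μ := 0) (v := Real.toNNReal (1 / (π ^ 2 * M ^ 2)))
    rw [ProbabilityTheory.variance_of_integral_eq_zero aemeasurable_id
      (by simp), Real.coe_toNNReal _ (by positivity)] at h1
    exact h1
  refine ⟨hi, ?_⟩
  calc ∫ y, |y| ∂shiftLaw M ≤ ∫ y, (M / 2 * y ^ 2 + 1 / (2 * M)) ∂shiftLaw M := by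
        refine integral_mono hi ((hs.const_mul _).add (integrable_const _)) fun y => ?_
        have : 0 ≤ (M * |y| - 1) ^ 2 / (2 * M) := by positivity
        have e : (M * |y| - 1) ^ 2 / (2 * M) = M / 2 * y ^ 2 + 1 / (2 * M) - |y| := by
          field_simp; rw [← sq_abs y]; ring
        dsimp only; linarith
    _ = M / 2 * (1 / (π ^ 2 * M ^ 2)) + 1 / (2 * M) := by
        rw [integral_add (hs.const_mul _) (integrable_const _), integral_const_mul, hv]; simp
    _ ≤ 1 / M := by
        have h2 : M / 2 * (1 / (π ^ 2 * M ^ 2)) ≤ 1 / (2 * M) := by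
          have : M / 2 * (1 / (π ^ 2 * M ^ 2)) = 1 / (2 * M * π ^ 2) := by field_simp
          rw [this]
          refine one_div_le_one_div_of_le (by positivity) (le_mul_of_one_le_right (by positivity) ?_)
          nlinarith [Real.pi_gt_three]
        have : 1 / (2 * M) + 1 / (2 * M) = 1 / M := by field_simp; norm_num
        linarith

/-- Smooth cutoff to a strip of width `M` inside a cube. -/
noncomputable def sw {n : ℕ} (c : Fin n → ℤ) (N : ℕ) (v : Fin n → ℝ) (A M : ℝ) (ξ : Fin n → ℤ) : ℝ :=
  bw c N ξ * Real.exp (-(((∑ i, v i * ξ i) - A) ^ 2 / M ^ 2))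

/-- Majorant for the square of the Schrödinger kernel of a strip. -/
noncomputable def kS {n : ℕ} (v : Fin n → ℝ) (N : ℕ) (M t : ℝ) : ℝ :=
  20000 ^ n * ∑ h ∈ Fintype.piFinset fun _ : Fin n => Icc (-((16 * N : ℕ) : ℤ)) (16 * N : ℕ),
    Real.exp (-((∑ i, v i * h i) ^ 2 / (8 * M ^ 2))) * ∫ y, ∏ i, Pm N (t * h i + v i * y) ∂shiftLaw M

lemma integral_prod_Pm_nonneg {n : ℕ} (N : ℕ) (ν : Measure ℝ) (θ v : Fin n → ℝ) :
    0 ≤ ∫ y, ∏ i, Pm N (θ i + v i * y) ∂ν :=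
  integral_nonneg fun _ => Finset.prod_nonneg fun _ _ => Pm_nonneg _ _

lemma kS_nonneg {n : ℕ} (v : Fin n → ℝ) (N : ℕ) (M t : ℝ) : 0 ≤ kS v N M t :=
  mul_nonneg (by positivity) (Finset.sum_nonneg fun _ _ =>
    mul_nonneg (Real.exp_pos _).le (integral_prod_Pm_nonneg _ _ _ _))

lemma sw_sum_le {n N : ℕ} (hN : 1 ≤ N) (c h : Fin n → ℤ) (v : Fin n → ℝ) (A : ℝ) {M : ℝ} (hM : 0 < M)
    (θ : Fin n → ℝ) :
    ‖∑ ξ ∈ cube c N, ((sw c N v A M ξ * sw c N v A M (ξ + h) : ℝ) : ℂ) * ee (∑ i, (ξ i : ℝ) * θ i)‖ ≤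
      Real.exp (-((∑ i, v i * h i) ^ 2 / (2 * M ^ 2))) *
        ∫ y, ∏ i, (20000 * Pm N (θ i + v i * y)) ∂shiftLaw M := by
  set η : ℝ := ∑ i, v i * h i with hη
  have h1 : ∀ ξ : Fin n → ℤ, ((sw c N v A M ξ * sw c N v A M (ξ + h) : ℝ) : ℂ) =
      (Real.exp (-(η ^ 2 / (2 * M ^ 2))) : ℂ) * ∫ y, ((bw c N ξ * bw c N (ξ + h) : ℝ) : ℂ) *
        ee (y * ((∑ i, v i * ξ i) - A + η / 2)) ∂shiftLaw M := by
    intro ξ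
    rw [integral_const_mul, integral_ee_shiftLaw hM, ← Complex.ofReal_mul, ← Complex.ofReal_mul, mul_left_comm,
      ← Real.exp_add]
    have e : (∑ i, v i * ((ξ + h) i : ℤ)) = (∑ i, v i * ξ i) + η := by
      rw [hη, ← Finset.sum_add_distrib]
      refine Finset.sum_congr rfl fun i _ => ?_
      rw [Pi.add_apply]; push_cast; ring
    rw [sw, sw, e, mul_mul_mul_comm, ← Real.exp_add]
    congr 3
    field_simp
    ring
  have h2 : ∀ ξ : Fin n → ℤ, Integrable (fun y : ℝ => ((bw c N ξ * bw c N (ξ + h) : ℝ) : ℂ) *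
      ee (y * ((∑ i, v i * ξ i) - A + η / 2)) * ee (∑ i, (ξ i : ℝ) * θ i)) (shiftLaw M) := by
    intro ξ
    refine Integrable.mul_const (Integrable.const_mul ?_ _) _
    refine Integrable.of_bound (C := 1) ?_ (Filter.Eventually.of_forall fun y => (norm_ee _).le)
    unfold ee
    fun_prop
  have h3 : ∑ ξ ∈ cube c N, ((sw c N v A M ξ * sw c N v A M (ξ + h) : ℝ) : ℂ) * ee (∑ i, (ξ i : ℝ) * θ i) =
      (Real.exp (-(η ^ 2 / (2 * M ^ 2))) : ℂ) * ∫ y, ee (y * (-A + η / 2)) *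
        ∑ ξ ∈ cube c N, ((bw c N ξ * bw c N (ξ + h) : ℝ) : ℂ) * ee (∑ i, (ξ i : ℝ) * (θ i + v i * y)) ∂shiftLaw M := by
    simp_rw [h1, mul_assoc (Complex.ofReal (Real.exp _)), ← integral_mul_const]
    rw [← Finset.mul_sum, ← integral_finsetSum _ fun ξ _ => h2 ξ]
    congr 1
    refine integral_congr_ae (Filter.Eventually.of_forall fun y => ?_)
    dsimp only
    rw [Finset.mul_sum]
    refine Finset.sum_congr rfl fun ξ _ => ?_
    have : y * ((∑ i, v i * ξ i) - A + η / 2) + ∑ i, (ξ i : ℝ) * θ i =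
        y * (-A + η / 2) + ∑ i, (ξ i : ℝ) * (θ i + v i * y) := by
      simp_rw [mul_add, Finset.sum_add_distrib, mul_sub, Finset.mul_sum]
      have : ∑ i, y * (v i * (ξ i : ℝ)) = ∑ i, (ξ i : ℝ) * (v i * y) :=
        Finset.sum_congr rfl fun i _ => by ring
      rw [this]; ring
    rw [mul_assoc, ← ee_add, this, ee_add]
    ring
  rw [h3, norm_mul, Complex.norm_real, Real.norm_of_nonneg (Real.exp_pos _).le]
  refine mul_le_mul_of_nonneg_left ?_ (Real.exp_pos _).le
  refine norm_integral_le_of_norm_le ?_ (Filter.Eventually.of_forall fun y => ?_)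
  · simp_rw [Finset.prod_mul_distrib]
    exact (integrable_prod_Pm N _ θ v).const_mul _
  · rw [norm_mul, norm_ee, one_mul]
    exact bw_sum_le hN c h _

lemma strip_kernel_sq_le {n N : ℕ} (hN : 1 ≤ N) (c : Fin n → ℤ) (v : Fin n → ℝ) (A : ℝ) {M : ℝ} (hM : 0 < M)
    (t : ℝ) (x : Fin n → ℝ) :
    ‖∑ ξ ∈ cube c N, (sw c N v A M ξ : ℂ) * ee (∑ i, (x i * ξ i + t * (ξ i : ℝ) ^ 2))‖ ^ 2 ≤ kS v N M t := by
  classical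
  refine (weyl_diff (cube c N) (dbox n N) (sw c N v A M) (fun ξ h => by rw [sw, bw_eq_zero hN h, zero_mul])
    (fun ξ h1 η h2 => sub_mem_dbox h1 h2) t x).trans ?_
  refine (Finset.sum_le_sum fun h _ => sw_sum_le hN c h v A hM fun i => 2 * t * h i).trans ?_
  simp_rw [Finset.prod_mul_distrib, Finset.prod_const, card_univ, Fintype.card_fin, integral_const_mul]
  set f : (Fin n → ℤ) → ℝ := fun h => Real.exp (-((∑ i, v i * h i) ^ 2 / (8 * M ^ 2))) *
    ∫ y, ∏ i, Pm N (t * h i + v i * y) ∂shiftLaw M with hf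
  have hinj : Function.Injective fun (h : Fin n → ℤ) (i : Fin n) => 2 * h i := by
    intro x y e; funext i; simpa using congrFun e i
  have e : ∀ h : Fin n → ℤ, Real.exp (-((∑ i, v i * h i) ^ 2 / (2 * M ^ 2))) *
      (20000 ^ n * ∫ y, ∏ i, Pm N (2 * t * h i + v i * y) ∂shiftLaw M) = 20000 ^ n * f fun i => 2 * h i := by
    intro h
    simp only [hf]
    have e1 : ∑ i, v i * ((2 * h i : ℤ) : ℝ) = 2 * ∑ i, v i * h i := by
      rw [Finset.mul_sum]; exact Finset.sum_congr rfl fun i _ => by push_cast; ring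
    have e2 : ∀ i, t * ((2 * h i : ℤ) : ℝ) = 2 * t * h i := fun i => by push_cast; ring
    simp_rw [e1, e2]
    have e3 : (2 * ∑ i, v i * h i) ^ 2 / (8 * M ^ 2) = (∑ i, v i * h i) ^ 2 / (2 * M ^ 2) := by
      field_simp; ring
    rw [e3]; ring
  simp_rw [e]
  rw [← Finset.mul_sum, kS]
  refine mul_le_mul_of_nonneg_left ?_ (by positivity)
  rw [← Finset.sum_image (f := f) (hinj.injOn)]
  refine Finset.sum_le_sum_of_subset_of_nonneg (fun m hm => ?_) fun m _ _ =>
    mul_nonneg (Real.exp_pos _).le (integral_prod_Pm_nonneg _ _ _ _)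
  obtain ⟨a, ha, rfl⟩ := mem_image.1 hm
  simp only [dbox, Fintype.mem_piFinset, mem_Icc] at ha ⊢
  intro i
  have := ha i
  push_cast at *
  omega

lemma sum_range_inv_sq_le (U : ℕ) : ∑ u ∈ range U, 1 / ((1 : ℝ) + u) ^ 2 ≤ 2 := by
  have h := sum_inv_one_add_sq one_pos U
  simp only [one_mul, div_one] at h
  calc ∑ u ∈ range U, 1 / ((1 : ℝ) + u) ^ 2 ≤ ∑ u ∈ range (U + 1), 1 / ((1 : ℝ) + u) ^ 2 :=
        Finset.sum_le_sum_of_subset_of_nonneg (Finset.range_mono (Nat.le_succ U)) fun _ _ _ => by positivity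
    _ ≤ 2 := by
      rw [Finset.sum_range_succ']
      norm_num only [Nat.cast_zero, add_zero, one_pow, div_one]
      linarith

lemma sum_Icc_inv_sq_le (N : ℕ) : ∑ r ∈ Icc (-(N : ℤ)) N, 1 / (1 + |(r : ℝ)|) ^ 2 ≤ 4 := by
  have e : ∀ r : ℤ, 1 / (1 + |(r : ℝ)|) ^ 2 = (fun k : ℕ => 1 / ((1 : ℝ) + k) ^ 2) r.natAbs := by
    intro r; simp only [Nat.cast_natAbs, Int.cast_abs]
  have h := sum_inv_one_add_sq one_pos N
  simp only [one_mul, div_one] at h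
  simp_rw [e]
  rw [sum_Icc_natAbs (fun k : ℕ => 1 / ((1 : ℝ) + k) ^ 2) N]
  norm_num only [Nat.cast_zero, add_zero, one_pow, div_one]
  linarith

open Classical in
lemma Pm_le_sum {N : ℕ} (hN : 1 ≤ N) (θ : ℝ) : Pm N θ ≤ ∑ r ∈ Icc (-(N : ℤ)) N,
    if ∃ k : ℤ, |θ - r / N - k| ≤ 1 / N then 8 * (N : ℝ) * (1 / (1 + |(r : ℝ)|) ^ 3) else 0 := by
  classical
  have hN0 : (0 : ℝ) < N := by exact_mod_cast hN
  have hN1 : (1 : ℝ) ≤ N := by exact_mod_cast hN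
  set f : ℝ := θ - round θ with hf
  set r : ℤ := round (N * f) with hr
  have h1 : |N * f - r| ≤ 1 / 2 := abs_sub_round _
  have h2 : |f| ≤ 1 / 2 := abs_sub_round θ
  have h3 : |(r : ℝ)| ≤ N * |f| + 1 / 2 := by
    have := abs_sub_abs_le_abs_sub (r : ℝ) (N * f)
    rw [abs_sub_comm, abs_mul, abs_of_pos hN0] at this
    linarith
  have hrN : r ∈ Icc (-(N : ℤ)) N := by
    rw [mem_Icc, ← abs_le]
    have : |(r : ℝ)| ≤ N := by nlinarith
    exact_mod_cast this
  have hc : ∃ k : ℤ, |θ - r / N - k| ≤ 1 / N := by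
    refine ⟨round θ, ?_⟩
    have : θ - r / N - round θ = (N * f - r) / N := by rw [hf]; field_simp; ring
    rw [this, abs_div, abs_of_pos hN0]
    gcongr
    linarith
  refine le_trans ?_ (Finset.single_le_sum (fun r _ => by split_ifs <;> positivity) hrN)
  rw [if_pos hc, Pm]
  have hnd : nd θ = |f| := rfl
  rw [hnd]
  have h4 : (1 + |(r : ℝ)|) ≤ 2 * (1 + N * |f|) := by linarith [mul_nonneg hN0.le (abs_nonneg f)]
  have h5 : (1 + |(r : ℝ)|) ^ 3 ≤ 8 * (1 + N * |f|) ^ 3 := by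
    calc (1 + |(r : ℝ)|) ^ 3 ≤ (2 * (1 + N * |f|)) ^ 3 := pow_le_pow_left₀ (by positivity) h4 3
      _ = _ := by ring
  rw [mul_one_div, div_le_div_iff₀ (by positivity) (by positivity)]
  nlinarith

lemma exp_le_sum {M : ℝ} (hM : 0 < M) {x : ℝ} {U : ℕ} (hU : |x| < U * M) :
    Real.exp (-(x ^ 2 / (8 * M ^ 2))) ≤
      ∑ u ∈ range U, if |x| ≤ (u + 1) * M then 1024 * (1 / ((1 : ℝ) + u) ^ 3) else 0 := by
  set X : ℝ := |x| / M with hX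
  have hX0 : 0 ≤ X := by positivity
  have hxX : |x| = X * M := by rw [hX]; field_simp
  have h1 := Nat.floor_le hX0
  have h2 := Nat.lt_floor_add_one X
  set u := ⌊X⌋₊ with hu
  have hmem : u ∈ range U := by
    rw [mem_range, hu, Nat.floor_lt hX0, hX, div_lt_iff₀ hM]; exact hU
  refine le_trans ?_ (Finset.single_le_sum (fun r _ => by split_ifs <;> positivity) hmem)
  rw [if_pos (by rw [hxX]; exact mul_le_mul_of_nonneg_right h2.le hM.le)]
  have e : x ^ 2 / (8 * M ^ 2) = X ^ 2 / 8 := by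
    rw [← sq_abs x, hxX]; field_simp
  rw [e, Real.exp_neg, mul_one_div, inv_le_comm₀ (Real.exp_pos _) (by positivity), inv_div]
  have h3 : 1 + X ^ 2 / 8 + (X ^ 2 / 8) ^ 2 / 2 ≤ Real.exp (X ^ 2 / 8) := Real.quadratic_le_exp_of_nonneg (by positivity)
  have hu0 : (0 : ℝ) ≤ u := Nat.cast_nonneg u
  have h4 : (1 + (u : ℝ)) ^ 3 ≤ (1 + X) ^ 3 := pow_le_pow_left₀ (by positivity) (by linarith) 3
  rw [div_le_iff₀ (by norm_num)]
  have h5 : (1 + X) ^ 3 ≤ 8 + 8 * X ^ 4 := by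
    nlinarith [sq_nonneg (X - 1), sq_nonneg (X ^ 2 - X), sq_nonneg (X ^ 2 - 1), mul_nonneg hX0 (sq_nonneg (X - 1)), mul_nonneg hX0 hX0]
  nlinarith [sq_nonneg X]

lemma one_le_prod_one_add {ι : Type*} (s : Finset ι) {f : ι → ℝ} (hf : ∀ i, 0 ≤ f i) : 1 ≤ ∏ i ∈ s, (1 + f i) := by
  calc (1 : ℝ) = ∏ _i ∈ s, 1 := by rw [Finset.prod_const_one]
    _ ≤ _ := Finset.prod_le_prod (fun _ _ => zero_le_one) fun i _ => by linarith [hf i]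

open Classical in
lemma prod_Pm_le_sum {n N : ℕ} (hN : 1 ≤ N) (θ : Fin n → ℝ) :
    ∏ i, Pm N (θ i) ≤ ∑ r ∈ Fintype.piFinset fun _ : Fin n => Icc (-(N : ℤ)) N,
      if ∀ i, ∃ k : ℤ, |θ i - r i / N - k| ≤ 1 / N then (8 * (N : ℝ)) ^ n * ∏ i, 1 / (1 + |(r i : ℝ)|) ^ 3 else 0 := by
  classical
  refine (Finset.prod_le_prod (fun _ _ => Pm_nonneg _ _) fun i _ => Pm_le_sum hN (θ i)).trans ?_
  rw [Finset.prod_univ_sum]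
  refine Finset.sum_le_sum fun r _ => le_of_eq ?_
  by_cases h : ∀ i, ∃ k : ℤ, |θ i - r i / N - k| ≤ 1 / N
  · rw [if_pos h, Finset.prod_congr rfl fun i _ => if_pos (h i), Finset.prod_mul_distrib, Finset.prod_const, card_univ,
      Fintype.card_fin]
  · rw [if_neg h]
    obtain ⟨i, hi⟩ := not_forall.1 h
    exact Finset.prod_eq_zero (mem_univ i) (if_neg hi)

lemma sum_weight_le {n : ℕ} (N : ℕ) {f : ℤ → ℝ} (h0 : ∀ r, 0 ≤ f r) (hf : ∀ r, f r ≤ 1 / (1 + |(r : ℝ)|) ^ 2) :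
    ∑ r ∈ Fintype.piFinset (fun _ : Fin n => Icc (-(N : ℤ)) N), ∏ i, f (r i) ≤ 4 ^ n := by
  rw [← Finset.prod_univ_sum (fun _ : Fin n => Icc (-(N : ℤ)) N) (fun _ => f), Finset.prod_const, card_univ,
    Fintype.card_fin]
  exact pow_le_pow_left₀ (Finset.sum_nonneg fun _ _ => h0 _)
    ((Finset.sum_le_sum fun r _ => hf r).trans (sum_Icc_inv_sq_le N)) n

/-- Constant for the averages of the strip kernel. -/
noncomputable def stripConst (n : ℕ) : ℝ :=
  2048 * 8 ^ n * 131 ^ n * ((n * (n + 2) + 1) * (600 * n + 400))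

lemma stripConst_nonneg (n : ℕ) : 0 ≤ stripConst n := by unfold stripConst; positivity

lemma strip_pointwise {n : ℕ} {v : Fin n → ℝ} (hv : ∑ i, v i ^ 2 = 1) {N q : ℕ} (hN : 1 ≤ N) (hq : 1 ≤ q)
    (hqN : q ≤ 64 * N) {β : ℝ} (hβ : |β| ≤ 1 / (64 * N * q)) {Λ M : ℝ} (hM : 1 ≤ M) (hΛ : 0 ≤ Λ)
    (hΛ' : ∀ x : ℝ, |x| ≤ 32 * N → |x| * (N * |β|) ≤ 2 → |x| ≤ Λ) (y : ℝ) :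
    ∑ a ∈ range q with a.Coprime q, ∑ h ∈ Fintype.piFinset fun _ : Fin n => Icc (-((16 * N : ℕ) : ℤ)) (16 * N : ℕ),
      Real.exp (-((∑ i, v i * h i) ^ 2 / (8 * M ^ 2))) * ∏ i, Pm N ((a / q + β) * h i + v i * y) ≤
    stripConst n * N ^ n * (Λ / q + 2) ^ (n - 1) * (4 ^ n * (2 * M + q * |y|) +
      ∑ r ∈ Fintype.piFinset fun _ : Fin n => Icc (-(N : ℤ)) N, (∏ i, 1 / (1 + |(r i : ℝ)|) ^ 3) *
        if q * |y - (∑ i, v i * r i) / N| < 130 * n then (q : ℝ) else 0) := by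
  classical
  have hM0 : 0 < M := by linarith
  set HB := Fintype.piFinset fun _ : Fin n => Icc (-((16 * N : ℕ) : ℤ)) (16 * N : ℕ) with hHB
  set RB := Fintype.piFinset fun _ : Fin n => Icc (-(N : ℤ)) N with hRB
  set CQ := {a ∈ range q | a.Coprime q} with hCQ
  have hHB1 : ∀ h ∈ HB, ∀ i, |(h i : ℝ)| ≤ 16 * N := by
    intro h hh i
    have := Fintype.mem_piFinset.1 hh i
    rw [mem_Icc, ← abs_le] at this
    exact_mod_cast this
  set U : ℕ := n * (16 * N) + 1 with hU
  have hHB2 : ∀ h ∈ HB, |∑ i, v i * (h i : ℝ)| < U * M := by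
    intro h hh
    have h1 := abs_dot_le hv (hHB1 h hh)
    have h2 : (n * (16 * N) : ℝ) < U := by rw [hU]; push_cast; linarith
    exact (h1.trans_lt h2).trans_le (le_mul_of_one_le_right (by positivity) hM)
  set W : (Fin n → ℤ) → ℝ := fun r => ∏ i, 1 / (1 + |(r i : ℝ)|) ^ 3 with hW
  have hW0 : ∀ r, 0 ≤ W r := fun r => Finset.prod_nonneg fun _ _ => by positivity
  set cnd : ℕ → (Fin n → ℤ) → ℕ × (Fin n → ℤ) → Prop := fun u r p => |∑ i, v i * (p.2 i : ℝ)| ≤ (u + 1) * M ∧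
    ∀ i, ∃ k : ℤ, |(p.1 / q + β) * p.2 i + v i * y - r i / N - k| ≤ 1 / N with hcnd
  set K : ℝ := 131 ^ n * ((Λ / q + 2) ^ (n - 1) * ((n * (n + 2) + 1) * (600 * n + 400))) with hK
  have hK0 : 0 ≤ K := by positivity
  set I : (Fin n → ℤ) → ℝ := fun r => if q * |y - (∑ i, v i * r i) / N| < 130 * n then (q : ℝ) else 0 with hI
  have hI0 : ∀ r, 0 ≤ I r := fun r => by simp only [hI]; split_ifs <;> positivity
  have hterm : ∀ a ∈ CQ, ∀ h ∈ HB, Real.exp (-((∑ i, v i * h i) ^ 2 / (8 * M ^ 2))) *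
      ∏ i, Pm N ((a / q + β) * h i + v i * y) ≤ ∑ u ∈ range U, ∑ r ∈ RB,
        1024 * (1 / ((1 : ℝ) + u) ^ 3) * ((8 * (N : ℝ)) ^ n * W r) * if cnd u r (a, h) then (1 : ℝ) else 0 := by
    intro a _ h hh
    refine (mul_le_mul (exp_le_sum hM0 (hHB2 h hh)) (prod_Pm_le_sum hN fun i => (a / q + β) * h i + v i * y)
      (Finset.prod_nonneg fun _ _ => Pm_nonneg _ _)
      (Finset.sum_nonneg fun _ _ => by split_ifs <;> positivity)).trans (le_of_eq ?_)
    rw [Finset.sum_mul_sum]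
    refine Finset.sum_congr rfl fun u _ => Finset.sum_congr rfl fun r _ => ?_
    simp only [hcnd, hW]
    rw [ite_and]
    split_ifs <;> simp
  have hcount : ∀ u : ℕ, ∀ r ∈ RB, (#{p ∈ CQ ×ˢ HB | cnd u r p} : ℝ) ≤
      K * ((u + 1) * (2 * M * (∏ i, (1 + |(r i : ℝ)|)) + q * |y| + I r)) := by
    intro u r _
    have hu1 : (1 : ℝ) ≤ u + 1 := by linarith [(Nat.cast_nonneg u : (0 : ℝ) ≤ u)]
    have hρ1 : 1 ≤ ∏ i, (1 + |(r i : ℝ)|) := one_le_prod_one_add _ fun _ => abs_nonneg _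
    have hρ : ∀ i, |(r i : ℝ)| ≤ ∏ i, (1 + |(r i : ℝ)|) := by
      intro i
      have h1 : 1 + |(r i : ℝ)| ≤ ∏ i, (1 + |(r i : ℝ)|) := by
        rw [← Finset.mul_prod_erase univ _ (mem_univ i)]
        exact le_mul_of_one_le_right (by positivity)
          (one_le_prod_one_add _ fun _ => abs_nonneg _)
      linarith
    refine (strip_pairs_le hv hN hq hqN hβ (M := (u + 1) * M) (by nlinarith) hΛ (by linarith) hΛ' r hρ _
      ?_ ?_ ?_ ?_ (δ := y)).trans ?_
    · intro p hp
      rw [mem_filter, mem_product, hCQ, mem_filter, mem_range] at hp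
      exact hp.1.1
    · intro p hp
      rw [mem_filter, mem_product] at hp
      exact hHB1 _ hp.1.2
    · exact fun p hp => (mem_filter.1 hp).2.1
    · exact fun p hp => (mem_filter.1 hp).2.2
    · have h1 : M * (1 + ∏ i, (1 + |(r i : ℝ)|)) ≤ 2 * M * ∏ i, (1 + |(r i : ℝ)|) := by nlinarith
      have h2 : 0 ≤ q * |y| := by positivity
      have h3 := hI0 r
      rw [← mul_assoc, ← mul_assoc, hK]
      have h4 : (u + 1) * M * (1 + ∏ i, (1 + |(r i : ℝ)|)) + q * |y| + I r ≤
          (u + 1) * (2 * M * (∏ i, (1 + |(r i : ℝ)|)) + q * |y| + I r) := by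
        nlinarith [mul_le_mul_of_nonneg_left h1 (by linarith : (0 : ℝ) ≤ u + 1)]
      refine le_trans (le_of_eq ?_) (mul_le_mul_of_nonneg_left h4 (show 0 ≤ 131 ^ n *
        ((Λ / q + 2) ^ (n - 1) * ((n * (n + 2) + 1) * (600 * n + 400))) by positivity))
      simp only [hI]
      ring
  calc _ ≤ ∑ a ∈ CQ, ∑ h ∈ HB, ∑ u ∈ range U, ∑ r ∈ RB,
        1024 * (1 / ((1 : ℝ) + u) ^ 3) * ((8 * (N : ℝ)) ^ n * W r) * (if cnd u r (a, h) then (1 : ℝ) else 0) :=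
      Finset.sum_le_sum fun a ha => Finset.sum_le_sum fun h hh => hterm a ha h hh
    _ = ∑ p ∈ CQ ×ˢ HB, ∑ u ∈ range U, ∑ r ∈ RB,
        1024 * (1 / ((1 : ℝ) + u) ^ 3) * ((8 * (N : ℝ)) ^ n * W r) * (if cnd u r p then (1 : ℝ) else 0) := by
      rw [Finset.sum_product]
    _ = ∑ u ∈ range U, ∑ r ∈ RB, 1024 * (1 / ((1 : ℝ) + u) ^ 3) * ((8 * (N : ℝ)) ^ n * W r) *
        #{p ∈ CQ ×ˢ HB | cnd u r p} := by
      rw [Finset.sum_comm]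
      refine Finset.sum_congr rfl fun u _ => ?_
      rw [Finset.sum_comm]
      refine Finset.sum_congr rfl fun r _ => ?_
      rw [← Finset.mul_sum, Finset.sum_boole]
    _ ≤ ∑ u ∈ range U, ∑ r ∈ RB, 1024 * (1 / ((1 : ℝ) + u) ^ 3) * ((8 * (N : ℝ)) ^ n * W r) *
        (K * ((u + 1) * (2 * M * (∏ i, (1 + |(r i : ℝ)|)) + q * |y| + I r))) := by
      refine Finset.sum_le_sum fun u _ => Finset.sum_le_sum fun r hr =>
        mul_le_mul_of_nonneg_left (hcount u r hr) ?_
      have := hW0 r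
      positivity
    _ = (∑ u ∈ range U, 1 / ((1 : ℝ) + u) ^ 2) * (1024 * (8 * (N : ℝ)) ^ n * K *
        ((∑ r ∈ RB, W r * ∏ i, (1 + |(r i : ℝ)|)) * (2 * M) + (∑ r ∈ RB, W r) * (q * |y|) + ∑ r ∈ RB, W r * I r)) := by
      have e : ∀ u : ℕ, ∑ r ∈ RB, 1024 * (1 / ((1 : ℝ) + u) ^ 3) * ((8 * (N : ℝ)) ^ n * W r) *
          (K * ((u + 1) * (2 * M * (∏ i, (1 + |(r i : ℝ)|)) + q * |y| + I r))) =
          1 / ((1 : ℝ) + u) ^ 2 * (1024 * (8 * (N : ℝ)) ^ n * K * ((∑ r ∈ RB, W r * ∏ i, (1 + |(r i : ℝ)|)) * (2 * M) +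
            (∑ r ∈ RB, W r) * (q * |y|) + ∑ r ∈ RB, W r * I r)) := by
        intro u
        rw [Finset.sum_mul, Finset.sum_mul, ← Finset.sum_add_distrib, ← Finset.sum_add_distrib, Finset.mul_sum,
          Finset.mul_sum]
        refine Finset.sum_congr rfl fun r _ => ?_
        have : (1 : ℝ) + u ≠ 0 := by positivity
        field_simp
        ring
      rw [Finset.sum_congr rfl fun u _ => e u, ← Finset.sum_mul]
    _ ≤ 2 * (1024 * (8 * (N : ℝ)) ^ n * K * (4 ^ n * (2 * M) + 4 ^ n * (q * |y|) + ∑ r ∈ RB, W r * I r)) := by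
      have h1 : ∑ r ∈ RB, W r * ∏ i, (1 + |(r i : ℝ)|) ≤ 4 ^ n := by
        have e : ∀ r : Fin n → ℤ, W r * ∏ i, (1 + |(r i : ℝ)|) = ∏ i, (fun m : ℤ => 1 / (1 + |(m : ℝ)|) ^ 2) (r i) := by
          intro r
          simp only [hW]
          rw [← Finset.prod_mul_distrib]
          refine Finset.prod_congr rfl fun i _ => ?_
          have : (1 + |(r i : ℝ)|) ≠ 0 := by positivity
          field_simp
        simp_rw [e]
        exact sum_weight_le N (fun _ => by positivity) fun _ => le_rfl
      have h2 : ∑ r ∈ RB, W r ≤ 4 ^ n := by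
        refine sum_weight_le N (f := fun m : ℤ => 1 / (1 + |(m : ℝ)|) ^ 3) (fun _ => by positivity) fun m => ?_
        refine one_div_le_one_div_of_le (by positivity) (pow_le_pow_right₀ ?_ (by norm_num))
        linarith [abs_nonneg (m : ℝ)]
      have h3 : 0 ≤ ∑ r ∈ RB, W r * I r := Finset.sum_nonneg fun r _ => mul_nonneg (hW0 r) (hI0 r)
      have h4 : 0 ≤ ∑ r ∈ RB, W r := Finset.sum_nonneg fun r _ => hW0 r
      have h5 : 0 ≤ ∑ r ∈ RB, W r * ∏ i, (1 + |(r i : ℝ)|) := Finset.sum_nonneg fun r _ =>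
        mul_nonneg (hW0 r) (Finset.prod_nonneg fun _ _ => by positivity)
      gcongr
      exact sum_range_inv_sq_le U
    _ = _ := by
      rw [hK, stripConst, mul_pow]; ring

lemma sum_kS_le {n : ℕ} {v : Fin n → ℝ} (hv : ∑ i, v i ^ 2 = 1) {N q : ℕ} (hN : 1 ≤ N) (hq : 1 ≤ q)
    (hqN : q ≤ 64 * N) {β : ℝ} (hβ : |β| ≤ 1 / (64 * N * q)) {Λ M : ℝ} (hM : 1 ≤ M) (hNM : (N : ℝ) ≤ M ^ 2) (hΛ : 0 ≤ Λ)
    (hΛ' : ∀ x : ℝ, |x| ≤ 32 * N → |x| * (N * |β|) ≤ 2 → |x| ≤ Λ) :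
    ∑ a ∈ range q with a.Coprime q, kS v N M (a / q + β) ≤
      20000 ^ n * (stripConst n * (4 ^ n * (66 + 520 * n))) * (N ^ n * M * (Λ / q + 2) ^ (n - 1)) := by
  have hM0 : 0 < M := by linarith
  have hq0 : (0 : ℝ) < q := by exact_mod_cast hq
  have hqN' : (q : ℝ) ≤ 64 * N := by exact_mod_cast hqN
  set HB := Fintype.piFinset fun _ : Fin n => Icc (-((16 * N : ℕ) : ℤ)) (16 * N : ℕ) with hHB
  set RB := Fintype.piFinset fun _ : Fin n => Icc (-(N : ℤ)) N with hRB
  set CQ := {a ∈ range q | a.Coprime q} with hCQ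
  set W : (Fin n → ℤ) → ℝ := fun r => ∏ i, 1 / (1 + |(r i : ℝ)|) ^ 3 with hW
  have hW0 : ∀ r, 0 ≤ W r := fun r => Finset.prod_nonneg fun _ _ => by positivity
  obtain ⟨hi1, hi2⟩ := integral_abs_shiftLaw hM0
  have hSC := stripConst_nonneg n
  set I : (Fin n → ℤ) → ℝ → ℝ := fun r y => if q * |y - (∑ i, v i * r i) / N| < 130 * n then (q : ℝ) else 0 with hI
  have hIeq : ∀ r, I r = (Metric.ball ((∑ i, v i * (r i : ℝ)) / N) (130 * n / q)).indicator fun _ => (q : ℝ) := by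
    intro r
    classical
    ext y
    rw [hI, Set.indicator_apply]
    simp only [Metric.mem_ball, Real.dist_eq, lt_div_iff₀ hq0, mul_comm]
  have hIint : ∀ r, Integrable (I r) (shiftLaw M) := fun r => by
    rw [hIeq r]
    exact (integrable_const _).indicator Metric.isOpen_ball.measurableSet
  have hIle : ∀ r, ∫ y, I r y ∂shiftLaw M ≤ 520 * n * M := by
    intro r
    rw [hIeq r, integral_indicator_const _ Metric.isOpen_ball.measurableSet, smul_eq_mul]
    refine (mul_le_mul_of_nonneg_right (shiftLaw_ball_le hM0 _ (by positivity)) hq0.le).trans (le_of_eq ?_)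
    field_simp
    ring
  have hint : ∀ a ∈ CQ, ∀ h ∈ HB, Integrable (fun y => Real.exp (-((∑ i, v i * h i) ^ 2 / (8 * M ^ 2))) *
      ∏ i, Pm N ((a / q + β) * h i + v i * y)) (shiftLaw M) := fun a _ h _ =>
    (integrable_prod_Pm N _ (fun i => (a / q + β) * h i) v).const_mul _
  have hW1 : ∑ r ∈ RB, W r ≤ 4 ^ n := by
    refine sum_weight_le N (f := fun m : ℤ => 1 / (1 + |(m : ℝ)|) ^ 3) (fun _ => by positivity) fun m => ?_
    refine one_div_le_one_div_of_le (by positivity) (pow_le_pow_right₀ ?_ (by norm_num))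
    linarith [abs_nonneg (m : ℝ)]
  have hsumI : Integrable (fun y => ∑ r ∈ RB, W r * I r y) (shiftLaw M) :=
    integrable_finsetSum _ fun r _ => (hIint r).const_mul _
  have hlin : Integrable (fun y : ℝ => 4 ^ n * (2 * M + q * |y|)) (shiftLaw M) :=
    ((integrable_const _).add (hi1.const_mul _)).const_mul _
  calc
    _ = 20000 ^ n * ∫ y, ∑ a ∈ CQ, ∑ h ∈ HB, Real.exp (-((∑ i, v i * h i) ^ 2 / (8 * M ^ 2))) *
        ∏ i, Pm N ((a / q + β) * h i + v i * y) ∂shiftLaw M := by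
      rw [integral_finsetSum _ (fun a ha => integrable_finsetSum _ fun h hh => hint a ha h hh), Finset.mul_sum]
      refine Finset.sum_congr rfl fun a ha => ?_
      rw [integral_finsetSum _ (fun h hh => hint a ha h hh), kS]
      congr 1
      refine Finset.sum_congr rfl fun h _ => ?_
      rw [integral_const_mul]
    _ ≤ 20000 ^ n * ∫ y, stripConst n * N ^ n * (Λ / q + 2) ^ (n - 1) * (4 ^ n * (2 * M + q * |y|) +
        ∑ r ∈ RB, W r * I r y) ∂shiftLaw M := by
      refine mul_le_mul_of_nonneg_left (integral_mono
        (integrable_finsetSum _ fun a ha => integrable_finsetSum _ fun h hh => hint a ha h hh)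
        ((hlin.add hsumI).const_mul _) fun y => ?_) (by positivity)
      exact strip_pointwise hv hN hq hqN hβ hM hΛ hΛ' y
    _ = 20000 ^ n * (stripConst n * N ^ n * (Λ / q + 2) ^ (n - 1) * (4 ^ n * (2 * M + q * ∫ y, |y| ∂shiftLaw M) +
        ∑ r ∈ RB, W r * ∫ y, I r y ∂shiftLaw M)) := by
      rw [integral_const_mul, integral_add hlin hsumI, integral_const_mul,
        integral_add (integrable_const _) (hi1.const_mul _), integral_const_mul,
        integral_finsetSum _ (fun r _ => (hIint r).const_mul _)]
      simp only [integral_const_mul, integral_const, probReal_univ, smul_eq_mul, one_mul]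
    _ ≤ 20000 ^ n * (stripConst n * N ^ n * (Λ / q + 2) ^ (n - 1) * (4 ^ n * (2 * M + 64 * M) +
        4 ^ n * (520 * n * M))) := by
      have h1 : q * ∫ y, |y| ∂shiftLaw M ≤ 64 * M := by
        refine (mul_le_mul_of_nonneg_left hi2 hq0.le).trans ?_
        rw [mul_one_div, div_le_iff₀ hM0]
        nlinarith
      have h2 : ∑ r ∈ RB, W r * ∫ y, I r y ∂shiftLaw M ≤ 4 ^ n * (520 * n * M) := by
        refine (Finset.sum_le_sum fun r _ => mul_le_mul_of_nonneg_left (hIle r) (hW0 r)).trans ?_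
        rw [← Finset.sum_mul]
        exact mul_le_mul_of_nonneg_right hW1 (by positivity)
      gcongr
    _ = _ := by ring

lemma one_sub_le_rpow_neg {r g : ℝ} (hr : 0 < r) (hg : 0 ≤ g) : 1 - g * (r - 1) ≤ r ^ (-g) := by
  rw [Real.rpow_def_of_pos hr]
  have h1 := Real.add_one_le_exp (Real.log r * -g)
  have h2 := Real.log_le_sub_one_of_pos hr
  nlinarith

lemma sum_one_add_rpow_neg_le {γ X : ℝ} (hγ : 1 < γ) (hX : 0 < X) (J : ℕ) :
    ∑ i ∈ range J, (1 + X * ((i + 1 : ℕ) : ℝ)) ^ (-γ) ≤ 1 / ((γ - 1) * X) := by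
  have hg : 0 < γ - 1 := by linarith
  have key : ∀ J : ℕ, (γ - 1) * X * ∑ i ∈ range J, (1 + X * ((i + 1 : ℕ) : ℝ)) ^ (-γ) ≤
      1 - (1 + X * (J : ℝ)) ^ (-(γ - 1)) := by
    intro J
    induction J with
    | zero => simp
    | succ J ih =>
      rw [Finset.sum_range_succ, mul_add]
      set u := 1 + X * (J : ℝ) with hu
      set w := 1 + X * ((J + 1 : ℕ) : ℝ) with hw
      have hwu : w = u + X := by rw [hu, hw]; push_cast; ring
      have hu0 : 0 < u := by positivity
      have hw0 : 0 < w := by positivity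
      have h1 := one_sub_le_rpow_neg (div_pos hu0 hw0) hg.le
      have h2 : u ^ (-(γ - 1)) = w ^ (-(γ - 1)) * (u / w) ^ (-(γ - 1)) := by
        rw [← Real.mul_rpow hw0.le (by positivity), mul_div_cancel₀ _ hw0.ne']
      have h3 : w ^ (-(γ - 1)) = w ^ (-γ) * w := by
        rw [← Real.rpow_add_one hw0.ne']; congr 1; ring
      have h4 : w ^ (-(γ - 1)) * (1 - (γ - 1) * (u / w - 1)) ≤ u ^ (-(γ - 1)) := by
        rw [h2]; exact mul_le_mul_of_nonneg_left h1 (by positivity)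
      have h5 : w ^ (-(γ - 1)) * (1 - (γ - 1) * (u / w - 1)) = w ^ (-(γ - 1)) + (γ - 1) * X * w ^ (-γ) := by
        rw [h3]
        field_simp
        rw [hwu]; ring
      linarith
  rw [le_div_iff₀ (by positivity), mul_comm]
  have := key J
  have h0 : 0 ≤ (1 + X * (J : ℝ)) ^ (-(γ - 1)) := by positivity
  linarith

lemma sum_rpow_sub_one_le {σ : ℝ} (h0 : 0 < σ) (h1 : σ ≤ 1) (Q : ℕ) :
    ∑ q ∈ Icc 1 Q, (q : ℝ) ^ (σ - 1) ≤ (Q : ℝ) ^ σ / σ := by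
  rw [le_div_iff₀ h0]
  induction Q with
  | zero => simp [Real.zero_rpow h0.ne']
  | succ Q ih =>
    rw [Finset.sum_Icc_succ_top (by omega), add_mul]
    set w : ℝ := ((Q + 1 : ℕ) : ℝ) with hw
    have hw0 : 0 < w := by positivity
    have hQ : (Q : ℝ) = w + -1 := by rw [hw]; push_cast; ring
    have h2 := rpow_one_add_le_one_add_mul_self (s := -1 / w) (by
      rw [le_div_iff₀ hw0, hw]; push_cast; linarith [(Nat.cast_nonneg Q : (0 : ℝ) ≤ Q)]) h0.le h1
    have h3 : (Q : ℝ) ^ σ = w ^ σ * (1 + -1 / w) ^ σ := by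
      rw [← Real.mul_rpow hw0.le]
      · congr 1; rw [hQ]; field_simp
      · have : 0 ≤ w * (1 + -1 / w) := by
          have : w * (1 + -1 / w) = Q := by rw [hQ]; field_simp
          rw [this]; positivity
        exact nonneg_of_mul_nonneg_right this hw0
    have h4 : w ^ σ = w ^ (σ - 1) * w := by rw [← Real.rpow_add_one hw0.ne']; congr 1; ring
    have h5 : w ^ σ * (1 + -1 / w) ^ σ ≤ w ^ σ * (1 + σ * (-1 / w)) := mul_le_mul_of_nonneg_left h2 (by positivity)
    have h6 : w ^ σ * (1 + σ * (-1 / w)) = w ^ σ - w ^ (σ - 1) * σ := by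
      rw [h4]; field_simp; ring
    linarith

lemma kS_add_intCast {n : ℕ} (v : Fin n → ℝ) (N : ℕ) (M t : ℝ) (k : ℤ) : kS v N M (t + k) = kS v N M t := by
  rw [kS, kS]
  congr 1
  refine Finset.sum_congr rfl fun h _ => ?_
  congr 2
  ext y
  refine Finset.prod_congr rfl fun i _ => ?_
  have : (t + k) * h i + v i * y = ((k * h i : ℤ) : ℝ) + (t * h i + v i * y) := by push_cast; ring
  rw [Pm, Pm, this, nd_int_mul_add]

/-- Counting the large values of a `1`-periodic function on a grid by means of rational approximation. -/
lemma card_large_grid_le {N T : ℕ} [NeZero T] (hN : 1 ≤ N) (hT : ∀ q, 1 ≤ q → q ≤ 64 * N → q ∣ T) (k : ℝ → ℝ)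
    (hk : ∀ t (m : ℤ), k (t + m) = k t) (thr : ℝ) :
    #{j : ZMod T | thr < k ((j.val : ℝ) / T)} ≤ ∑ q ∈ Icc 1 (64 * N),
      ∑ i ∈ Icc (-((T / (64 * N * q) : ℕ) : ℤ)) (T / (64 * N * q) : ℕ),
        #((range q).filter fun a : ℕ => a.Coprime q ∧ thr < k (a / q + i / T)) := by
  classical
  have hT0 : (0 : ℝ) < T := by exact_mod_cast Nat.pos_of_ne_zero (NeZero.ne T)
  have hN0 : (0 : ℝ) < N := by exact_mod_cast hN
  have hsub : ({j : ZMod T | thr < k ((j.val : ℝ) / T)} : Finset (ZMod T)) ⊆ (Icc 1 (64 * N)).biUnion fun q =>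
      (Icc (-((T / (64 * N * q) : ℕ) : ℤ)) (T / (64 * N * q) : ℕ)).biUnion fun i =>
        ((range q).filter fun a : ℕ => a.Coprime q ∧ thr < k (a / q + i / T)).image
          fun a : ℕ => (((a : ℤ) * (T / q : ℕ) + i : ℤ) : ZMod T) := by
    intro j hj
    rw [mem_filter] at hj
    obtain ⟨q, a, hq, hqN, hco, hβ⟩ := exists_dirichlet ((j.val : ℝ) / T) hN
    have hq0 : (0 : ℝ) < q := by exact_mod_cast hq
    obtain ⟨s, hs⟩ := hT q hq hqN
    have hTs : T / q = s := by rw [hs]; exact Nat.mul_div_cancel_left s (by omega)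
    set i : ℤ := (j.val : ℤ) - a * s with hi
    have hsT : (T : ℝ) = q * s := by exact_mod_cast hs
    have hs0 : (s : ℝ) ≠ 0 := by
      intro h; rw [h, mul_zero] at hsT; exact hT0.ne' hsT
    have hiβ : (i : ℝ) / T = (j.val : ℝ) / T - a / q := by
      rw [hi, hsT]; push_cast; field_simp
    have hle : i.natAbs ≤ T / (64 * N * q) := by
      rw [Nat.le_div_iff_mul_le (by positivity)]
      have : (i.natAbs : ℝ) * (64 * N * q) ≤ T := by
        rw [← hiβ, abs_div, abs_of_pos hT0, div_le_div_iff₀ hT0 (by positivity), one_mul] at hβ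
        rwa [Nat.cast_natAbs, Int.cast_abs]
      exact_mod_cast this
    have ha0 := Int.emod_nonneg a (show (q : ℤ) ≠ 0 by omega)
    have ha1 := Int.emod_lt_of_pos a (show (0 : ℤ) < q by omega)
    have hcast : ((a % q).toNat : ℤ) = a % q := Int.toNat_of_nonneg ha0
    simp only [mem_biUnion, mem_image, mem_filter, mem_range, mem_Icc]
    refine ⟨q, ⟨hq, hqN⟩, i, by omega, (a % q).toNat, ⟨by omega, ?_, ?_⟩, ?_⟩
    · rw [← Nat.isCoprime_iff_coprime, Int.toNat_of_nonneg ha0]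
      have : IsCoprime (a - q * (a / q)) (q : ℤ) := by
        have := IsCoprime.add_mul_left_left hco (-(a / q))
        rwa [mul_neg, ← sub_eq_add_neg] at this
      rwa [Int.emod_def]
    · have e : (j.val : ℝ) / T = (((a % q).toNat : ℕ) : ℝ) / q + i / T + ((a / q : ℤ) : ℝ) := by
        have h1 : (((a % q).toNat : ℕ) : ℝ) = ((a % q : ℤ) : ℝ) := by exact_mod_cast hcast
        have h2 : (a : ℝ) = ((a % q : ℤ) : ℝ) + q * ((a / q : ℤ) : ℝ) := by
          exact_mod_cast (Int.emod_add_mul_ediv a q).symm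
        have h3 : (a : ℝ) / q = ((a % q : ℤ) : ℝ) / q + ((a / q : ℤ) : ℝ) := by
          rw [div_add' _ _ _ hq0.ne', mul_comm _ (q : ℝ), ← h2]
        rw [h1, hiβ, h3]
        ring
      rw [← hk _ (a / q), ← e]
      exact hj.2
    · have hj' : j = (((j.val : ℤ)) : ZMod T) := by simp
      conv_rhs => rw [hj']
      rw [ZMod.intCast_eq_intCast_iff_dvd_sub, hTs, hcast]
      have hTz : (T : ℤ) = q * s := by exact_mod_cast hs
      refine ⟨a / q, ?_⟩
      rw [Int.emod_def, hTz]
      have : (j.val : ℤ) = i + a * s := by rw [hi]; ring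
      rw [this]; ring
  refine (Finset.card_le_card hsub).trans (card_biUnion_le.trans ?_)
  exact Finset.sum_le_sum fun q _ => card_biUnion_le.trans (Finset.sum_le_sum fun i _ => card_image_le)

lemma le_rpow_mul_rpow {x a b θ : ℝ} (hx : 0 ≤ x) (ha : x ≤ a) (hb : x ≤ b) (h0 : 0 ≤ θ) (h1 : θ ≤ 1) :
    x ≤ a ^ (1 - θ) * b ^ θ := by
  rcases hx.eq_or_lt with rfl | hx
  · positivity
  calc x = x ^ (1 - θ) * x ^ θ := by rw [← Real.rpow_add hx]; simp
    _ ≤ _ := mul_le_mul (Real.rpow_le_rpow hx.le ha (by linarith)) (Real.rpow_le_rpow hx.le hb h0) (by positivity)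
      (Real.rpow_nonneg (hx.le.trans ha) _)

set_option maxHeartbeats 1000000 in
/-- The grid times at which the strip kernel is large. -/
lemma strip_times_le {n : ℕ} (hn : 2 ≤ n) {θ : ℝ} (hθ1 : 1 < ((n : ℝ) - 1) * θ) (hθ2 : n * θ < 2) :
    ∃ C : ℝ, 0 ≤ C ∧ ∀ N : ℕ, 1 ≤ N → ∀ T : ℕ, [NeZero T] → (∀ q, 1 ≤ q → q ≤ 64 * N → q ∣ T) → N ^ 2 ≤ T →
      ∀ M : ℝ, 1 ≤ M → (N : ℝ) ≤ M ^ 2 → ∀ v : Fin n → ℝ, ∑ i, v i ^ 2 = 1 → ∀ thr : ℝ, 0 < thr →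
      (#{j : ZMod T | thr < kS v N M ((j.val : ℝ) / T)} : ℝ) ≤ T * (C * (N ^ (n - 1) * M / thr) ^ θ) := by
  have hn' : (2 : ℝ) ≤ n := by exact_mod_cast hn
  have hθ0 : 0 < θ := by
    by_contra h
    nlinarith [not_lt.1 h]
  have hθ3 : θ ≤ 1 := by nlinarith
  set γ : ℝ := ((n : ℝ) - 1) * θ with hγ
  set σ : ℝ := 2 - n * θ with hσ
  have hσ0 : 0 < σ := by linarith
  have hσ1 : σ ≤ 1 := by nlinarith
  set K0 : ℝ := 20000 ^ n * (stripConst n * (4 ^ n * (66 + 520 * n))) with hK0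
  have hSC := stripConst_nonneg n
  have hK00 : 0 ≤ K0 := by positivity
  set D : ℝ := K0 * 400 ^ (n - 1) with hD
  have hD0 : 0 ≤ D := by positivity
  have hγ1 : 0 < γ - 1 := by linarith
  refine ⟨D ^ θ * (64 ^ σ / σ) * (1 + 2 / (γ - 1)), by positivity, ?_⟩
  intro N hN T _ hT hNT M hM hNM v hv thr hthr
  have hT0 : (0 : ℝ) < T := by exact_mod_cast Nat.pos_of_ne_zero (NeZero.ne T)
  have hN0 : (0 : ℝ) < N := by exact_mod_cast hN
  have hNT' : (N : ℝ) ^ 2 ≤ T := by exact_mod_cast hNT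
  set Y : ℝ := N ^ (n - 1) * M / thr with hY
  have hY0 : 0 < Y := by positivity
  set X : ℝ := (N : ℝ) ^ 2 / T with hX
  have hX0 : 0 < X := by positivity
  have hX1 : X ≤ 1 := by rw [hX, div_le_one hT0]; exact hNT'
  have hterm : ∀ q ∈ Icc 1 (64 * N), ∀ i ∈ Icc (-((T / (64 * N * q) : ℕ) : ℤ)) (T / (64 * N * q) : ℕ),
      (#((range q).filter fun a : ℕ => a.Coprime q ∧ thr < kS v N M (a / q + i / T)) : ℝ) ≤
        D ^ θ * Y ^ θ * N ^ (θ + γ) * ((q : ℝ) ^ (σ - 1) * (1 + X * (i.natAbs : ℝ)) ^ (-γ)) := by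
    intro q hq i hi
    obtain ⟨hq1, hqN⟩ := mem_Icc.1 hq
    have hq0 : (0 : ℝ) < q := by exact_mod_cast hq1
    have hqN' : (q : ℝ) ≤ 64 * N := by exact_mod_cast hqN
    rw [mem_Icc] at hi
    have hi' : i.natAbs * (64 * N * q) ≤ T := (Nat.le_div_iff_mul_le (by positivity)).1 (by omega)
    have hi'' : (i.natAbs : ℝ) * (64 * N * q) ≤ T := by exact_mod_cast hi'
    have habs : |(i : ℝ)| = (i.natAbs : ℝ) := by rw [Nat.cast_natAbs, Int.cast_abs]
    set m : ℝ := 1 + X * (i.natAbs : ℝ) with hm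
    have hm0 : 0 < m := by positivity
    have hm1 : 1 ≤ m := by rw [hm]; linarith [show 0 ≤ X * (i.natAbs : ℝ) by positivity]
    have hβ : |(i : ℝ) / T| ≤ 1 / (64 * N * q) := by
      rw [abs_div, abs_of_pos hT0, habs, div_le_div_iff₀ hT0 (by positivity), one_mul]
      exact hi''
    have hXβ : X * (i.natAbs : ℝ) = N * (N * |(i : ℝ) / T|) := by
      rw [abs_div, abs_of_pos hT0, habs, hX]; field_simp
    have hsum := sum_kS_le hv hN hq1 hqN hβ (Λ := 64 * N / m) hM hNM (by positivity) (by
      intro x h1 h2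
      rw [le_div_iff₀ hm0, hm, hXβ]
      have := mul_le_mul_of_nonneg_left h2 hN0.le
      nlinarith)
    rw [← hK0] at hsum
    have hqm : q * m ≤ 65 * N := by
      have h1 : q * (X * (i.natAbs : ℝ)) ≤ N := by
        have h2 : X * ((i.natAbs : ℝ) * (64 * N * q)) ≤ N ^ 2 := by
          refine (mul_le_mul_of_nonneg_left hi'' hX0.le).trans (le_of_eq ?_)
          rw [hX]; field_simp
        have h3 : (64 * N) * (q * (X * (i.natAbs : ℝ))) ≤ (64 * N) * N := by nlinarith
        exact le_of_mul_le_mul_left h3 (by positivity)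
      rw [hm]; linarith
    have hZ : 64 * N / m / q + 2 ≤ 400 * (N / (q * m)) := by
      have h1 : 1 ≤ 65 * (N / (q * m)) := by
        rw [← mul_div_assoc, le_div_iff₀ (by positivity)]; linarith
      have h2 : 64 * N / m / q = 64 * (N / (q * m)) := by field_simp
      rw [h2]; linarith
    set cnt : ℝ := (#((range q).filter fun a : ℕ => a.Coprime q ∧ thr < kS v N M (a / q + i / T)) : ℝ) with hcnt
    have hc1 : cnt ≤ q := by
      rw [hcnt]
      have := card_filter_le (range q) fun a : ℕ => a.Coprime q ∧ thr < kS v N M (a / q + i / T)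
      rw [card_range] at this
      exact_mod_cast this
    have hc2 : cnt ≤ D * (Y * (N * (N / (q * m)) ^ (n - 1))) := by
      have h1 : cnt * thr ≤ ∑ a ∈ range q with a.Coprime q, kS v N M (a / q + i / T) := by
        rw [hcnt, ← nsmul_eq_mul]
        refine (Finset.card_nsmul_le_sum _ (fun a : ℕ => kS v N M (a / q + i / T)) thr fun a ha =>
          (mem_filter.1 ha).2.2.le).trans ?_
        refine Finset.sum_le_sum_of_subset_of_nonneg (fun a ha => ?_) fun a _ _ => kS_nonneg _ _ _ _
        rw [mem_filter] at ha ⊢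
        exact ⟨ha.1, ha.2.1⟩
      have h2 : cnt * thr ≤ K0 * (N ^ n * M * (400 * (N / (q * m))) ^ (n - 1)) := by
        refine h1.trans (hsum.trans ?_)
        gcongr
      rw [← le_div_iff₀ hthr] at h2
      refine h2.trans (le_of_eq ?_)
      have e : (N : ℝ) ^ n = N ^ (n - 1) * N := by rw [← pow_succ]; congr 1; omega
      rw [hD, hY, mul_pow, e]
      ring
    refine (le_rpow_mul_rpow (Nat.cast_nonneg _) hc1 hc2 hθ0.le hθ3).trans (le_of_eq ?_)
    rw [Real.mul_rpow hD0 (by positivity), Real.mul_rpow hY0.le (by positivity), Real.mul_rpow hN0.le (by positivity),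
      ← Real.rpow_natCast (N / (q * m)), ← Real.rpow_mul (by positivity), Nat.cast_sub (by omega : 1 ≤ n), Nat.cast_one,
      ← hγ, Real.div_rpow hN0.le (by positivity), Real.mul_rpow hq0.le hm0.le, Real.rpow_add hN0]
    have e1 : (q : ℝ) ^ (σ - 1) = (q : ℝ) ^ (1 - θ) / (q : ℝ) ^ γ := by
      rw [← Real.rpow_sub hq0]; congr 1; rw [hσ, hγ]; ring
    rw [e1, Real.rpow_neg hm0.le]
    field_simp
  have h1 := card_large_grid_le hN hT (kS v N M) (fun t k => kS_add_intCast v N M t k) thr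
  have h2 : (#{j : ZMod T | thr < kS v N M ((j.val : ℝ) / T)} : ℝ) ≤ ∑ q ∈ Icc 1 (64 * N),
      ∑ i ∈ Icc (-((T / (64 * N * q) : ℕ) : ℤ)) (T / (64 * N * q) : ℕ),
        (#((range q).filter fun a : ℕ => a.Coprime q ∧ thr < kS v N M (a / q + i / T)) : ℝ) := by exact_mod_cast h1
  refine h2.trans ((Finset.sum_le_sum fun q hq => Finset.sum_le_sum fun i hi => hterm q hq i hi).trans ?_)
  have hI : ∀ J : ℕ, ∑ i ∈ Icc (-(J : ℤ)) J, (1 + X * (i.natAbs : ℝ)) ^ (-γ) ≤ (1 + 2 / (γ - 1)) / X := by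
    intro J
    rw [sum_Icc_natAbs (fun k : ℕ => (1 + X * (k : ℝ)) ^ (-γ))]
    have h3 := sum_one_add_rpow_neg_le (γ := γ) (by linarith) hX0 J
    have h4 : (1 + 2 / (γ - 1)) / X = 1 / X + 2 * (1 / ((γ - 1) * X)) := by
      rw [add_div, div_div, mul_one_div]
    have h5 : 1 ≤ 1 / X := by rw [le_div_iff₀ hX0]; linarith
    rw [h4]
    simp only [Nat.cast_zero, mul_zero, add_zero, Real.one_rpow]
    linarith
  calc _ = D ^ θ * Y ^ θ * N ^ (θ + γ) * ∑ q ∈ Icc 1 (64 * N), (q : ℝ) ^ (σ - 1) *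
        ∑ i ∈ Icc (-((T / (64 * N * q) : ℕ) : ℤ)) (T / (64 * N * q) : ℕ), (1 + X * (i.natAbs : ℝ)) ^ (-γ) := by
        simp_rw [← Finset.mul_sum]
    _ ≤ D ^ θ * Y ^ θ * N ^ (θ + γ) * ∑ q ∈ Icc 1 (64 * N), (q : ℝ) ^ (σ - 1) * ((1 + 2 / (γ - 1)) / X) := by
        refine mul_le_mul_of_nonneg_left (Finset.sum_le_sum fun q _ =>
          mul_le_mul_of_nonneg_left (hI _) (by positivity)) (by positivity)
    _ ≤ D ^ θ * Y ^ θ * N ^ (θ + γ) * ((((64 * N : ℕ) : ℝ) ^ σ / σ) * ((1 + 2 / (γ - 1)) / X)) := by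
        rw [← Finset.sum_mul]
        exact mul_le_mul_of_nonneg_left (mul_le_mul_of_nonneg_right (sum_rpow_sub_one_le hσ0 hσ1 _) (by positivity))
          (by positivity)
    _ = _ := by
        have e : (N : ℝ) ^ (θ + γ) * N ^ σ = N ^ 2 := by
          rw [← Real.rpow_add hN0, ← Real.rpow_natCast]; congr 1; rw [hσ, hγ]; push_cast; ring
        rw [Nat.cast_mul, Real.mul_rpow (by positivity) hN0.le, hX]
        push_cast
        calc _ = D ^ θ * Y ^ θ * (N ^ (θ + γ) * N ^ σ) * (64 ^ σ / σ * ((1 + 2 / (γ - 1)) / (N ^ 2 / T))) := by ring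
          _ = _ := by
            rw [e]; field_simp

lemma grid_strip_kernel_le {n N T : ℕ} [NeZero T] (hN : 1 ≤ N) (c : Fin n → ℤ) (v : Fin n → ℝ) (A : ℝ) {M : ℝ}
    (hM : 0 < M) (z : ZMod T × (Fin n → ZMod T)) :
    ‖∑ ξ ∈ cube c N, (sw c N v A M ξ : ℂ) * psi T ξ z‖ ^ 2 ≤ kS v N M ((z.1.val : ℝ) / T) := by
  refine le_trans (le_of_eq ?_) (strip_kernel_sq_le hN c v A hM ((z.1.val : ℝ) / T) (fun i => ((z.2 i).val : ℝ) / T))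
  congr 2
  refine Finset.sum_congr rfl fun ξ _ => ?_
  congr 1
  have h := psi_intCast ξ (T := T) (z.1.val : ℤ) (fun i => ((z.2 i).val : ℤ))
  have e : z = ((((z.1.val : ℤ)) : ZMod T), fun i => ((((z.2 i).val : ℤ)) : ZMod T)) := by
    ext <;> simp
  rw [e, h]
  simp

/-- Level set estimate for waves with frequencies in a strip, of use for small levels. -/
lemma strip_level {n : ℕ} (hn : 2 ≤ n) {θ : ℝ} (hθ1 : 1 < ((n : ℝ) - 1) * θ) (hθ2 : n * θ < 2) :
    ∃ C : ℝ, 0 ≤ C ∧ ∀ N : ℕ, 1 ≤ N → ∀ T : ℕ, [NeZero T] → (∀ q, 1 ≤ q → q ≤ 64 * N → q ∣ T) → N ^ 2 ≤ T → 8 * N < T →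
      ∀ M : ℝ, 1 ≤ M → (N : ℝ) ≤ M ^ 2 → ∀ v : Fin n → ℝ, ∑ i, v i ^ 2 = 1 → ∀ (A : ℝ) (c : Fin n → ℤ)
      (a : (Fin n → ℤ) → ℂ), (∀ ξ, a ξ ≠ 0 → (∀ i, |ξ i - c i| ≤ N) ∧ |(∑ i, v i * ξ i) - A| ≤ M) →
      ∑ ξ ∈ cube c N, ‖a ξ‖ ^ 2 ≤ 1 → ∀ lam : ℝ, 0 < lam →
      lvl (gw T (cube c N) a) lam * lam ^ 2 ≤ C * (N ^ (n - 1) * M / lam ^ 4) ^ θ := by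
  obtain ⟨C, hC0, hC⟩ := strip_times_le hn hθ1 hθ2
  refine ⟨6 * (C * 36 ^ θ), by positivity, ?_⟩
  intro N hN T _ hT hNT h8 M hM hNM v hv A c a hsupp ha lam hlam
  have hM0 : 0 < M := by linarith
  have hT0 : (0 : ℝ) < T := by exact_mod_cast Nat.pos_of_ne_zero (NeZero.ne T)
  have hbw1 : ∀ ξ, bw c N ξ ≤ 1 := bw_le_one c hN
  have h1 := low_level h8 c a ha (fun ξ => 3 * sw c N v A M ξ)
    (fun ξ => mul_nonneg (by norm_num) (mul_nonneg (bw_nonneg c N ξ) (Real.exp_pos _).le)) (B := 3) (by norm_num)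
    (fun ξ => by
      have : sw c N v A M ξ ≤ 1 := mul_le_one₀ (hbw1 ξ) (Real.exp_pos _).le (Real.exp_le_one_iff.2 (by
        have : 0 ≤ ((∑ i, v i * ξ i) - A) ^ 2 / M ^ 2 := by positivity
        linarith))
      linarith)
    (fun ξ h => by
      obtain ⟨h2, h3⟩ := hsupp ξ h
      rw [sw, bw_eq_one hN h2, one_mul]
      have h4 : ((∑ i, v i * ξ i) - A) ^ 2 / M ^ 2 ≤ 1 := by
        rw [div_le_one (by positivity)]
        exact sq_le_sq' (by linarith [(abs_le.1 h3).1]) (abs_le.1 h3).2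
      have h5 : Real.exp (-1) ≤ Real.exp (-(((∑ i, v i * ξ i) - A) ^ 2 / M ^ 2)) := Real.exp_le_exp.2 (by linarith)
      have h6 : 1 / 3 ≤ Real.exp (-1) := by
        rw [Real.exp_neg, one_div]
        exact inv_anti₀ (Real.exp_pos _) (by linarith [Real.exp_one_lt_d9])
      linarith)
    (fun j => 3 * √(kS v N M ((j.val : ℝ) / T))) (fun z => by
      have h2 : ∑ ξ ∈ cube c N, ((3 * sw c N v A M ξ : ℝ) : ℂ) * psi T ξ z =
          3 * ∑ ξ ∈ cube c N, (sw c N v A M ξ : ℂ) * psi T ξ z := by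
        rw [Finset.mul_sum]
        refine Finset.sum_congr rfl fun ξ _ => ?_
        push_cast; ring
      rw [h2, norm_mul, Complex.norm_ofNat]
      exact mul_le_mul_of_nonneg_left (Real.le_sqrt_of_sq_le (grid_strip_kernel_le hN c v A hM0 z)) (by norm_num))
    (lam := lam) hlam
  refine h1.trans ?_
  have h2 := hC N hN T hT hNT M hM hNM v hv (lam ^ 4 / 36) (by positivity)
  have h3 : (#{j : ZMod T | lam ^ 2 / 2 < 3 * √(kS v N M ((j.val : ℝ) / T))} : ℝ) ≤
      #{j : ZMod T | lam ^ 4 / 36 < kS v N M ((j.val : ℝ) / T)} := by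
    refine Nat.cast_le.2 (card_le_card fun j hj => ?_)
    rw [mem_filter] at hj ⊢
    refine ⟨hj.1, ?_⟩
    have h4 : (lam ^ 2 / 6) ^ 2 < √(kS v N M ((j.val : ℝ) / T)) ^ 2 :=
      pow_lt_pow_left₀ (by linarith [hj.2]) (by positivity) two_ne_zero
    rw [Real.sq_sqrt (kS_nonneg _ _ _ _)] at h4
    calc lam ^ 4 / 36 = (lam ^ 2 / 6) ^ 2 := by ring
      _ < _ := h4
  have h4 : (#{j : ZMod T | lam ^ 2 / 2 < 3 * √(kS v N M ((j.val : ℝ) / T))} : ℝ) / T ≤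
      C * (N ^ (n - 1) * M / (lam ^ 4 / 36)) ^ θ := by
    rw [div_le_iff₀ hT0, mul_comm]
    exact h3.trans h2
  have h5 : (N : ℝ) ^ (n - 1) * M / (lam ^ 4 / 36) = 36 * (N ^ (n - 1) * M / lam ^ 4) := by field_simp
  rw [h5, Real.mul_rpow (by norm_num) (by positivity)] at h4
  calc _ ≤ 2 * 3 * (C * (36 ^ θ * (N ^ (n - 1) * M / lam ^ 4) ^ θ)) := mul_le_mul_of_nonneg_left h4 (by norm_num)
    _ = _ := by ring

/-- Power sums are controlled by weak-type bounds on the level sets. -/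
lemma sum_rpow_le_of_lvl {Z : Type*} [Fintype Z] [Nonempty Z] (u : Z → ℂ) {P p A l₁ l₂ : ℝ} (hPp : P < p) (hp : 0 < p)
    (hA : 0 ≤ A) (h1 : 0 ≤ l₁) (h2 : 0 < l₂)
    (h : ∀ lam, l₁ / 2 < lam → 0 < lam → lam ≤ l₂ → lvl u lam * lam ^ P ≤ A) :
    ∑ z, (if l₁ < ‖u z‖ ∧ ‖u z‖ ≤ l₂ then ‖u z‖ ^ p else 0) ≤
      Fintype.card Z * (2 ^ P / (1 - (1 / 2) ^ (p - P)) * A * l₂ ^ (p - P)) := by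
  classical
  have hZ : (0 : ℝ) < Fintype.card Z := by exact_mod_cast Fintype.card_pos
  have hr0 : (0 : ℝ) < (1 / 2) ^ (p - P) := by positivity
  have hr1 : ((1 : ℝ) / 2) ^ (p - P) < 1 := Real.rpow_lt_one (by norm_num) (by norm_num) (by linarith)
  set r : ℝ := (1 / 2) ^ (p - P) with hr
  have hex : ∀ z, ∃ k : ℕ, l₁ < ‖u z‖ ∧ ‖u z‖ ≤ l₂ → l₂ * (1 / 2) ^ (k + 1) < ‖u z‖ ∧ ‖u z‖ ≤ l₂ * (1 / 2) ^ k := by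
    intro z
    by_cases hz : l₁ < ‖u z‖ ∧ ‖u z‖ ≤ l₂
    · obtain ⟨k, hk1, hk2⟩ := exists_nat_pow_near_of_lt_one (x := ‖u z‖ / l₂) (y := (1 / 2 : ℝ))
        (div_pos (h1.trans_lt hz.1) h2) ((div_le_one h2).2 hz.2) (by norm_num) (by norm_num)
      refine ⟨k, fun _ => ⟨?_, ?_⟩⟩
      · rwa [lt_div_iff₀ h2, mul_comm] at hk1
      · rwa [div_le_iff₀ h2, mul_comm] at hk2
    · exact ⟨0, fun h => absurd h hz⟩
  choose k hk using hex
  obtain ⟨J, hJ⟩ : ∃ J, ∀ z, k z < J := ⟨univ.sup k + 1, fun z => Nat.lt_succ_of_le (Finset.le_sup (mem_univ z))⟩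
  have hpt : ∀ z, (if l₁ < ‖u z‖ ∧ ‖u z‖ ≤ l₂ then ‖u z‖ ^ p else 0) ≤ ∑ j ∈ range J,
      if l₁ / 2 < l₂ * (1 / 2) ^ (j + 1) then (l₂ * (1 / 2) ^ j) ^ p *
        (if l₂ * (1 / 2) ^ (j + 1) < ‖u z‖ then (1 : ℝ) else 0) else 0 := by
    intro z
    have hnn : ∀ j ∈ range J, (0 : ℝ) ≤ if l₁ / 2 < l₂ * (1 / 2) ^ (j + 1) then (l₂ * (1 / 2) ^ j) ^ p *
        (if l₂ * (1 / 2) ^ (j + 1) < ‖u z‖ then (1 : ℝ) else 0) else 0 := by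
      intro j _
      split_ifs <;> positivity
    split_ifs with hz
    · obtain ⟨h3, h4⟩ := hk z hz
      refine le_trans ?_ (Finset.single_le_sum hnn (mem_range.2 (hJ z)))
      rw [if_pos h3, mul_one, if_pos (by rw [pow_succ]; linarith [hz.1])]
      exact Real.rpow_le_rpow (norm_nonneg _) h4 hp.le
    · exact Finset.sum_nonneg hnn
  refine (Finset.sum_le_sum fun z _ => hpt z).trans ?_
  rw [Finset.sum_comm]
  have hj : ∀ j ∈ range J, ∑ z, (if l₁ / 2 < l₂ * (1 / 2) ^ (j + 1) then (l₂ * (1 / 2) ^ j) ^ p *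
        (if l₂ * (1 / 2) ^ (j + 1) < ‖u z‖ then (1 : ℝ) else 0) else 0) ≤
      Fintype.card Z * (2 ^ P * A * l₂ ^ (p - P)) * r ^ j := by
    intro j _
    by_cases hc : l₁ / 2 < l₂ * (1 / 2) ^ (j + 1)
    swap
    · simp only [if_neg hc, Finset.sum_const_zero]; positivity
    simp only [if_pos hc]
    rw [← Finset.mul_sum, Finset.sum_boole]
    set μ : ℝ := l₂ * (1 / 2) ^ (j + 1) with hμ
    have hμ0 : 0 < μ := by positivity
    have hμl : μ ≤ l₂ := mul_le_of_le_one_right h2.le (pow_le_one₀ (by norm_num) (by norm_num))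
    have h3 := h μ hc hμ0 hμl
    have h4 : (#{z | μ < ‖u z‖} : ℝ) = lvl u μ * Fintype.card Z := by
      rw [lvl, div_mul_cancel₀ _ hZ.ne']
    have h5 : lvl u μ ≤ A / μ ^ P := by rwa [le_div_iff₀ (by positivity)]
    have h6 : l₂ * (1 / 2) ^ j = 2 * μ := by rw [hμ, pow_succ]; ring
    rw [h4, h6]
    calc (2 * μ) ^ p * (lvl u μ * Fintype.card Z) ≤ (2 * μ) ^ p * (A / μ ^ P * Fintype.card Z) := by gcongr
      _ = Fintype.card Z * (2 ^ P * A) * (2 * μ) ^ (p - P) := by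
        rw [Real.rpow_sub (by positivity), Real.mul_rpow (z := P) (by norm_num) hμ0.le]
        field_simp
      _ = _ := by
        rw [← h6, Real.mul_rpow h2.le (by positivity), hr, ← Real.rpow_natCast, ← Real.rpow_natCast, ← Real.rpow_mul (by norm_num),
          ← Real.rpow_mul (by norm_num), mul_comm (j : ℝ)]
        ring
  refine (Finset.sum_le_sum hj).trans ?_
  rw [← Finset.mul_sum]
  have h7 : ∑ j ∈ range J, r ^ j ≤ 1 / (1 - r) := by
    rw [le_div_iff₀ (by linarith), geom_sum_mul_neg]
    linarith [pow_nonneg hr0.le J]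
  calc _ ≤ Fintype.card Z * (2 ^ P * A * l₂ ^ (p - P)) * (1 / (1 - r)) :=
        mul_le_mul_of_nonneg_left h7 (by positivity)
    _ = _ := by ring

/-- Grid sizes for which the discrete Schrödinger waves with frequencies in `cube c N` are faithful models. -/
def GoodGrid {n : ℕ} (c : Fin n → ℤ) (N T : ℕ) : Prop :=
  (∀ q, 1 ≤ q → q ≤ 64 * N → q ∣ T) ∧ N ^ 2 ≤ T ∧ 8 * N < T ∧
    ∀ ξ ∈ cube c N, (∀ i, 8 * |ξ i| < T) ∧ 8 * ∑ i, ξ i ^ 2 < T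

/-- Contribution of the large values of a wave to its power sums. -/
lemma sum_high_le {n m : ℕ} (hn : 1 ≤ n) (hm : 2 ≤ m) {κ P p : ℝ} (hκ : κ = 1 / ((m : ℝ) - 1))
    (hP : P = 2 + 4 / n + (2 + 8 / n) * κ) (hPp : P < p) :
    ∃ C : ℝ, 1 ≤ C ∧ ∀ N : ℕ, 1 ≤ N → ∀ (T : ℕ) [NeZero T] (c : Fin n → ℤ), GoodGrid c N T →
      ∀ a : (Fin n → ℤ) → ℂ, (∀ ξ, a ξ ≠ 0 → ∀ i, |ξ i - c i| ≤ N) → ∑ ξ ∈ cube c N, ‖a ξ‖ ^ 2 ≤ 1 →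
      ∀ U : ℝ, 0 < U → (∀ z, ‖gw T (cube c N) a z‖ ≤ U) →
      ∑ z, (if C * (N : ℝ) ^ ((n : ℝ) / 4) < ‖gw T (cube c N) a z‖ then ‖gw T (cube c N) a z‖ ^ p else 0) ≤
        Fintype.card (ZMod T × (Fin n → ZMod T)) * (C * (N : ℝ) ^ ((n + 4) * κ) * U ^ (p - P)) := by
  obtain ⟨C₀, hC₀, hlev⟩ := large_level n m hn hm
  have hn0 : (0 : ℝ) < n := by exact_mod_cast hn
  have hm0 : (0 : ℝ) < (m : ℝ) - 1 := by
    have : (2 : ℝ) ≤ m := by exact_mod_cast hm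
    linarith
  have hκ0 : 0 < κ := by rw [hκ]; positivity
  have hP0 : 0 < P := by rw [hP]; positivity
  have hr1 : ((1 : ℝ) / 2) ^ (p - P) < 1 := Real.rpow_lt_one (by norm_num) (by norm_num) (by linarith)
  set D : ℝ := 2 ^ P / (1 - (1 / 2) ^ (p - P)) with hD
  have hD0 : 0 ≤ D := div_nonneg (by positivity) (by linarith)
  refine ⟨1 + 2 * C₀ ^ ((n : ℝ) / 4) + D * C₀ ^ κ, ?_, ?_⟩
  · have : 0 ≤ 2 * C₀ ^ ((n : ℝ) / 4) + D * C₀ ^ κ := by positivity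
    linarith
  intro N hN T _ c hT a hsupp ha U hU hu
  have hN0 : (0 : ℝ) < N := by exact_mod_cast hN
  set C : ℝ := 1 + 2 * C₀ ^ ((n : ℝ) / 4) + D * C₀ ^ κ with hC
  set l₁ : ℝ := 2 * (C₀ * N) ^ ((n : ℝ) / 4) with hl₁
  set A : ℝ := (C₀ * (N : ℝ) ^ (n + 4)) ^ κ with hA
  have hl : l₁ ≤ C * (N : ℝ) ^ ((n : ℝ) / 4) := by
    rw [hl₁, Real.mul_rpow (by linarith) hN0.le, ← mul_assoc]
    refine mul_le_mul_of_nonneg_right ?_ (by positivity)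
    have : 0 ≤ D * C₀ ^ κ := by positivity
    linarith
  have hlv : ∀ lam, l₁ / 2 < lam → 0 < lam → lam ≤ U → lvl (gw T (cube c N) a) lam * lam ^ P ≤ A := by
    intro lam h1 hlam _
    have h2 := hlev N hN T hT.1 hT.2.1 hT.2.2.1 c a hsupp ha lam (lam ^ (4 / (n : ℝ))) hlam (by positivity) (by
      rw [← Real.rpow_natCast (lam ^ _), ← Real.rpow_mul hlam.le, div_mul_cancel₀ _ hn0.ne']
      norm_cast) (by
      have h3 : (C₀ * N) ^ ((n : ℝ) / 4) ≤ lam := by rw [hl₁] at h1; linarith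
      have h4 := Real.rpow_le_rpow (by positivity) h3 (by positivity : 0 ≤ 4 / (n : ℝ))
      rwa [← Real.rpow_mul (by positivity), div_mul_div_comm, mul_comm (n : ℝ), div_self (by positivity), Real.rpow_one] at h4)
    have hx : 0 ≤ lvl (gw T (cube c N) a) lam * lam ^ P := mul_nonneg (lvl_nonneg _ _) (by positivity)
    have h3 : (lvl (gw T (cube c N) a) lam * lam ^ P) ^ (m - 1) ≤ C₀ * (N : ℝ) ^ (n + 4) := by
      refine le_trans (le_of_eq ?_) h2
      rw [mul_pow, mul_assoc]
      congr 1
      rw [← Real.rpow_natCast, ← Real.rpow_natCast, ← Real.rpow_natCast, ← Real.rpow_mul hlam.le, ← Real.rpow_mul hlam.le,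
        ← Real.rpow_add hlam, hP, hκ, Nat.cast_sub (by omega)]
      congr 1
      push_cast
      field_simp
      ring
    have h4 := Real.rpow_le_rpow (by positivity) h3 hκ0.le
    have h5 : κ = ((m - 1 : ℕ) : ℝ)⁻¹ := by rw [hκ, Nat.cast_sub (by omega), one_div, Nat.cast_one]
    rw [h5, Real.pow_rpow_inv_natCast hx (by omega), ← h5] at h4
    exact h4
  have h1 := sum_rpow_le_of_lvl (gw T (cube c N) a) hPp (hP0.trans hPp) (by positivity) (by positivity) hU hlv
  refine le_trans (Finset.sum_le_sum fun z _ => ?_) (h1.trans ?_)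
  · split_ifs with h2 h3 h3
    · exact le_rfl
    · exact absurd ⟨hl.trans_lt h2, hu z⟩ h3
    · positivity
    · exact le_rfl
  · refine mul_le_mul_of_nonneg_left (mul_le_mul_of_nonneg_right ?_ (by positivity)) (by positivity)
    rw [hA, Real.mul_rpow (by linarith) (by positivity), ← Real.rpow_natCast, ← Real.rpow_mul hN0.le, ← mul_assoc]
    push_cast
    refine mul_le_mul_of_nonneg_right ?_ (by positivity)
    have : 0 ≤ C₀ ^ ((n : ℝ) / 4) := by positivity
    linarith

/-- Pointwise bound for waves with frequencies in a strip. -/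
lemma norm_gw_strip_le {n N T : ℕ} [NeZero T] (hn : 1 ≤ n) (hN : 1 ≤ N) {M : ℝ} (hM : 1 ≤ M) {v : Fin n → ℝ}
    (hv : ∑ i, v i ^ 2 = 1) {A : ℝ} {c : Fin n → ℤ} {a : (Fin n → ℤ) → ℂ}
    (hsupp : ∀ ξ, a ξ ≠ 0 → (∀ i, |ξ i - c i| ≤ N) ∧ |(∑ i, v i * ξ i) - A| ≤ M)
    (ha : ∑ ξ ∈ cube c N, ‖a ξ‖ ^ 2 ≤ 1) (z : ZMod T × (Fin n → ZMod T)) :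
    ‖gw T (cube c N) a z‖ ^ 2 ≤ 3 ^ n * n * (N ^ (n - 1) * M) := by
  classical
  set S := {ξ ∈ cube c N | a ξ ≠ 0} with hS
  have hSs : ∀ ξ ∈ S, (∀ i, |ξ i - c i| ≤ N) ∧ |(∑ i, v i * ξ i) - A| ≤ M := fun ξ h => hsupp ξ (mem_filter.1 h).2
  have h1 : gw T (cube c N) a z = gw T S a z := by
    unfold gw
    rw [hS, Finset.sum_filter]
    exact Finset.sum_congr rfl fun ξ _ => by split_ifs with h <;> simp_all
  have h2 : ∑ ξ ∈ S, ‖a ξ‖ ^ 2 ≤ 1 :=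
    (Finset.sum_le_sum_of_subset_of_nonneg (filter_subset _ _) fun _ _ _ => sq_nonneg _).trans ha
  have h3 : (#S : ℝ) ≤ (2 * N / (1 : ℕ) + 1) ^ (n - 1) * (n * (2 * M) / (1 : ℕ) + 1) := by
    refine card_strip_le hv le_rfl (by positivity) (by positivity) S (fun _ _ _ _ _ => by simp) ?_ ?_
    · intro h hh h' hh' i
      have e1 := abs_le.1 ((hSs h hh).1 i)
      have e2 := abs_le.1 ((hSs h' hh').1 i)
      have : h i - h' i ≤ 2 * N := by omega
      exact_mod_cast this
    · intro h hh h' hh'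
      have e1 := abs_le.1 (hSs h hh).2
      have e2 := abs_le.1 (hSs h' hh').2
      linarith
  have hN1 : (1 : ℝ) ≤ N := by exact_mod_cast hN
  have hn1 : (1 : ℝ) ≤ n := by exact_mod_cast hn
  have hnM : 1 ≤ n * M := one_le_mul_of_one_le_of_one_le hn1 hM
  rw [h1]
  calc _ ≤ #S * ∑ ξ ∈ S, ‖a ξ‖ ^ 2 := norm_gw_sq_le S a z
    _ ≤ #S := mul_le_of_le_one_right (by positivity) h2
    _ ≤ _ := h3
    _ ≤ (3 * N) ^ (n - 1) * (3 * (n * M)) := by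
      rw [Nat.cast_one, div_one, div_one]
      gcongr <;> linarith
    _ = _ := by
      rw [mul_pow]
      obtain ⟨k, rfl⟩ : ∃ k, n = k + 1 := ⟨n - 1, by omega⟩
      rw [Nat.add_sub_cancel, pow_succ (3 : ℝ)]
      ring

/-- Removing the loss in a moment estimate at the cost of raising the exponent. -/
lemma cube_moment_le {n : ℕ} (hn : 1 ≤ n) {p₁ p : ℝ} (hp₁ : 2 + 4 / (n : ℝ) ≤ p₁) (hp : p₁ < p)
    (hmom : ∃ C : ℝ, 1 ≤ C ∧ ∀ N : ℕ, 1 ≤ N → ∀ (T : ℕ) [NeZero T] (c : Fin n → ℤ) (a : (Fin n → ℤ) → ℂ),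
      (∀ ξ ∈ cube c N, (∀ i, 8 * |ξ i| < T) ∧ 8 * ∑ i, ξ i ^ 2 < T) → ∑ ξ ∈ cube c N, ‖a ξ‖ ^ 2 ≤ 1 →
      ∑ z, ‖gw T (cube c N) a z‖ ^ p₁ ≤ Fintype.card (ZMod T × (Fin n → ZMod T)) *
        (C * (N : ℝ) ^ (n * p₁ / 2 - n - 2 + n * (p - p₁) / 4))) :
    ∃ C : ℝ, 1 ≤ C ∧ ∀ N : ℕ, 1 ≤ N → ∀ (T : ℕ) [NeZero T] (c : Fin n → ℤ), GoodGrid c N T →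
      ∀ a : (Fin n → ℤ) → ℂ, (∀ ξ, a ξ ≠ 0 → ∀ i, |ξ i - c i| ≤ N) → ∑ ξ ∈ cube c N, ‖a ξ‖ ^ 2 ≤ 1 →
      ∑ z, ‖gw T (cube c N) a z‖ ^ p ≤
        Fintype.card (ZMod T × (Fin n → ZMod T)) * (C * (N : ℝ) ^ (n * p / 2 - n - 2)) := by
  obtain ⟨C₁, hC₁, hmom⟩ := hmom
  have hn0 : (0 : ℝ) < n := by exact_mod_cast hn
  have hg : 0 < p - 2 - 4 / n := by linarith
  obtain ⟨k, hk⟩ := exists_nat_gt ((2 + 8 / (n : ℝ)) / (p - 2 - 4 / n))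
  have hk0 : (0 : ℝ) < k + 1 := by positivity
  set κ : ℝ := 1 / (((k + 2 : ℕ) : ℝ) - 1) with hκ
  have hκ' : κ = 1 / (k + 1) := by rw [hκ]; push_cast; ring
  set P : ℝ := 2 + 4 / n + (2 + 8 / n) * κ with hP
  have hp₁0 : 0 < p₁ := lt_of_lt_of_le (by positivity) hp₁
  have hPp : P < p := by
    rw [div_lt_iff₀ hg] at hk
    have : (2 + 8 / (n : ℝ)) * κ < p - 2 - 4 / n := by
      rw [hκ', mul_one_div, div_lt_iff₀ hk0]
      nlinarith
    linarith
  obtain ⟨C₂, hC₂, hhigh⟩ := sum_high_le hn (by omega : 2 ≤ k + 2) hκ hP hPp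
  refine ⟨C₂ ^ (p - p₁) * C₁ + C₂ * (9 ^ ((n : ℝ) / 2)) ^ (p - P), ?_, ?_⟩
  · have h1 : 1 ≤ C₂ ^ (p - p₁) := Real.one_le_rpow hC₂ (by linarith)
    have h2 : 1 ≤ C₂ ^ (p - p₁) * C₁ := one_le_mul_of_one_le_of_one_le h1 hC₁
    have h3 : 0 ≤ C₂ * ((9 : ℝ) ^ ((n : ℝ) / 2)) ^ (p - P) := by positivity
    linarith
  intro N hN T _ c hT a hsupp ha
  have hN0 : (0 : ℝ) < N := by exact_mod_cast hN
  set U : ℝ := (9 * N) ^ ((n : ℝ) / 2) with hU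
  have hu : ∀ z, ‖gw T (cube c N) a z‖ ≤ U := by
    intro z
    refine le_of_sq_le_sq ?_ (by positivity)
    rw [hU, ← Real.rpow_natCast (_ ^ _), ← Real.rpow_mul (by positivity), Nat.cast_ofNat, div_mul_cancel₀ _ (by norm_num),
      Real.rpow_natCast]
    exact (norm_gw_sq_le _ a z).trans ((mul_le_of_le_one_right (by positivity) ha).trans (card_cube_le hN c))
  have h1 := hhigh N hN T c hT a hsupp ha U (by positivity) hu
  have h2 := hmom N hN T c a hT.2.2.2 ha
  set l : ℝ := C₂ * (N : ℝ) ^ ((n : ℝ) / 4) with hl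
  have hl0 : 0 < l := by positivity
  set W : ℝ := (Fintype.card (ZMod T × (Fin n → ZMod T)) : ℝ) with hW
  have h3 : ∀ z, ‖gw T (cube c N) a z‖ ^ p ≤ l ^ (p - p₁) * ‖gw T (cube c N) a z‖ ^ p₁ +
      if l < ‖gw T (cube c N) a z‖ then ‖gw T (cube c N) a z‖ ^ p else 0 := by
    intro z
    split_ifs with h
    · have : 0 ≤ l ^ (p - p₁) * ‖gw T (cube c N) a z‖ ^ p₁ := by positivity
      linarith
    · rw [add_zero]
      have e : ‖gw T (cube c N) a z‖ ^ p = ‖gw T (cube c N) a z‖ ^ (p - p₁) * ‖gw T (cube c N) a z‖ ^ p₁ := by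
        rw [← Real.rpow_add_of_nonneg (norm_nonneg _) (by linarith) hp₁0.le]; congr 1; ring
      rw [e]
      refine mul_le_mul_of_nonneg_right (Real.rpow_le_rpow (norm_nonneg _) (not_lt.1 h) (by linarith)) (by positivity)
  have e1 : l ^ (p - p₁) * (N : ℝ) ^ (n * p₁ / 2 - n - 2 + n * (p - p₁) / 4) =
      C₂ ^ (p - p₁) * (N : ℝ) ^ (n * p / 2 - n - 2) := by
    rw [hl, Real.mul_rpow (by positivity) (by positivity), ← Real.rpow_mul hN0.le, mul_assoc, ← Real.rpow_add hN0]
    congr 2; ring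
  have e2 : (N : ℝ) ^ ((n + 4) * κ) * U ^ (p - P) = (9 ^ ((n : ℝ) / 2)) ^ (p - P) * (N : ℝ) ^ (n * p / 2 - n - 2) := by
    rw [hU, Real.mul_rpow (by positivity) hN0.le, Real.mul_rpow (by positivity) (by positivity), ← Real.rpow_mul hN0.le,
      mul_left_comm, ← Real.rpow_add hN0]
    congr 2
    rw [hP]
    field_simp
    ring
  calc _ ≤ ∑ z, (l ^ (p - p₁) * ‖gw T (cube c N) a z‖ ^ p₁ +
        if l < ‖gw T (cube c N) a z‖ then ‖gw T (cube c N) a z‖ ^ p else 0) := Finset.sum_le_sum fun z _ => h3 z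
    _ ≤ l ^ (p - p₁) * (W * (C₁ * (N : ℝ) ^ (n * p₁ / 2 - n - 2 + n * (p - p₁) / 4))) +
        W * (C₂ * (N : ℝ) ^ ((n + 4) * κ) * U ^ (p - P)) := by
      rw [Finset.sum_add_distrib, ← Finset.mul_sum]
      exact add_le_add (mul_le_mul_of_nonneg_left h2 (by positivity)) h1
    _ = W * (C₁ * (l ^ (p - p₁) * (N : ℝ) ^ (n * p₁ / 2 - n - 2 + n * (p - p₁) / 4)) +
        C₂ * ((N : ℝ) ^ ((n + 4) * κ) * U ^ (p - P))) := by ring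
    _ = _ := by rw [e1, e2]; ring

/-- Passing from an exponent to a larger one through the pointwise bound. -/
lemma sum_rpow_le_sup_mul {Z : Type*} [Fintype Z] (u : Z → ℂ) {B p q : ℝ} (hq : 0 < q) (hqp : q ≤ p)
    (hu : ∀ z, ‖u z‖ ^ 2 ≤ B) : ∑ z, ‖u z‖ ^ p ≤ B ^ ((p - q) / 2) * ∑ z, ‖u z‖ ^ q := by
  rw [Finset.mul_sum]
  refine Finset.sum_le_sum fun z _ => ?_
  have e : ‖u z‖ ^ p = (‖u z‖ ^ 2) ^ ((p - q) / 2) * ‖u z‖ ^ q := by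
    rw [← Real.rpow_natCast (‖u z‖), ← Real.rpow_mul (norm_nonneg _), ← Real.rpow_add_of_nonneg (norm_nonneg _)
      (by push_cast; linarith) hq.le]
    congr 1; push_cast; ring
  rw [e]
  exact mul_le_mul_of_nonneg_right (Real.rpow_le_rpow (sq_nonneg _) (hu z) (by linarith)) (by positivity)

/-- Discrete Strichartz estimate for strips. -/
def GridStrichartz (n : ℕ) (p δ : ℝ) : Prop :=
  ∃ C : ℝ, 0 ≤ C ∧ ∀ N : ℕ, 1 ≤ N → ∀ (T : ℕ) [NeZero T] (c : Fin n → ℤ), GoodGrid c N T →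
    ∀ M : ℝ, 1 ≤ M → M ≤ N → ∀ v : Fin n → ℝ, ∑ i, v i ^ 2 = 1 → ∀ (A : ℝ) (a : (Fin n → ℤ) → ℂ),
    (∀ ξ, a ξ ≠ 0 → (∀ i, |ξ i - c i| ≤ N) ∧ |(∑ i, v i * ξ i) - A| ≤ M) → ∑ ξ ∈ cube c N, ‖a ξ‖ ^ 2 ≤ 1 →
    ∑ z, ‖gw T (cube c N) a z‖ ^ p ≤ Fintype.card (ZMod T × (Fin n → ZMod T)) *
      (C * ((N : ℝ) ^ (n * p / 2 - n - 2) * (M / N) ^ (δ * p)))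

/-- A sharp moment bound for cubes implies the improved bound for strips at larger exponents. -/
lemma gridStrichartz_of_cube {n : ℕ} (hn : 1 ≤ n) {p δ : ℝ} (hδ : 0 < δ) (hp : 0 < p - 2 * (δ * p))
    (hcube : ∃ C : ℝ, 1 ≤ C ∧ ∀ N : ℕ, 1 ≤ N → ∀ (T : ℕ) [NeZero T] (c : Fin n → ℤ), GoodGrid c N T →
      ∀ a : (Fin n → ℤ) → ℂ, (∀ ξ, a ξ ≠ 0 → ∀ i, |ξ i - c i| ≤ N) → ∑ ξ ∈ cube c N, ‖a ξ‖ ^ 2 ≤ 1 →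
      ∑ z, ‖gw T (cube c N) a z‖ ^ (p - 2 * (δ * p)) ≤ Fintype.card (ZMod T × (Fin n → ZMod T)) *
        (C * (N : ℝ) ^ (n * (p - 2 * (δ * p)) / 2 - n - 2))) (hp0 : 0 < p) : GridStrichartz n p δ := by
  obtain ⟨C, hC, hcube⟩ := hcube
  refine ⟨(3 ^ n * n) ^ (δ * p) * C, by positivity, ?_⟩
  intro N hN T _ c hT M hM hMN v hv A a hsupp ha
  have hN0 : (0 : ℝ) < N := by exact_mod_cast hN
  have hM0 : 0 < M := by linarith
  have h1 := hcube N hN T c hT a (fun ξ h => (hsupp ξ h).1) ha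
  have hδp : 0 < δ * p := mul_pos hδ hp0
  have h2 := sum_rpow_le_sup_mul (gw T (cube c N) a) hp (by linarith : p - 2 * (δ * p) ≤ p)
    (B := 3 ^ n * n * (N ^ (n - 1) * M)) (norm_gw_strip_le hn hN hM hv hsupp ha)
  have e1 : (p - (p - 2 * (δ * p))) / 2 = δ * p := by ring
  rw [e1] at h2
  refine h2.trans ((mul_le_mul_of_nonneg_left h1 (by positivity)).trans (le_of_eq ?_))
  have e2 : (N : ℝ) ^ (n - 1) * M = (N : ℝ) ^ (n : ℝ) * (M / N) := by
    obtain ⟨k, rfl⟩ : ∃ k, n = k + 1 := ⟨n - 1, by omega⟩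
    rw [Real.rpow_natCast, Nat.add_sub_cancel, pow_succ]
    field_simp
  have e3 : (N : ℝ) ^ (n * p / 2 - n - 2) = ((N : ℝ) ^ (n : ℝ)) ^ (δ * p) * (N : ℝ) ^ (n * (p - 2 * (δ * p)) / 2 - n - 2) := by
    rw [← Real.rpow_mul hN0.le, ← Real.rpow_add hN0]; congr 1; ring
  rw [e2, e3, Real.mul_rpow (by positivity) (by positivity), Real.mul_rpow (x := (N : ℝ) ^ (n : ℝ)) (by positivity) (by positivity)]
  ring

lemma gridStrichartz_one {p δ : ℝ} (hp : 6 < p) (hδ : 0 < δ) (hδ' : δ < 1 / 2 - 3 / p) : GridStrichartz 1 p δ := by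
  have hp0 : 0 < p := by linarith
  have h1 : 6 < p - 2 * (δ * p) := by
    have := mul_lt_mul_of_pos_right hδ' hp0
    rw [sub_mul, div_mul_cancel₀ _ hp0.ne'] at this
    linarith
  refine gridStrichartz_of_cube le_rfl hδ (by linarith) (cube_moment_le le_rfl (p₁ := 6) (by norm_num) h1 ?_) hp0
  obtain ⟨C, hC, h⟩ := moment_one ((p - 2 * (δ * p) - 6) / 4) (by linarith)
  refine ⟨C, hC, fun N hN T _ c a hT ha => ?_⟩
  have h2 := h N hN T c a hT ha
  have e : ((1 : ℕ) : ℝ) * 6 / 2 - (1 : ℕ) - 2 + (1 : ℕ) * (p - 2 * (δ * p) - 6) / 4 = (p - 2 * (δ * p) - 6) / 4 := by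
    push_cast; ring
  rw [e]
  exact_mod_cast h2

lemma gridStrichartz_two {p δ : ℝ} (hp : 4 < p) (hδ : 0 < δ) (hδ' : δ < 1 / 2 - 2 / p) : GridStrichartz 2 p δ := by
  have hp0 : 0 < p := by linarith
  have h1 : 4 < p - 2 * (δ * p) := by
    have := mul_lt_mul_of_pos_right hδ' hp0
    rw [sub_mul, div_mul_cancel₀ _ hp0.ne'] at this
    linarith
  refine gridStrichartz_of_cube (by norm_num) hδ (by linarith)
    (cube_moment_le (by norm_num) (p₁ := 4) (by norm_num) h1 ?_) hp0
  obtain ⟨C, hC, h⟩ := moment_two (2 * (p - 2 * (δ * p) - 4) / 4) (by linarith)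
  refine ⟨C, hC, fun N hN T _ c a hT ha => ?_⟩
  have h2 := h N hN T c a hT ha
  have e : ((2 : ℕ) : ℝ) * 4 / 2 - (2 : ℕ) - 2 + (2 : ℕ) * (p - 2 * (δ * p) - 4) / 4 = 2 * (p - 2 * (δ * p) - 4) / 4 := by
    push_cast; ring
  rw [e]
  exact_mod_cast h2

lemma gridStrichartz_three {p δ : ℝ} (hp : 4 < p) (hδ : 0 < δ) (hδ' : δ < 1 / 2 - 2 / p) : GridStrichartz 3 p δ := by
  have hp0 : 0 < p := by linarith
  have h1 : 4 < p - 2 * (δ * p) := by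
    have := mul_lt_mul_of_pos_right hδ' hp0
    rw [sub_mul, div_mul_cancel₀ _ hp0.ne'] at this
    linarith
  refine gridStrichartz_of_cube (by norm_num) hδ (by linarith)
    (cube_moment_le (by norm_num) (p₁ := 4) (by norm_num) h1 ?_) hp0
  obtain ⟨C, hC, h⟩ := moment_three (3 * (p - 2 * (δ * p) - 4) / 4) (by linarith)
  refine ⟨C, hC, fun N hN T _ c a hT ha => ?_⟩
  have h2 := h N hN T c a hT ha
  have e : ((3 : ℕ) : ℝ) * 4 / 2 - (3 : ℕ) - 2 + (3 : ℕ) * (p - 2 * (δ * p) - 4) / 4 = 1 + 3 * (p - 2 * (δ * p) - 4) / 4 := by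
    push_cast; ring
  rw [e]
  exact_mod_cast h2

set_option maxHeartbeats 1000000 in
lemma gridStrichartz_of_four_le {n : ℕ} (hn : 4 ≤ n) {p δ : ℝ} (hp : 2 * ((n : ℝ) + 4) / n ≤ p)
    (hδ' : δ < 1 / 2 - ((n : ℝ) + 3) / (n * p)) : GridStrichartz n p δ := by
  have hn4 : (4 : ℝ) ≤ n := by exact_mod_cast hn
  have hn0 : (0 : ℝ) < n := by linarith
  set p₀ : ℝ := 2 + 8 / n with hp₀
  have hp₀p : p₀ ≤ p := by
    refine le_trans (le_of_eq ?_) hp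
    rw [hp₀]; field_simp; ring
  have hp₀0 : 0 < p₀ := by positivity
  have hp0 : 0 < p := by linarith
  have hκ₀ : δ * p - (p - p₀) / 2 < 1 / n := by
    have h1 := mul_lt_mul_of_pos_right hδ' hp0
    have h2 : (1 / 2 - ((n : ℝ) + 3) / (n * p)) * p = p / 2 - 1 - 3 / n := by field_simp; ring
    have h3 : (p - p₀) / 2 = p / 2 - 1 - 4 / n := by rw [hp₀]; ring
    have h4 : (4 : ℝ) / n = 3 / n + 1 / n := by ring
    rw [h2] at h1
    linarith
  obtain ⟨θ, hθ1, hθ2, hθ3⟩ : ∃ θ : ℝ, 1 < ((n : ℝ) - 1) * θ ∧ n * θ < 2 ∧ δ * p - (p - p₀) / 2 ≤ θ / 2 := by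
    set a := (1 / ((n : ℝ) - 1) + 2 / n) / 2 with ha
    have h1 : 1 / ((n : ℝ) - 1) < 2 / n := by
      rw [div_lt_div_iff₀ (by linarith) hn0]; linarith
    refine ⟨max a (2 * (δ * p - (p - p₀) / 2)), ?_, ?_, ?_⟩
    · have h2 : 1 / ((n : ℝ) - 1) < max a (2 * (δ * p - (p - p₀) / 2)) := lt_max_of_lt_left (by linarith)
      rwa [div_lt_iff₀' (by linarith)] at h2
    · have h2 : max a (2 * (δ * p - (p - p₀) / 2)) < 2 / n :=
        max_lt (by linarith) (by rw [show (2 : ℝ) / n = 2 * (1 / n) by ring]; linarith)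
      rwa [lt_div_iff₀' hn0] at h2
    · linarith [le_max_right a (2 * (δ * p - (p - p₀) / 2))]
  have hθ0 : 0 < θ := by
    by_contra h
    have : ((n : ℝ) - 1) * θ ≤ 0 := mul_nonpos_of_nonneg_of_nonpos (by linarith) (not_lt.1 h)
    linarith
  have hθn : θ < 2 / n := by rwa [lt_div_iff₀' hn0]
  set κ : ℝ := 1 / (((n + 5 : ℕ) : ℝ) - 1) with hκ
  set P : ℝ := 2 + 4 / n + (2 + 8 / n) * κ with hP
  have hκ' : κ = 1 / ((n : ℝ) + 4) := by rw [hκ]; push_cast; congr 1; ring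
  have hP' : P = 2 + 6 / n := by
    rw [hP, hκ']; field_simp; ring
  have hPp : P < p₀ := by
    rw [hP', hp₀]
    have : (6 : ℝ) / n < 8 / n := by gcongr; norm_num
    linarith
  obtain ⟨C₁, hC₁, hlow⟩ := strip_level (by omega : 2 ≤ n) hθ1 hθ2
  obtain ⟨C₂, hC₂, hhigh⟩ := sum_high_le (by omega : 1 ≤ n) (by omega : 2 ≤ n + 5) hκ hP hPp
  have hQp : 2 + 4 * θ < p₀ := by
    rw [hp₀]
    have : (8 : ℝ) / n = 4 * (2 / n) := by ring
    linarith
  have hr1 : ((1 : ℝ) / 2) ^ (p₀ - (2 + 4 * θ)) < 1 := Real.rpow_lt_one (by norm_num) (by norm_num) (by linarith)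
  set D : ℝ := 2 ^ (2 + 4 * θ) / (1 - (1 / 2) ^ (p₀ - (2 + 4 * θ))) with hD
  have hD0 : 0 ≤ D := div_nonneg (by positivity) (by linarith)
  set B₀ : ℝ := 3 ^ n * n with hB₀
  have hB₀0 : 0 < B₀ := by positivity
  refine ⟨B₀ ^ ((p - p₀) / 2) * (D * C₁ * C₂ ^ (p₀ - (2 + 4 * θ)) + C₂ * B₀ ^ ((1 : ℝ) / n)), by positivity, ?_⟩
  intro N hN T _ c hT M hM hMN v hv A a hsupp ha
  have hN0 : (0 : ℝ) < N := by exact_mod_cast hN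
  have hM0 : 0 < M := by linarith
  set W : ℝ := (Fintype.card (ZMod T × (Fin n → ZMod T)) : ℝ) with hW
  set u := gw T (cube c N) a with hu
  set s : ℝ := M / N with hs
  have hs0 : 0 < s := by positivity
  have hs1 : s ≤ 1 := (div_le_one hN0).2 hMN
  set B : ℝ := B₀ * ((N : ℝ) ^ (n : ℝ) * s) with hB
  have hsup : ∀ z, ‖u z‖ ^ 2 ≤ B := by
    intro z
    refine (norm_gw_strip_le (by omega) hN hM hv hsupp ha z).trans (le_of_eq ?_)
    rw [hB, hB₀]
    obtain ⟨k, rfl⟩ : ∃ k, n = k + 1 := ⟨n - 1, by omega⟩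
    rw [Real.rpow_natCast, Nat.add_sub_cancel, pow_succ (N : ℝ), hs]
    field_simp
  have hB0 : 0 < B := by positivity
  set M' : ℝ := √(M * N) with hM'
  have hM'sq : M' ^ 2 = M * N := Real.sq_sqrt (by positivity)
  have hM'M : M ≤ M' := Real.le_sqrt_of_sq_le (by nlinarith)
  have hM'N : M' / N = s ^ ((1 : ℝ) / 2) := by
    rw [← Real.sqrt_eq_rpow, hs, eq_comm, Real.sqrt_eq_iff_mul_self_eq (by positivity) (by positivity)]
    field_simp
    rw [hM'sq]
  set l : ℝ := C₂ * (N : ℝ) ^ ((n : ℝ) / 4) with hl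
  have hl0 : 0 < l := by positivity
  have h1 : ∑ z, (if 0 < ‖u z‖ ∧ ‖u z‖ ≤ l then ‖u z‖ ^ p₀ else 0) ≤
      W * (D * (C₁ * (N ^ (n - 1) * M') ^ θ) * l ^ (p₀ - (2 + 4 * θ))) := by
    refine sum_rpow_le_of_lvl u hQp hp₀0 (by positivity) le_rfl hl0 fun lam _ hlam _ => ?_
    have h2 := hlow N hN T hT.1 hT.2.1 hT.2.2.1 M' (hM.trans hM'M) (by rw [hM'sq]; nlinarith) v hv A c a
      (fun ξ h => ⟨(hsupp ξ h).1, (hsupp ξ h).2.trans hM'M⟩) ha lam hlam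
    rw [Real.div_rpow (by positivity) (by positivity), ← Real.rpow_natCast lam 4, ← Real.rpow_mul hlam.le, mul_div_assoc',
      le_div_iff₀ (by positivity), mul_assoc, ← Real.rpow_natCast lam 2, ← Real.rpow_add hlam] at h2
    push_cast at h2
    exact h2
  have h2 := hhigh N hN T c hT a (fun ξ h => (hsupp ξ h).1) ha (B ^ ((1 : ℝ) / 2)) (by positivity) (fun z => by
    rw [← Real.sqrt_eq_rpow]; exact Real.le_sqrt_of_sq_le (hsup z))
  have e1 : ((N : ℝ) ^ (n - 1) * M') ^ θ * l ^ (p₀ - (2 + 4 * θ)) =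
      C₂ ^ (p₀ - (2 + 4 * θ)) * ((N : ℝ) ^ (2 : ℝ) * s ^ (θ / 2)) := by
    have e2 : (N : ℝ) ^ (n - 1) * M' = (N : ℝ) ^ (n : ℝ) * s ^ ((1 : ℝ) / 2) := by
      rw [← hM'N]
      obtain ⟨k, rfl⟩ : ∃ k, n = k + 1 := ⟨n - 1, by omega⟩
      rw [Real.rpow_natCast, Nat.add_sub_cancel, pow_succ]
      field_simp
    rw [e2, hl, Real.mul_rpow (by positivity) (by positivity), Real.mul_rpow (by positivity) (by positivity),
      ← Real.rpow_mul hN0.le, ← Real.rpow_mul hN0.le, ← Real.rpow_mul hs0.le]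
    have e3 : (N : ℝ) ^ (2 : ℝ) = (N : ℝ) ^ ((n : ℝ) * θ) * (N : ℝ) ^ ((n : ℝ) / 4 * (p₀ - (2 + 4 * θ))) := by
      rw [← Real.rpow_add hN0, hp₀]; congr 1; field_simp; ring
    rw [e3, one_div_mul_eq_div]
    ring
  have e4 : (N : ℝ) ^ ((n + 4) * κ) * (B ^ ((1 : ℝ) / 2)) ^ (p₀ - P) = B₀ ^ ((1 : ℝ) / n) * ((N : ℝ) ^ (2 : ℝ) * s ^ ((1 : ℝ) / n)) := by
    have e5 : (1 : ℝ) / 2 * (p₀ - P) = 1 / n := by rw [hp₀, hP']; ring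
    rw [← Real.rpow_mul hB0.le, e5, hB, Real.mul_rpow (x := B₀) hB₀0.le (by positivity),
      Real.mul_rpow (x := (N : ℝ) ^ (n : ℝ)) (by positivity) (by positivity),
      ← Real.rpow_mul hN0.le]
    have e6 : (N : ℝ) ^ (2 : ℝ) = (N : ℝ) ^ (((n : ℝ) + 4) * κ) * (N : ℝ) ^ ((n : ℝ) * (1 / n)) := by
      rw [← Real.rpow_add hN0, hκ']; congr 1; field_simp; ring
    rw [e6]
    ring
  have h3 : s ^ ((1 : ℝ) / n) ≤ s ^ (θ / 2) :=
    Real.rpow_le_rpow_of_exponent_ge hs0 hs1 (by rw [show (1 : ℝ) / n = 2 / n / 2 by ring]; linarith)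
  have h4 : ∑ z, ‖u z‖ ^ p₀ ≤ W * ((D * C₁ * C₂ ^ (p₀ - (2 + 4 * θ)) + C₂ * B₀ ^ ((1 : ℝ) / n)) *
      ((N : ℝ) ^ (2 : ℝ) * s ^ (θ / 2))) := by
    have h5 : ∀ z, ‖u z‖ ^ p₀ ≤ (if 0 < ‖u z‖ ∧ ‖u z‖ ≤ l then ‖u z‖ ^ p₀ else 0) +
        if l < ‖u z‖ then ‖u z‖ ^ p₀ else 0 := by
      intro z
      rcases (norm_nonneg (u z)).eq_or_lt with h0 | h0
      · rw [← h0, Real.zero_rpow hp₀0.ne']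
        split_ifs <;> simp
      rcases le_or_gt (‖u z‖) l with h | h
      · rw [if_pos ⟨h0, h⟩, if_neg (not_lt.2 h), add_zero]
      · rw [if_neg (fun h' => absurd h'.2 (not_le.2 h)), if_pos h, zero_add]
    calc _ ≤ _ := Finset.sum_le_sum fun z _ => h5 z
      _ ≤ W * (D * (C₁ * (N ^ (n - 1) * M') ^ θ) * l ^ (p₀ - (2 + 4 * θ))) +
          W * (C₂ * (N : ℝ) ^ ((n + 4) * κ) * (B ^ ((1 : ℝ) / 2)) ^ (p₀ - P)) := by
        rw [Finset.sum_add_distrib]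
        exact add_le_add h1 h2
      _ = W * (D * C₁ * (((N : ℝ) ^ (n - 1) * M') ^ θ * l ^ (p₀ - (2 + 4 * θ))) +
          C₂ * ((N : ℝ) ^ ((n + 4) * κ) * (B ^ ((1 : ℝ) / 2)) ^ (p₀ - P))) := by ring
      _ ≤ W * (D * C₁ * (C₂ ^ (p₀ - (2 + 4 * θ)) * ((N : ℝ) ^ (2 : ℝ) * s ^ (θ / 2))) +
          C₂ * (B₀ ^ ((1 : ℝ) / n) * ((N : ℝ) ^ (2 : ℝ) * s ^ (θ / 2)))) := by
        rw [e1, e4]; gcongr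
      _ = _ := by ring
  have h6 := sum_rpow_le_sup_mul u hp₀0 hp₀p hsup
  have e7 : B ^ ((p - p₀) / 2) * ((N : ℝ) ^ (2 : ℝ) * s ^ (θ / 2)) =
      B₀ ^ ((p - p₀) / 2) * ((N : ℝ) ^ (n * p / 2 - n - 2) * s ^ ((p - p₀) / 2 + θ / 2)) := by
    rw [hB, Real.mul_rpow (x := B₀) hB₀0.le (by positivity),
      Real.mul_rpow (x := (N : ℝ) ^ (n : ℝ)) (by positivity) (by positivity),
      ← Real.rpow_mul hN0.le, Real.rpow_add hs0]
    have e8 : (N : ℝ) ^ (n * p / 2 - n - 2) = (N : ℝ) ^ ((n : ℝ) * ((p - p₀) / 2)) * (N : ℝ) ^ (2 : ℝ) := by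
      rw [← Real.rpow_add hN0, hp₀]; congr 1; field_simp; ring
    rw [e8]
    ring
  have h7 : s ^ ((p - p₀) / 2 + θ / 2) ≤ s ^ (δ * p) := Real.rpow_le_rpow_of_exponent_ge hs0 hs1 (by linarith)
  set E := D * C₁ * C₂ ^ (p₀ - (2 + 4 * θ)) + C₂ * B₀ ^ ((1 : ℝ) / n) with hE
  have hE0 : 0 ≤ E := by positivity
  calc _ ≤ _ := h6
    _ ≤ B ^ ((p - p₀) / 2) * (W * (E * ((N : ℝ) ^ (2 : ℝ) * s ^ (θ / 2)))) := mul_le_mul_of_nonneg_left h4 (by positivity)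
    _ = W * (E * (B ^ ((p - p₀) / 2) * ((N : ℝ) ^ (2 : ℝ) * s ^ (θ / 2)))) := by ring
    _ ≤ W * (E * (B₀ ^ ((p - p₀) / 2) * ((N : ℝ) ^ (n * p / 2 - n - 2) * s ^ (δ * p)))) := by
      rw [e7]; gcongr
    _ = _ := by ring

/-- The projection of space-time onto the torus. -/
noncomputable def torusMk (n : ℕ) (q : ℝ × (Fin n → ℝ)) : AddCircle (2 * π) × (Fin n → AddCircle (2 * π)) :=
  ((q.1 : AddCircle (2 * π)), fun i => (q.2 i : AddCircle (2 * π)))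

/-- Integrals over the period box of functions on the torus are translation invariant. -/
lemma setIntegral_stBox_add {n : ℕ} (F : AddCircle (2 * π) × (Fin n → AddCircle (2 * π)) → ℝ) (hF : Continuous F)
    (s : ℝ × (Fin n → ℝ)) :
    ∫ q in stBox n, F (torusMk n (s + q)) = ∫ q in stBox n, F (torusMk n q) := by
  have : Fact (0 < 2 * π) := ⟨Real.two_pi_pos⟩
  set μ : Measure (AddCircle (2 * π) × (Fin n → AddCircle (2 * π))) := volume with hμ
  have h0 : (volume : Measure (Fin n → AddCircle (2 * π))).IsAddLeftInvariant := inferInstance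
  have hinv : μ.IsAddLeftInvariant := Measure.prod.instIsAddLeftInvariant
  set J : Set (ℝ × (Fin n → ℝ)) := Set.Ioc 0 (2 * π) ×ˢ Set.univ.pi fun _ => Set.Ioc 0 (2 * π) with hJ
  have hae : (stBox n : Set (ℝ × (Fin n → ℝ))) =ᵐ[volume] J :=
    (Measure.set_prod_ae_eq Ioc_ae_eq_Icc Measure.pi_Ioc_ae_eq_pi_Icc).symm
  have hmp : MeasurePreserving (torusMk n) (volume.restrict J) μ := by
    have h1 : MeasurePreserving (fun x : ℝ => (x : AddCircle (2 * π))) (volume.restrict (Set.Ioc 0 (2 * π))) volume := by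
      have := AddCircle.measurePreserving_mk (2 * π) 0
      rwa [zero_add] at this
    have h2 := h1.prod (measurePreserving_pi (fun _ : Fin n => volume.restrict (Set.Ioc 0 (2 * π)))
      (fun _ => (volume : Measure (AddCircle (2 * π)))) fun _ => h1)
    rw [← Measure.restrict_pi_pi, Measure.prod_restrict] at h2
    exact h2
  have key : ∀ G : AddCircle (2 * π) × (Fin n → AddCircle (2 * π)) → ℝ, Continuous G →
      ∫ q in stBox n, G (torusMk n q) = ∫ g, G g ∂μ := by
    intro G hG
    rw [setIntegral_congr_set hae, ← hmp.map_eq, integral_map hmp.aemeasurable]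
    exact hG.aestronglyMeasurable
  have h1 : ∀ q, torusMk n (s + q) = torusMk n s + torusMk n q := fun q => by
    ext <;> simp [torusMk]
  simp_rw [h1]
  rw [key (fun g => F (torusMk n s + g)) (by fun_prop), key F hF]
  exact integral_add_left_eq_self F _

/-- Waves descend to the torus. -/
lemma exists_torus_wave {n : ℕ} (a : (Fin n → ℤ) →₀ ℂ) :
    ∃ F : AddCircle (2 * π) × (Fin n → AddCircle (2 * π)) → ℂ, Continuous F ∧
      ∀ q : ℝ × (Fin n → ℝ), F (torusMk n q) = tWave n a q.1 q.2 := by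
  refine ⟨fun g => ∑ ξ ∈ a.support, a ξ * (fourier (-∑ i, ξ i ^ 2) g.1 * ∏ i, fourier (ξ i) (g.2 i)), by fun_prop, ?_⟩
  intro q
  unfold tWave
  refine Finset.sum_congr rfl fun ξ _ => ?_
  congr 1
  simp only [torusMk, fourier_coe_apply]
  rw [← Complex.exp_sum, ← Complex.exp_add]
  congr 1
  have hpi : (π : ℂ) ≠ 0 := by exact_mod_cast Real.pi_ne_zero
  push_cast
  rw [mul_sub, Finset.mul_sum, add_comm, sub_eq_add_neg]
  congr 1
  · refine Finset.sum_congr rfl fun i _ => ?_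
    field_simp
  · field_simp

lemma continuous_tWave {n : ℕ} (a : (Fin n → ℤ) →₀ ℂ) : Continuous fun q : ℝ × (Fin n → ℝ) => tWave n a q.1 q.2 := by
  unfold tWave; fun_prop

/-- Averaging over a grid: an `L^p` bound for all discrete waves with the same coefficient moduli bounds a wave. -/
lemma integral_stBox_le_of_grid {n T N : ℕ} [NeZero T] (c : Fin n → ℤ) (a : (Fin n → ℤ) →₀ ℂ)
    (hsupp : ∀ ξ ∈ a.support, ξ ∈ cube c N) {p B : ℝ} (hp : 0 < p)
    (h : ∀ b : (Fin n → ℤ) → ℂ, (∀ ξ, ‖b ξ‖ = ‖a ξ‖) →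
      ∑ z, ‖gw T (cube c N) b z‖ ^ p ≤ Fintype.card (ZMod T × (Fin n → ZMod T)) * B) :
    ∫ q in stBox n, ‖tWave n a q.1 q.2‖ ^ p ≤ (2 * π) ^ (n + 1) * B := by
  classical
  obtain ⟨F, hF, hFa⟩ := exists_torus_wave a
  set s : ZMod T × (Fin n → ZMod T) → ℝ × (Fin n → ℝ) := fun z =>
    (-(2 * π * (z.1.val / T)), fun i => 2 * π * ((z.2 i).val / T)) with hs
  have hT0 : (0 : ℝ) < T := by exact_mod_cast Nat.pos_of_ne_zero (NeZero.ne T)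
  have h1 : ∀ z, ∫ q in stBox n, ‖tWave n a (s z + q).1 (s z + q).2‖ ^ p = ∫ q in stBox n, ‖tWave n a q.1 q.2‖ ^ p := by
    intro z
    simp_rw [← hFa]
    exact setIntegral_stBox_add (fun g => ‖F g‖ ^ p) (hF.norm.rpow_const fun _ => Or.inr hp.le) (s z)
  have hcomp : IsCompact (stBox n) := isCompact_Icc.prod (isCompact_univ_pi fun _ => isCompact_Icc)
  have hcont : ∀ z, Continuous fun q : ℝ × (Fin n → ℝ) => ‖tWave n a (s z + q).1 (s z + q).2‖ ^ p := fun z =>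
    ((continuous_tWave a).comp (continuous_const.add continuous_id)).norm.rpow_const fun _ => Or.inr hp.le
  have hint : ∀ z, IntegrableOn (fun q : ℝ × (Fin n → ℝ) => ‖tWave n a (s z + q).1 (s z + q).2‖ ^ p) (stBox n) := fun z =>
    (hcont z).continuousOn.integrableOn_compact hcomp
  have hpt : ∀ q : ℝ × (Fin n → ℝ), ∑ z, ‖tWave n a (s z + q).1 (s z + q).2‖ ^ p ≤
      Fintype.card (ZMod T × (Fin n → ZMod T)) * B := by
    intro q
    set b : (Fin n → ℤ) → ℂ := fun ξ => a ξ *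
      Complex.exp (Complex.I * (((∑ i, q.2 i * (ξ i : ℝ)) - q.1 * ∑ i, ((ξ i : ℝ)) ^ 2 : ℝ) : ℂ)) with hb
    have hba : ∀ ξ, ‖b ξ‖ = ‖a ξ‖ := by
      intro ξ
      rw [hb]
      simp only
      rw [norm_mul, mul_comm Complex.I, Complex.norm_exp_ofReal_mul_I, mul_one]
    refine le_trans (le_of_eq (Finset.sum_congr rfl fun z _ => ?_)) (h b hba)
    congr 2
    unfold tWave gw
    rw [Finset.sum_subset (s₁ := a.support) (s₂ := cube c N) hsupp fun ξ _ hξ => by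
      rw [Finsupp.notMem_support_iff.1 hξ, zero_mul]]
    refine Finset.sum_congr rfl fun ξ _ => ?_
    have hz := psi_intCast ξ (T := T) (z.1.val : ℤ) (fun i => ((z.2 i).val : ℤ))
    have e : z = ((((z.1.val : ℤ)) : ZMod T), fun i => ((((z.2 i).val : ℤ)) : ZMod T)) := by
      ext <;> simp
    rw [← e] at hz
    rw [hz, hb]
    simp only
    have e2 : (∑ i, (s z + q).2 i * (ξ i : ℝ)) - (s z + q).1 * ∑ i, ((ξ i : ℝ)) ^ 2 =
        ((∑ i, q.2 i * (ξ i : ℝ)) - q.1 * ∑ i, ((ξ i : ℝ)) ^ 2) + 2 * π * ∑ i, ((((z.2 i).val : ℤ) / T : ℝ) * ξ i +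
          (((z.1.val : ℤ) / T : ℝ)) * (ξ i : ℝ) ^ 2) := by
      simp only [hs, Prod.fst_add, Prod.snd_add, Pi.add_apply, Finset.mul_sum, ← Finset.sum_sub_distrib,
        ← Finset.sum_add_distrib]
      refine Finset.sum_congr rfl fun i _ => ?_
      push_cast
      ring
    rw [mul_assoc, ee, ← Complex.exp_add, e2]
    congr 2
    push_cast
    ring
  have hvol : volume.real (stBox n) = (2 * π) ^ (n + 1) := by
    rw [stBox, Measure.real, Measure.volume_eq_prod, Measure.prod_prod, volume_pi_pi]
    simp [Real.volume_Icc, ENNReal.toReal_mul, Real.pi_pos.le, pow_succ']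
  have hW : (0 : ℝ) < Fintype.card (ZMod T × (Fin n → ZMod T)) := by exact_mod_cast Fintype.card_pos
  refine le_of_mul_le_mul_left ?_ hW
  calc _ = ∑ z : ZMod T × (Fin n → ZMod T), ∫ q in stBox n, ‖tWave n a (s z + q).1 (s z + q).2‖ ^ p := by
        simp_rw [h1]
        rw [Finset.sum_const, Finset.card_univ, nsmul_eq_mul]
    _ = ∫ q in stBox n, ∑ z : ZMod T × (Fin n → ZMod T), ‖tWave n a (s z + q).1 (s z + q).2‖ ^ p :=
        (integral_finsetSum _ fun z _ => hint z).symm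
    _ ≤ ∫ q in stBox n, (Fintype.card (ZMod T × (Fin n → ZMod T)) * B) :=
        integral_mono (integrable_finsetSum _ fun z _ => hint z) (integrableOn_const hcomp.measure_ne_top) hpt
    _ = _ := by
        rw [setIntegral_const, hvol, smul_eq_mul]
        ring

lemma exists_goodGrid {n : ℕ} (c : Fin n → ℤ) (N : ℕ) : ∃ T : ℕ, T ≠ 0 ∧ GoodGrid c N T := by
  classical
  set K : ℕ := ∑ ξ ∈ cube c N, (∑ i, 8 * (ξ i).natAbs + 8 * ∑ i, (ξ i).natAbs ^ 2) with hK
  set L : ℕ := N ^ 2 + 8 * N + 1 + K with hL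
  have hf : 1 ≤ (64 * N).factorial := Nat.factorial_pos _
  have hLT : L ≤ (64 * N).factorial * L := Nat.le_mul_of_pos_left _ hf
  refine ⟨(64 * N).factorial * L, by positivity, fun q h1 h2 => (Nat.dvd_factorial h1 h2).mul_right _, by omega, by omega, ?_⟩
  intro ξ hξ
  have h1 : ∑ i, 8 * (ξ i).natAbs + 8 * ∑ i, (ξ i).natAbs ^ 2 ≤ K :=
    Finset.single_le_sum (f := fun ξ : Fin n → ℤ => ∑ i, 8 * (ξ i).natAbs + 8 * ∑ i, (ξ i).natAbs ^ 2)
      (fun _ _ => Nat.zero_le _) hξ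
  refine ⟨fun i => ?_, ?_⟩
  · have h2 : 8 * (ξ i).natAbs ≤ ∑ i, 8 * (ξ i).natAbs :=
      Finset.single_le_sum (f := fun i => 8 * (ξ i).natAbs) (fun _ _ => Nat.zero_le _) (mem_univ i)
    have h3 : 8 * (ξ i).natAbs < (64 * N).factorial * L := by omega
    rw [Int.abs_eq_natAbs]
    exact_mod_cast h3
  · have h3 : 8 * ∑ i, (ξ i).natAbs ^ 2 < (64 * N).factorial * L := by omega
    have h4 : ∑ i, ξ i ^ 2 = ((∑ i, (ξ i).natAbs ^ 2 : ℕ) : ℤ) := by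
      push_cast
      exact Finset.sum_congr rfl fun i _ => by rw [sq_abs]
    rw [h4]
    exact_mod_cast h3

lemma gw_smul {n T : ℕ} [NeZero T] (S : Finset (Fin n → ℤ)) (r : ℝ) (a : (Fin n → ℤ) → ℂ) (z : ZMod T × (Fin n → ZMod T)) :
    gw T S (fun ξ => (r : ℂ) * a ξ) z = r * gw T S a z := by
  unfold gw
  rw [Finset.mul_sum]
  exact Finset.sum_congr rfl fun ξ _ => by ring

/-- The discrete estimate implies the estimate on the torus. -/
lemma strichartz_of_grid {n : ℕ} {p δ : ℝ} (hp : 0 < p) (hδ : 0 < δ) (h : GridStrichartz n p δ) :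
    ∃ C > 0, ∀ M N : ℝ, 1 ≤ M → M ≤ N → ∀ R : Set (Fin n → ℤ), InStripClass n M N R →
      ∀ a : (Fin n → ℤ) →₀ ℂ, (∀ ξ ∈ a.support, ξ ∈ R) →
      boxLpNorm n p (tWave n a) ≤ C * N ^ ((n : ℝ) / 2 - ((n : ℝ) + 2) / p) * (M / N) ^ δ * l2Norm n a := by
  classical
  obtain ⟨C, hC, h⟩ := h
  set x : ℝ := (n : ℝ) / 2 - ((n : ℝ) + 2) / p with hx
  refine ⟨((2 * π) ^ (n + 1) * (C + 1)) ^ (1 / p) * 2 ^ |x|, by positivity, ?_⟩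
  rintro M N hM hMN R ⟨c, v, A, hv, rfl⟩ a ha
  have hM0 : 0 < M := by linarith
  have hN1 : 1 ≤ N := hM.trans hMN
  have hN0 : 0 < N := by linarith
  set N' : ℕ := ⌈N⌉₊ with hN'
  have hNN' : N ≤ N' := Nat.le_ceil N
  have hN'0 : (0 : ℝ) < N' := by linarith
  have hN'1 : 1 ≤ N' := by exact_mod_cast hN1.trans hNN'
  have hN'N : (N' : ℝ) ≤ 2 * N := by linarith [Nat.ceil_lt_add_one hN0.le]
  set s : ℝ := l2Norm n a with hs
  have hs0 : 0 ≤ s := Real.sqrt_nonneg _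
  have hsq : ∑ ξ ∈ a.support, ‖a ξ‖ ^ 2 = s ^ 2 := (Real.sq_sqrt (Finset.sum_nonneg fun _ _ => sq_nonneg _)).symm
  have hsupp : ∀ ξ, a ξ ≠ 0 → (∀ i, |ξ i - c i| ≤ N') ∧ |(∑ i, v i * ξ i) - A| ≤ M := by
    intro ξ hξ
    obtain ⟨h1, h2⟩ := ha ξ (Finsupp.mem_support_iff.2 hξ)
    refine ⟨fun i => ?_, h2⟩
    have := (h1 i).trans hNN'
    exact_mod_cast this
  have hcube : ∀ ξ ∈ a.support, ξ ∈ cube c N' := by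
    intro ξ hξ
    rw [mem_cube_iff]
    intro i
    have := abs_le.1 ((hsupp ξ (Finsupp.mem_support_iff.1 hξ)).1 i)
    omega
  rcases hs0.eq_or_lt with h0 | hs0
  · have ha0 : a = 0 := by
      ext ξ
      by_contra hξ
      have h1 := Finset.single_le_sum (f := fun ξ => ‖a ξ‖ ^ 2) (fun _ _ => sq_nonneg _) (Finsupp.mem_support_iff.2 hξ)
      rw [hsq, ← h0] at h1
      have h2 : 0 < ‖a ξ‖ := norm_pos_iff.2 hξ
      nlinarith
    have h1 : boxLpNorm n p (tWave n a) = 0 := by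
      simp [boxLpNorm, tWave, ha0, Real.zero_rpow hp.ne', Real.zero_rpow (inv_pos.2 hp).ne']
    rw [h1, ← h0, mul_zero]
  obtain ⟨T, hT0, hT⟩ := exists_goodGrid c N'
  have : NeZero T := ⟨hT0⟩
  set B : ℝ := C * ((N' : ℝ) ^ (n * p / 2 - n - 2) * (M / N') ^ (δ * p)) with hB
  have hgrid : ∀ b : (Fin n → ℤ) → ℂ, (∀ ξ, ‖b ξ‖ = ‖a ξ‖) →
      ∑ z, ‖gw T (cube c N') b z‖ ^ p ≤ Fintype.card (ZMod T × (Fin n → ZMod T)) * (s ^ p * B) := by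
    intro b hb
    set b' : (Fin n → ℤ) → ℂ := fun ξ => ((s⁻¹ : ℝ) : ℂ) * b ξ with hb'
    have hb'n : ∀ ξ, ‖b' ξ‖ = s⁻¹ * ‖a ξ‖ := fun ξ => by
      rw [hb']
      simp only
      rw [norm_mul, hb, Complex.norm_real, Real.norm_of_nonneg (by positivity)]
    have h1 := h N' hN'1 T c hT M hM (hMN.trans hNN') v hv A b' (fun ξ hξ => hsupp ξ (by
      rw [← norm_ne_zero_iff, hb'n] at hξ
      exact norm_ne_zero_iff.1 (right_ne_zero_of_mul hξ))) (by
      simp_rw [hb'n, mul_pow]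
      rw [← Finset.mul_sum, ← Finset.sum_subset hcube fun ξ _ hξ => by
        rw [Finsupp.notMem_support_iff.1 hξ, norm_zero, zero_pow two_ne_zero], hsq, ← mul_pow, inv_mul_cancel₀ hs0.ne',
        one_pow])
    have h2 : ∀ z, ‖gw T (cube c N') b z‖ ^ p = s ^ p * ‖gw T (cube c N') b' z‖ ^ p := by
      intro z
      rw [hb', gw_smul, norm_mul, Complex.norm_real, Real.norm_of_nonneg (by positivity),
        ← Real.mul_rpow hs0.le (by positivity), mul_inv_cancel_left₀ hs0.ne']
    simp_rw [h2]
    rw [← Finset.mul_sum]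
    calc _ ≤ _ := mul_le_mul_of_nonneg_left h1 (by positivity)
      _ = _ := by rw [hB]; ring
  have h1 := integral_stBox_le_of_grid c a hcube hp hgrid
  have hInn : 0 ≤ ∫ q in stBox n, ‖tWave n a q.1 q.2‖ ^ p := integral_nonneg fun _ => by positivity
  have h2 : boxLpNorm n p (tWave n a) ≤ ((2 * π) ^ (n + 1) * (C + 1)) ^ (1 / p) * (N' : ℝ) ^ x * (M / N') ^ δ * s := by
    have e1 : (2 * π) ^ (n + 1) * (s ^ p * B) ≤
        ((2 * π) ^ (n + 1) * (C + 1)) * ((N' : ℝ) ^ (n * p / 2 - n - 2) * (M / N') ^ (δ * p) * s ^ p) := by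
      calc _ = ((2 * π) ^ (n + 1) * C) * ((N' : ℝ) ^ (n * p / 2 - n - 2) * (M / N') ^ (δ * p) * s ^ p) := by rw [hB]; ring
        _ ≤ _ := by gcongr; linarith
    refine (Real.rpow_le_rpow hInn (h1.trans e1) (by positivity)).trans (le_of_eq ?_)
    rw [Real.mul_rpow (by positivity) (by positivity), Real.mul_rpow (y := s ^ p) (by positivity) (by positivity),
      Real.mul_rpow (x := (N' : ℝ) ^ _) (by positivity) (by positivity), ← Real.rpow_mul hN'0.le, ← Real.rpow_mul (by positivity),
      ← Real.rpow_mul hs0.le, mul_one_div_cancel hp.ne', Real.rpow_one, mul_assoc δ, mul_one_div_cancel hp.ne', mul_one,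
      show (n * p / 2 - n - 2) * (1 / p) = x by rw [hx]; field_simp; ring]
    ring
  have h3 : (N' : ℝ) ^ x ≤ 2 ^ |x| * N ^ x := by
    rcases le_total 0 x with h | h
    · rw [abs_of_nonneg h, ← Real.mul_rpow (by norm_num) hN0.le]
      exact Real.rpow_le_rpow hN'0.le hN'N h
    · exact (Real.rpow_le_rpow_of_nonpos hN0 hNN' h).trans
        (le_mul_of_one_le_left (by positivity) (Real.one_le_rpow (by norm_num) (abs_nonneg _)))
  have h4 : (M / N') ^ δ ≤ (M / N) ^ δ := Real.rpow_le_rpow (by positivity) (by gcongr) hδ.le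
  calc _ ≤ _ := h2
    _ ≤ ((2 * π) ^ (n + 1) * (C + 1)) ^ (1 / p) * (2 ^ |x| * N ^ x) * (M / N) ^ δ * s := by gcongr
    _ = _ := by ring

/-- improved Strichartz estimate with decay `(M/N)^δ` for frequencies
localized in a strip of width `2M` inside a cube of side `2N`. -/
theorem strichartz_strip_improved (n : ℕ) (p δ : ℝ) (h : AdmissibleStrichartz n p)
    (hδ1 : n = 1 → 0 < δ ∧ δ < 1 / 2 - 3 / p)
    (hδ23 : n = 2 ∨ n = 3 → 0 < δ ∧ δ < 1 / 2 - 2 / p)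
    (hδ4 : 4 ≤ n → 0 < δ ∧ δ < 1 / 2 - ((n : ℝ) + 3) / ((n : ℝ) * p)) :
    ∃ C > 0, ∀ M N : ℝ, 1 ≤ M → M ≤ N → ∀ R : Set (Fin n → ℤ),
      InStripClass n M N R →
      ∀ a : (Fin n → ℤ) →₀ ℂ, (∀ ξ ∈ a.support, ξ ∈ R) →
      boxLpNorm n p (tWave n a) ≤
        C * N ^ ((n : ℝ) / 2 - ((n : ℝ) + 2) / p) * (M / N) ^ δ * l2Norm n a := by
  rcases h with ⟨rfl, hp⟩ | ⟨rfl | rfl, hp⟩ | ⟨hn, hp⟩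
  · obtain ⟨h1, h2⟩ := hδ1 rfl
    exact strichartz_of_grid (by linarith) h1 (gridStrichartz_one hp h1 h2)
  · obtain ⟨h1, h2⟩ := hδ23 (Or.inl rfl)
    exact strichartz_of_grid (by linarith) h1 (gridStrichartz_two hp h1 h2)
  · obtain ⟨h1, h2⟩ := hδ23 (Or.inr rfl)
    exact strichartz_of_grid (by linarith) h1 (gridStrichartz_three hp h1 h2)
  · obtain ⟨h1, h2⟩ := hδ4 hn
    have hn0 : (0 : ℝ) < n := by exact_mod_cast (by omega : 0 < n)
    exact strichartz_of_grid (lt_of_lt_of_le (by positivity) hp) h1 (gridStrichartz_of_four_le hn hp h2)
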